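/- Let q ≥ 1, p = p_c(q) = √q/(1+√q), and let φ be a tail-trivial Gibbs measure for FK-percolation with parameters (p,q). Let ω be sampled from φ. Then the restriction of ω to the upper half-plane H contains at most one infinite primal cluster, and if this infinite cluster exists it almost surely contains infinitely many points of R × {0}. The same statements hold for dual clusters, and for all other half-planes. -/

import Mathlib

open MeasureTheory ProbabilityTheory Filter
open scoped ENNReal

noncomputable section

namespace FK

/-- Ambient vertex set: points of the plane with integer coordinates. -/
abbrev V : Type := ℤ × ℤ

variable (Adj : V → V → Prop)

/-- The edge set of the graph with adjacency relation `Adj`, as unordered pairs. -/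
def EdgeSet : Set (Sym2 V) := {e | ∃ u v : V, Adj u v ∧ e = s(u, v)}

/-- Edges of the graph. -/
abbrev Edge := {e : Sym2 V // e ∈ EdgeSet Adj}

/-- A percolation configuration: each edge is open (`true`) or closed (`false`). -/
abbrev Config := Edge Adj → Bool

/-- A vertex is an endpoint of an edge. -/
def Inc (v : V) (e : Edge Adj) : Prop := v ∈ (e : Sym2 V)

/-- The vertex set of a finite set of edges. -/
def vertexSet (D : Finset (Edge Adj)) : Set V := {v | ∃ e ∈ D, Inc Adj v e}

open Classical in
/-- The degree of a vertex in a finite set of edges. -/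
def degree (D : Finset (Edge Adj)) (v : V) : ℕ :=
  (D.filter fun e => Inc Adj v e).card

/-- Boundary of a finite domain: its vertices of degree less than `maxDeg`
(the degree of the full lattice). -/
def bdry (maxDeg : ℕ) (D : Finset (Edge Adj)) : Set V :=
  {v | v ∈ vertexSet Adj D ∧ degree Adj D v < maxDeg}

/-- `u` and `v` are connected by a path of `ω`-open edges, all belonging to `S`. -/
def ConnectedIn (ω : Config Adj) (S : Set (Edge Adj)) (u v : V) : Prop :=
  Relation.ReflTransGen
    (fun a b => ∃ e : Edge Adj, e ∈ S ∧ ω e = true ∧ Inc Adj a e ∧ Inc Adj b e) u v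

/-- `u` lies in an infinite cluster of `ω` restricted to the edges of `S`. -/
def InfCluster (ω : Config Adj) (S : Set (Edge Adj)) (u : V) : Prop :=
  {v | ConnectedIn Adj ω S u v}.Infinite

/-- The set of edges whose endpoints all belong to the region `S`. -/
def edgesInRegion (S : Set V) : Set (Edge Adj) := {e | ∀ v ∈ (e : Sym2 V), v ∈ S}

/-- The boundary condition induced on `D` by the configuration outside of `D`:
two boundary vertices are wired iff they are connected outside of `D`,
or both belong to infinite clusters of the configuration outside of `D`. -/
def inducedBC (maxDeg : ℕ) (D : Finset (Edge Adj)) (ω : Config Adj) :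
    Setoid (bdry Adj maxDeg D) :=
  Relation.EqvGen.setoid fun u v =>
    ConnectedIn Adj ω {e | e ∉ D} u.1 v.1 ∨
      (InfCluster Adj ω {e | e ∉ D} u.1 ∧ InfCluster Adj ω {e | e ∉ D} v.1)

/-- Extension of a local configuration on `D` by closed edges. -/
def extendBy (D : Finset (Edge Adj)) (η : {e // e ∈ D} → Bool) : Config Adj :=
  fun e => if h : e ∈ D then η ⟨e, h⟩ else false

open Classical in
/-- Number of open edges of a local configuration. -/
def openCount (D : Finset (Edge Adj)) (η : {e // e ∈ D} → Bool) : ℕ :=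
  (Finset.univ.filter fun e : {e // e ∈ D} => η e = true).card

/-- The number of clusters of the configuration `ω` in the domain `D`, where boundary
vertices wired together by `ξ` are identified. -/
def clusterCount (maxDeg : ℕ) (D : Finset (Edge Adj)) (ξ : Setoid (bdry Adj maxDeg D))
    (ω : Config Adj) : ℕ :=
  Nat.card (Quot fun u v : vertexSet Adj D =>
    (∃ e ∈ D, ω e = true ∧ Inc Adj u.1 e ∧ Inc Adj v.1 e) ∨
      ∃ hu : u.1 ∈ bdry Adj maxDeg D, ∃ hv : v.1 ∈ bdry Adj maxDeg D,
        ξ.r ⟨u.1, hu⟩ ⟨v.1, hv⟩)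

/-- The FK-percolation weight of a local configuration `η` on the domain `D` with
boundary condition `ξ`. -/
def fkWeight (p q : ℝ) (maxDeg : ℕ) (D : Finset (Edge Adj)) (ξ : Setoid (bdry Adj maxDeg D))
    (η : {e // e ∈ D} → Bool) : ℝ :=
  (p / (1 - p)) ^ openCount Adj D η * q ^ clusterCount Adj maxDeg D ξ (extendBy Adj D η)

/-- The finite-volume FK-percolation measure on the domain `D` with edge-intensity `p`,
cluster-weight `q` and boundary condition `ξ`. -/
def fkFin (p q : ℝ) (maxDeg : ℕ) (D : Finset (Edge Adj)) (ξ : Setoid (bdry Adj maxDeg D)) :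
    Measure ({e // e ∈ D} → Bool) :=
  (∑ η : {e // e ∈ D} → Bool, ENNReal.ofReal (fkWeight Adj p q maxDeg D ξ η))⁻¹ •
    ∑ η : {e // e ∈ D} → Bool,
      ENNReal.ofReal (fkWeight Adj p q maxDeg D ξ η) • Measure.dirac η

/-- Restriction of a configuration to the edges of `D`. -/
def restrictD (D : Finset (Edge Adj)) (ω : Config Adj) : {e // e ∈ D} → Bool := fun e => ω e.1

/-- The event `B` depends only on the edges outside of `D`. -/
def DependsOutside (D : Finset (Edge Adj)) (B : Set (Config Adj)) : Prop :=
  ∀ ω ω' : Config Adj, (∀ e : Edge Adj, e ∉ D → ω e = ω' e) → (ω ∈ B ↔ ω' ∈ B)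

/-- `φ` is a Gibbs measure for FK-percolation with parameters `(p, q)`:
for every finite domain `D` and boundary condition `ξ`, conditionally on the event that
the configuration outside `D` induces the boundary condition `ξ` and on any event
measurable with respect to the edges outside of `D`, the restriction of `φ` to `D`
is the finite-volume FK-percolation measure with boundary condition `ξ`. -/
def IsGibbs (maxDeg : ℕ) (p q : ℝ) (φ : Measure (Config Adj)) : Prop :=
  IsProbabilityMeasure φ ∧
    ∀ (D : Finset (Edge Adj)) (ξ : Setoid (bdry Adj maxDeg D)) (B : Set (Config Adj)),
      MeasurableSet B → DependsOutside Adj D B →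
      φ ({ω | inducedBC Adj maxDeg D ω = ξ} ∩ B) ≠ 0 →
      (φ[|{ω | inducedBC Adj maxDeg D ω = ξ} ∩ B]).map (restrictD Adj D) =
        fkFin Adj p q maxDeg D ξ

/-- The cylinder event prescribing the configuration on the edges of `D`. -/
def cylinder (D : Finset (Edge Adj)) (η : {e // e ∈ D} → Bool) : Set (Config Adj) :=
  {ω | ∀ e : {e // e ∈ D}, ω e.1 = η e}

/-- Weak convergence of measures on configurations: convergence of the probabilities of
all cylinder events. -/
def WeakLim (μs : ℕ → Measure (Config Adj)) (μ : Measure (Config Adj)) : Prop :=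
  ∀ (D : Finset (Edge Adj)) (η : {e // e ∈ D} → Bool),
    Tendsto (fun k => μs k (cylinder Adj D η)) atTop (nhds (μ (cylinder Adj D η)))

/-- A sequence of finite domains increasing to the full lattice. -/
def IsExhaustion (Dseq : ℕ → Finset (Edge Adj)) : Prop :=
  Monotone Dseq ∧ ∀ e : Edge Adj, ∃ k, e ∈ Dseq k

/-- `φ` is the free infinite-volume FK measure: the weak limit of finite-volume measures
with free boundary conditions along any exhaustion. -/
def IsFreeLimit (maxDeg : ℕ) (p q : ℝ) (φ : Measure (Config Adj)) : Prop :=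
  IsProbabilityMeasure φ ∧
    ∀ Dseq : ℕ → Finset (Edge Adj), IsExhaustion Adj Dseq →
      WeakLim Adj
        (fun k => (fkFin Adj p q maxDeg (Dseq k) ⊥).map (extendBy Adj (Dseq k))) φ

/-- `φ` is the wired infinite-volume FK measure: the weak limit of finite-volume measures
with wired boundary conditions along any exhaustion. -/
def IsWiredLimit (maxDeg : ℕ) (p q : ℝ) (φ : Measure (Config Adj)) : Prop :=
  IsProbabilityMeasure φ ∧
    ∀ Dseq : ℕ → Finset (Edge Adj), IsExhaustion Adj Dseq →
      WeakLim Adj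
        (fun k => (fkFin Adj p q maxDeg (Dseq k) ⊤).map (extendBy Adj (Dseq k))) φ

/-- Tail triviality: every event depending on no finite set of edges has probability 0 or 1. -/
def TailTrivial (φ : Measure (Config Adj)) : Prop :=
  ∀ B : Set (Config Adj), MeasurableSet B →
    (∀ D : Finset (Edge Adj), DependsOutside Adj D B) → φ B = 0 ∨ φ B = 1


open Classical in
/-- The finite set of edges of the graph with both endpoints in the finite vertex set `W`. -/
def finEdgesIn (W : Finset V) : Finset (Edge Adj) :=
  (((W ×ˢ W).filter fun p => Adj p.1 p.2).image fun p => s(p.1, p.2)).subtype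
    (· ∈ EdgeSet Adj)

/-- Adjacency of the square lattice `L`: vertices with even coordinate sum at
euclidean distance `√2`. -/
def AdjL (u v : V) : Prop :=
  Even (u.1 + u.2) ∧ Even (v.1 + v.2) ∧ (u.1 - v.1) ^ 2 = 1 ∧ (u.2 - v.2) ^ 2 = 1

end FK

namespace FK

/-! ### Additional structure on the square lattice: translations, duality, half-planes,
boxes and slit domains. -/

/-- Translation vectors of the square lattice `L`. -/
def IsLatticeVec (t : V) : Prop := Even (t.1 + t.2)

/-- Translation of the plane by `t`. -/
def shiftV (t : V) (v : V) : V := (v.1 + t.1, v.2 + t.2)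

lemma adjL_shift {t : V} (ht : IsLatticeVec t) {u v : V} (h : AdjL u v) :
    AdjL (shiftV t u) (shiftV t v) := by
  obtain ⟨hu, hv, h1, h2⟩ := h
  refine ⟨?_, ?_, ?_, ?_⟩
  · have e : (u.1 + t.1) + (u.2 + t.2) = (u.1 + u.2) + (t.1 + t.2) := by ring
    exact e ▸ hu.add ht
  · have e : (v.1 + t.1) + (v.2 + t.2) = (v.1 + v.2) + (t.1 + t.2) := by ring
    exact e ▸ hv.add ht
  · have e : (u.1 + t.1) - (v.1 + t.1) = u.1 - v.1 := by ring
    exact e ▸ h1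
  · have e : (u.2 + t.2) - (v.2 + t.2) = u.2 - v.2 := by ring
    exact e ▸ h2

lemma edgeSet_shift {t : V} (ht : IsLatticeVec t) {e : Sym2 V} (he : e ∈ EdgeSet AdjL) :
    Sym2.map (shiftV t) e ∈ EdgeSet AdjL := by
  obtain ⟨u, v, huv, rfl⟩ := he
  exact ⟨shiftV t u, shiftV t v, adjL_shift ht huv, by rw [Sym2.map_pair_eq]⟩

/-- Translation of an edge of the square lattice by a lattice vector. -/
def shiftEdge (t : V) (ht : IsLatticeVec t) (e : Edge AdjL) : Edge AdjL :=
  ⟨Sym2.map (shiftV t) e.1, edgeSet_shift ht e.2⟩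

/-- The shift of a configuration by a lattice vector. -/
def Shift (t : V) (ht : IsLatticeVec t) (ω : Config AdjL) : Config AdjL :=
  fun e => ω (shiftEdge t ht e)

/-- Dual vertices: points with odd coordinate sum, i.e. vertices of `L* = L + (1,0)`. -/
def IsDualV (w : V) : Prop := Odd (w.1 + w.2)

/-- The primal edge crossed by the dual edge joining the dual vertices `w` and `w'`. -/
def crossSym (w w' : V) : Sym2 V := s(((w.1, w'.2) : V), ((w'.1, w.2) : V))

/-- One step of a dual-open path: `w` and `w'` are adjacent dual vertices and the primal
edge crossing the dual edge between them belongs to `S` and is closed in `ω`. -/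
def DualStep (ω : Config AdjL) (S : Set (Edge AdjL)) (w w' : V) : Prop :=
  IsDualV w ∧ IsDualV w' ∧ (w.1 - w'.1) ^ 2 = 1 ∧ (w.2 - w'.2) ^ 2 = 1 ∧
    ∃ h : crossSym w w' ∈ EdgeSet AdjL,
      (⟨crossSym w w', h⟩ : Edge AdjL) ∈ S ∧ ω ⟨crossSym w w', h⟩ = false

/-- Connectivity by a dual-open path whose crossed primal edges all lie in `S`. -/
def DualConnectedIn (ω : Config AdjL) (S : Set (Edge AdjL)) (w w' : V) : Prop :=
  Relation.ReflTransGen (DualStep ω S) w w'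

/-- The dual vertex `w` lies in an infinite dual cluster. -/
def DualInfCluster (ω : Config AdjL) (S : Set (Edge AdjL)) (w : V) : Prop :=
  {w' | DualConnectedIn ω S w w'}.Infinite

/-- The upper half-plane `H = ℝ × [0, ∞)`. -/
def HP : Set V := {v | 0 ≤ v.2}

/-- The edges of the square lattice contained in the upper half-plane. -/
def HPedges : Set (Edge AdjL) := edgesInRegion AdjL HP

/-- The vertex set of the rectangle `[x1,x2] × [y1,y2]`. -/
def rectV (x1 x2 y1 y2 : ℤ) : Finset V := Finset.Icc x1 x2 ×ˢ Finset.Icc y1 y2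

/-- The edges of the box `Λ_n = [-n,n]²`. -/
def boxE (n : ℤ) : Finset (Edge AdjL) := finEdgesIn AdjL (rectV (-n) n (-n) n)

open Classical in
/-- The configuration in which precisely the edges of the upper half-plane are open. -/
def tau10 : Config AdjL := fun e => if e ∈ HPedges then true else false

/-- The self-dual (= critical) point `p_c(q) = √q / (1 + √q)`. -/
def pc (q : ℝ) : ℝ := Real.sqrt q / (1 + Real.sqrt q)

/-- The domain `[-N,N] × [0,N]`. -/
def hpDomain (N : ℤ) : Finset (Edge AdjL) := finEdgesIn AdjL (rectV (-N) N 0 N)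

/-- `φ` is the infinite-volume FK measure on the upper half-plane with Dobrushin boundary
conditions at parameters `(p,q)`: the weak limit, as `N → ∞`, of the finite-volume FK
measures on `[-N,N] × [0,N]` with the boundary conditions induced by `tau10`. -/
def IsHPDobrushin (p q : ℝ) (φ : Measure (Config AdjL)) : Prop :=
  IsProbabilityMeasure φ ∧
    WeakLim AdjL (fun N =>
      (fkFin AdjL p q 4 (hpDomain N) (inducedBC AdjL 4 (hpDomain N) tau10)).map
        (extendBy AdjL (hpDomain N))) φ

/-- The free and wired infinite-volume measures (at parameters `(p,q)`) differ. -/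
def FreeNeqWired (p q : ℝ) : Prop :=
  ∃ φ0 φ1 : Measure (Config AdjL),
    IsFreeLimit AdjL 4 p q φ0 ∧ IsWiredLimit AdjL 4 p q φ1 ∧ φ0 ≠ φ1

/-! #### The slit domain `Slit(M,N)` -/

/-- Points of the axis that are split in the slit domain `Slit(M,N)`. -/
def SplitPt (M N : ℤ) (v : V) : Prop := v.2 = 0 ∧ (v.1 < -M ∨ N < v.1)

open Classical in
/-- The copy (upper = `true` / lower = `false`) of the endpoint `u` to which the edge `e`
is attached in the slit domain. -/
def endSide (M N : ℤ) (u : V) (e : Edge AdjL) : Bool :=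
  if SplitPt M N u ∧ e ∉ HPedges then false else true

/-- Admissible slit vertices: pairs (vertex, side), the side being `true` except that split
points carry two copies. -/
def SlitVOK (M N : ℤ) (a : V × Bool) : Prop := a.2 = true ∨ SplitPt M N a.1

open Classical in
/-- The degree of a slit vertex in the finite edge set `D`. -/
def slitDeg (M N : ℤ) (D : Finset (Edge AdjL)) (a : V × Bool) : ℕ :=
  (D.filter fun e => Inc AdjL a.1 e ∧ a.2 = endSide M N a.1 e).card

/-- A slit vertex belongs to the finite slit graph spanned by `D`. -/
def SlitPresent (M N : ℤ) (D : Finset (Edge AdjL)) (a : V × Bool) : Prop :=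
  SlitVOK M N a ∧ 0 < slitDeg M N D a

/-- Boundary of the finite slit graph spanned by `D`: its vertices of degree `< 4`. -/
def slitBdry (M N : ℤ) (D : Finset (Edge AdjL)) : Set (V × Bool) :=
  {a | SlitPresent M N D a ∧ slitDeg M N D a < 4}

/-- Number of clusters of `ω` in the finite slit graph spanned by `D`, with boundary
vertices wired together according to `ξ`. -/
def slitClusterCount (M N : ℤ) (D : Finset (Edge AdjL)) (ξ : Setoid (V × Bool))
    (ω : Config AdjL) : ℕ :=
  Nat.card (Quot fun a b : {a : V × Bool // SlitPresent M N D a} =>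
    (∃ e ∈ D, ω e = true ∧ Inc AdjL a.1.1 e ∧ Inc AdjL b.1.1 e ∧
        a.1.2 = endSide M N a.1.1 e ∧ b.1.2 = endSide M N b.1.1 e) ∨
      (a.1 ∈ slitBdry M N D ∧ b.1 ∈ slitBdry M N D ∧ ξ.r a.1 b.1))

/-- FK weight of a local configuration on the finite slit graph. -/
def slitWeight (p q : ℝ) (M N : ℤ) (D : Finset (Edge AdjL)) (ξ : Setoid (V × Bool))
    (η : {e // e ∈ D} → Bool) : ℝ :=
  (p / (1 - p)) ^ openCount AdjL D η *
    q ^ slitClusterCount M N D ξ (extendBy AdjL D η)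

/-- Finite-volume FK measure on the slit graph spanned by `D`, with boundary
condition `ξ`. -/
def slitFin (p q : ℝ) (M N : ℤ) (D : Finset (Edge AdjL)) (ξ : Setoid (V × Bool)) :
    Measure ({e // e ∈ D} → Bool) :=
  (∑ η : {e // e ∈ D} → Bool, ENNReal.ofReal (slitWeight p q M N D ξ η))⁻¹ •
    ∑ η : {e // e ∈ D} → Bool,
      ENNReal.ofReal (slitWeight p q M N D ξ η) • Measure.dirac η

/-- The boundary condition on the slit graph which is wired on `∂Slit⁺` (the upper copies
of the split points) and free everywhere else. -/
def slitPlusBC (M N : ℤ) : Setoid (V × Bool) :=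
  Relation.EqvGen.setoid fun a b =>
    (SplitPt M N a.1 ∧ a.2 = true) ∧ (SplitPt M N b.1 ∧ b.2 = true)

/-- `φ` is the FK measure `φ^{1/0}_{Slit(M,N),p,q}` on `Slit(M,N)`, with wired boundary
conditions on `∂Slit⁺` and free boundary conditions on `∂Slit⁻`: the weak limit of the
finite-volume slit measures on `Λ_R ∩ Slit` as `R → ∞`. -/
def IsSlitMeasure (p q : ℝ) (M N : ℤ) (φ : Measure (Config AdjL)) : Prop :=
  IsProbabilityMeasure φ ∧
    WeakLim AdjL (fun R =>
      (slitFin p q M N (boxE R) (slitPlusBC M N)).map (extendBy AdjL (boxE R))) φ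

/-- The event that `z` is connected to `∂Slit⁺` by an open path contained in the upper
half-plane `H`. -/
def slitPlusConn (M N : ℤ) (z : V) : Set (Config AdjL) :=
  {ω | ∃ a : ℤ, (a < -M ∨ N < a) ∧ ConnectedIn AdjL ω HPedges z (a, 0)}

open Classical in
/-- The number of `c`-good points `(a, 0)`, `a ∈ [x1, x2]`, for the slit measure `φ`:
points of the primal lattice for which the probability of being connected to `∂Slit⁺`
inside `H` is at least `c`. -/
def goodCount (M N : ℤ) (φ : Measure (Config AdjL)) (c : ℝ) (x1 x2 : ℤ) : ℕ :=
  ((Finset.Icc x1 x2).filter fun a =>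
    Even a ∧ ENNReal.ofReal c ≤ φ (slitPlusConn M N (a, 0))).card

end FK

namespace FK

/-- The lattice half-plane with inner normal direction `a` and offset `t`. -/
def hpRegion (a : V) (t : ℤ) : Set V := {x | t ≤ a.1 * x.1 + a.2 * x.2}

/-- The edges of the square lattice contained in the half-plane `hpRegion a t`. -/
def hpE (a : V) (t : ℤ) : Set (Edge AdjL) := edgesInRegion AdjL (hpRegion a t)

/-- The boundary line of the half-plane `hpRegion a t`. -/
def hpLine (a : V) (t : ℤ) : Set V := {x | a.1 * x.1 + a.2 * x.2 = t}

end FK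

namespace FK

/-- Lower endpoint of the diagonal of parity `p` of the unit cell `c`. -/
def lo (p : ℤ) (c : V) : V := if (c.1 + c.2 + p) % 2 = 0 then c else (c.1 + 1, c.2)

/-- Upper endpoint of the diagonal of parity `p` of the unit cell `c`. -/
def hi (p : ℤ) (c : V) : V :=
  if (c.1 + c.2 + p) % 2 = 0 then (c.1 + 1, c.2 + 1) else (c.1, c.2 + 1)

/-- Connectivity by diagonals of parity `p` of the cells in `A`. -/
def conn (p : ℤ) (A : Set V) : Setoid V :=
  Relation.EqvGen.setoid fun u v => ∃ c ∈ A, u = lo p c ∧ v = hi p c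

/-- The cluster of `u` for the diagonals of parity `p` of the cells in `A`. -/
def cl (p : ℤ) (A : Set V) (u : V) : Set V := {v | conn p A u v}

/-- The cells of the upper half-plane. -/
def Hc : Set V := {c | 0 ≤ c.2}

lemma conn_step {p : ℤ} {A : Set V} {c : V} (h : c ∈ A) : conn p A (lo p c) (hi p c) :=
  Relation.EqvGen.rel _ _ ⟨c, h, rfl, rfl⟩

lemma conn_le_iff {p : ℤ} {A : Set V} {s : Setoid V} :
    conn p A ≤ s ↔ ∀ c ∈ A, s (lo p c) (hi p c) := by
  constructor
  · intro h c hc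
    exact h (conn_step hc)
  · intro h
    apply Setoid.eqvGen_le
    rintro x y ⟨c, hc, rfl, rfl⟩
    exact h c hc

lemma conn_mono {p : ℤ} {A B : Set V} (h : A ⊆ B) : conn p A ≤ conn p B :=
  conn_le_iff.2 fun _ hc => conn_step (h hc)

lemma conn_union (p : ℤ) (A B : Set V) : conn p (A ∪ B) = conn p A ⊔ conn p B := by
  apply le_antisymm
  · rw [conn_le_iff]
    rintro c (hc | hc)
    · exact (le_sup_left : conn p A ≤ conn p A ⊔ conn p B) (conn_step hc)
    · exact (le_sup_right : conn p B ≤ conn p A ⊔ conn p B) (conn_step hc)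
  · exact sup_le (conn_mono Set.subset_union_left) (conn_mono Set.subset_union_right)

lemma conn_inv {p : ℤ} {A : Set V} {α : Type*} (f : V → α)
    (h : ∀ c ∈ A, f (lo p c) = f (hi p c)) {u v : V} (huv : conn p A u v) : f u = f v := by
  have : conn p A ≤ Setoid.ker f := conn_le_iff.2 h
  exact this huv

lemma conn_refl (p : ℤ) (A : Set V) (u : V) : conn p A u u := (conn p A).refl u

lemma conn_symm {p : ℤ} {A : Set V} {u v : V} (h : conn p A u v) : conn p A v u :=
  (conn p A).symm h

lemma conn_trans {p : ℤ} {A : Set V} {u v w : V} (h : conn p A u v) (h' : conn p A v w) :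
    conn p A u w := (conn p A).trans h h'

lemma cl_mono {p : ℤ} {A B : Set V} (h : A ⊆ B) (u : V) : cl p A u ⊆ cl p B u :=
  fun _ hv => conn_mono h hv

lemma cl_eq {p : ℤ} {A : Set V} {u v : V} (h : conn p A u v) : cl p A u = cl p A v :=
  Set.ext fun _ => ⟨fun hw => conn_trans (conn_symm h) hw, fun hw => conn_trans h hw⟩

lemma lo_period (p : ℤ) : lo (p + 1 + 1) = lo p := by
  funext c; unfold lo; congr 1; simp only [eq_iff_iff]; omega

lemma hi_period (p : ℤ) : hi (p + 1 + 1) = hi p := by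
  funext c; unfold hi; congr 1; simp only [eq_iff_iff]; omega

lemma conn_period (p : ℤ) : conn (p + 1 + 1) = conn p := by
  funext A; unfold conn; rw [lo_period, hi_period]

lemma cl_period (p : ℤ) : cl (p + 1 + 1) = cl p := by
  funext A u; unfold cl; rw [conn_period]

/-- Sign relating the two diagonals of a cell. -/
def sg (p : ℤ) (c : V) : ℤ := if (c.1 + c.2 + p) % 2 = 0 then -1 else 1

/-- The pairing of the increments of `f` and `g` along the two diagonals of a cell. -/
def pairing (p : ℤ) (f g : V → ℤ) (c : V) : ℤ :=
  sg p c * (f (hi p c) - f (lo p c)) * (g (hi (p + 1) c) - g (lo (p + 1) c))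

lemma pairing_swap (p : ℤ) (f g : V → ℤ) (c : V) :
    pairing (p + 1) g f c = - pairing p f g c := by
  unfold pairing
  rw [lo_period, hi_period]
  have : sg (p + 1) c = - sg p c := by
    unfold sg; split_ifs <;> first | rfl | omega
  rw [this]; ring

/-- The cells around a vertex. -/
def star (v : V) : Finset V :=
  {v, (v.1 - 1, v.2), (v.1 - 1, v.2 - 1), (v.1, v.2 - 1)}

lemma lo_mem_star {p : ℤ} {c v : V} (h : lo p c = v) : c ∈ star v := by
  subst h; unfold lo star
  split_ifs <;> simp [Prod.ext_iff]

lemma hi_mem_star {p : ℤ} {c v : V} (h : hi p c = v) : c ∈ star v := by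
  subst h; unfold hi star
  split_ifs <;> simp [Prod.ext_iff]

lemma sum_pairing_single (p : ℤ) (g : V → ℤ) (v : V) :
    ∑ c ∈ star v, pairing p (fun w => if w = v then 1 else 0) g c = 0 := by
  obtain ⟨x, y⟩ := v
  have h1 : ((x, y) : V) ∉ ({(x - 1, y), (x - 1, y - 1), (x, y - 1)} : Finset V) := by
    simp; omega
  have h2 : ((x - 1, y) : V) ∉ ({(x - 1, y - 1), (x, y - 1)} : Finset V) := by
    simp; omega
  have h3 : ((x - 1, y - 1) : V) ∉ ({(x, y - 1)} : Finset V) := by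
    simp
  unfold star
  rw [Finset.sum_insert h1, Finset.sum_insert h2, Finset.sum_insert h3, Finset.sum_singleton]
  unfold pairing sg lo hi
  by_cases h : (x + y + p) % 2 = 0
  · have e1 : (x - 1 + y + p) % 2 ≠ 0 := by omega
    have e2 : (x - 1 + (y - 1) + p) % 2 = 0 := by omega
    have e3 : (x + (y - 1) + p) % 2 ≠ 0 := by omega
    have e4 : (x + y + (p + 1)) % 2 ≠ 0 := by omega
    have e5 : (x - 1 + y + (p + 1)) % 2 = 0 := by omega
    have e6 : (x - 1 + (y - 1) + (p + 1)) % 2 ≠ 0 := by omega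
    have e7 : (x + (y - 1) + (p + 1)) % 2 = 0 := by omega
    simp only [h, e1, e2, e3, e4, e5, e6, e7, if_true, if_false]
    simp [Prod.ext_iff]
  · have e1 : (x - 1 + y + p) % 2 = 0 := by omega
    have e2 : (x - 1 + (y - 1) + p) % 2 ≠ 0 := by omega
    have e3 : (x + (y - 1) + p) % 2 = 0 := by omega
    have e4 : (x + y + (p + 1)) % 2 = 0 := by omega
    have e5 : (x - 1 + y + (p + 1)) % 2 ≠ 0 := by omega
    have e6 : (x - 1 + (y - 1) + (p + 1)) % 2 = 0 := by omega
    have e7 : (x + (y - 1) + (p + 1)) % 2 ≠ 0 := by omega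
    simp only [h, e1, e2, e3, e4, e5, e6, e7, if_true, if_false]
    simp [Prod.ext_iff]

lemma sum_pairing (p : ℤ) (f g : V → ℤ) (S C : Finset V) (hS : ∀ v, v ∉ S → f v = 0)
    (hC : ∀ v ∈ S, star v ⊆ C) : ∑ c ∈ C, pairing p f g c = 0 := by
  have hf : ∀ w, f w = ∑ v ∈ S, f v * (if w = v then 1 else 0) := by
    intro w
    by_cases hw : w ∈ S
    · simp [hw]
    · simp [hw, hS w hw]
  have : ∀ c, pairing p f g c
      = ∑ v ∈ S, f v * pairing p (fun w => if w = v then 1 else 0) g c := by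
    intro c
    unfold pairing
    rw [hf (hi p c), hf (lo p c), ← Finset.sum_sub_distrib, Finset.mul_sum, Finset.sum_mul]
    refine Finset.sum_congr rfl fun v _ => ?_
    ring
  rw [Finset.sum_congr rfl fun c _ => this c, Finset.sum_comm]
  refine Finset.sum_eq_zero fun v hv => ?_
  rw [← Finset.mul_sum]
  rw [← Finset.sum_subset (hC v hv), sum_pairing_single, mul_zero]
  intro c _ hc
  have h1 : hi p c ≠ v := fun h => hc (hi_mem_star h)
  have h2 : lo p c ≠ v := fun h => hc (lo_mem_star h)
  simp [pairing, h1, h2]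

lemma pairing_eq_zero_of_nonneg {p : ℤ} {f g : V → ℤ}
    (hf : (Function.support f).Finite) (h : ∀ c, 0 ≤ pairing p f g c) (c : V) :
    pairing p f g c = 0 := by
  classical
  set S := hf.toFinset with hSdef
  have hS : ∀ v, v ∉ S → f v = 0 := by
    intro v hv
    simpa [S] using hv
  have hC : ∀ v ∈ S, star v ⊆ insert c (S.biUnion star) := by
    intro v hv
    exact (Finset.subset_biUnion_of_mem star hv).trans (Finset.subset_insert _ _)
  have := sum_pairing p f g S _ hS hC
  rw [Finset.sum_eq_zero_iff_of_nonneg fun c _ => h c] at this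
  exact this c (Finset.mem_insert_self _ _)

lemma exists_pairing_pos {p : ℤ} {f g : V → ℤ}
    (hf : (Function.support f).Finite ∨ (Function.support g).Finite) {c : V}
    (h : pairing p f g c < 0) : ∃ c', 0 < pairing p f g c' := by
  by_contra! hn
  rcases hf with hf | hf
  · have key : ∀ c, pairing p f (-g) c = - pairing p f g c := by
      intro c; simp only [pairing, Pi.neg_apply]; ring
    have := pairing_eq_zero_of_nonneg (p := p) (g := -g) hf
      (fun c => by rw [key]; linarith [hn c]) c
    rw [key] at this
    linarith
  · have := pairing_eq_zero_of_nonneg (p := p + 1) (g := f) hf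
      (fun c => by rw [pairing_swap]; linarith [hn c]) c
    rw [pairing_swap] at this
    linarith

lemma pairing_single_zero {p : ℤ} {f g : V → ℤ}
    (hf : (Function.support f).Finite ∨ (Function.support g).Finite) {e : V}
    (h : ∀ c, c ≠ e → pairing p f g c = 0) : pairing p f g e = 0 := by
  have key : ∀ c, pairing p f (-g) c = - pairing p f g c := by
    intro c; simp only [pairing, Pi.neg_apply]; ring
  rcases lt_trichotomy (pairing p f g e) 0 with h1 | h1 | h1
  · obtain ⟨c, hc⟩ := exists_pairing_pos hf h1
    by_cases hce : c = e
    · subst hce; linarith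
    · linarith [h c hce]
  · exact h1
  · have hf' : (Function.support f).Finite ∨ (Function.support (-g)).Finite := by
      rwa [Function.support_neg]
    obtain ⟨c, hc⟩ := exists_pairing_pos hf' (c := e) (by rw [key]; linarith)
    rw [key] at hc
    by_cases hce : c = e
    · subst hce; linarith
    · linarith [h c hce]

open Classical in
/-- Indicator function with integer values. -/
def ind (S : Set V) (v : V) : ℤ := if v ∈ S then 1 else 0

lemma ind_support (S : Set V) : Function.support (ind S) = S := by
  ext v
  unfold ind
  simp [Function.mem_support]

lemma ind_congr {S : Set V} {u v : V} (h : u ∈ S ↔ v ∈ S) : ind S u = ind S v := by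
  unfold ind
  by_cases hv : v ∈ S
  · rw [if_pos hv, if_pos (h.2 hv)]
  · rw [if_neg hv, if_neg fun hu => hv (h.1 hu)]

lemma ind_cl_step {p : ℤ} {A : Set V} {u c : V} (h : c ∈ A) :
    ind (cl p A u) (hi p c) = ind (cl p A u) (lo p c) :=
  ind_congr ⟨fun hh => conn_trans hh (conn_symm (conn_step h)),
    fun hh => conn_trans hh (conn_step h)⟩

lemma sg_ne_zero (p : ℤ) (c : V) : sg p c ≠ 0 := by unfold sg; split_ifs <;> decide

lemma conn_dual_of_finite {p : ℤ} {A : Set V} {e a b : V} (hab : (a = lo p e ∧ b = hi p e) ∨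
    (a = hi p e ∧ b = lo p e)) (hfin : (cl p (A \ {e}) a).Finite)
    (hnot : ¬ conn p (A \ {e}) a b) :
    conn (p + 1) (Aᶜ \ {e}) (lo (p + 1) e) (hi (p + 1) e) := by
  by_contra hcon
  have hz : pairing p (ind (cl p (A \ {e}) a))
      (ind (cl (p + 1) (Aᶜ \ {e}) (lo (p + 1) e))) e = 0 := by
    apply pairing_single_zero
    · left; rwa [ind_support]
    · intro c hc
      unfold pairing
      by_cases hcA : c ∈ A
      · rw [ind_cl_step (u := a) (show c ∈ A \ {e} from ⟨hcA, hc⟩)]; ring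
      · rw [ind_cl_step (p := p + 1) (u := lo (p + 1) e)
          (show c ∈ Aᶜ \ {e} from ⟨hcA, hc⟩)]; ring
  have ha : a ∈ cl p (A \ {e}) a := conn_refl _ _ _
  have hb : b ∉ cl p (A \ {e}) a := hnot
  have hl : lo (p + 1) e ∈ cl (p + 1) (Aᶜ \ {e}) (lo (p + 1) e) := conn_refl _ _ _
  have hh : hi (p + 1) e ∉ cl (p + 1) (Aᶜ \ {e}) (lo (p + 1) e) := hcon
  unfold pairing at hz
  have hs := sg_ne_zero p e
  rcases hab with ⟨rfl, rfl⟩ | ⟨rfl, rfl⟩ <;> simp [ind, ha, hb, hl, hh, hs] at hz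

lemma exists_flow {q : ℤ} {B : Set V} {u v : V} (h : conn q B u v) :
    ∃ J : V →₀ ℤ, (∀ c, c ∉ B → J c = 0) ∧
      ∀ f : V → ℤ, J.sum (fun c z => z * (f (hi q c) - f (lo q c))) = f v - f u := by
  induction h with
  | rel x y h =>
    obtain ⟨c, hc, rfl, rfl⟩ := h
    refine ⟨Finsupp.single c 1, fun d hd => ?_, fun f => ?_⟩
    · rw [Finsupp.single_apply_eq_zero]
      rintro rfl; exact absurd hc hd
    · rw [Finsupp.sum_single_index] <;> simp
  | refl x => exact ⟨0, by simp, by simp⟩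
  | symm x y _ ih =>
    obtain ⟨J, hJ, hf⟩ := ih
    refine ⟨-J, fun c hc => by simp [hJ c hc], fun f => ?_⟩
    rw [Finsupp.sum_neg_index (by simp)]
    simp only [neg_mul]
    rw [Finsupp.sum_neg, hf]; ring
  | trans x y z _ _ ih1 ih2 =>
    obtain ⟨J, hJ, hf⟩ := ih1
    obtain ⟨J', hJ', hf'⟩ := ih2
    refine ⟨J + J', fun c hc => by simp [hJ c hc, hJ' c hc], fun f => ?_⟩
    rw [Finsupp.sum_add_index' (by simp) (by intros; ring), hf, hf']; ring

/-- Partial sums of a cell function along a row. -/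
def rowSum (J : V →₀ ℤ) (v : V) : ℤ :=
  J.sum fun c z => if c.2 = v.2 ∧ c.1 < v.1 then z else 0

lemma rowSum_succ (J : V →₀ ℤ) (x y : ℤ) :
    rowSum J (x + 1, y) - rowSum J (x, y) = J (x, y) := by
  unfold rowSum
  rw [← Finsupp.sum_sub]
  have : (J.sum fun c z => (if c.2 = y ∧ c.1 < x + 1 then z else 0) -
      if c.2 = y ∧ c.1 < x then z else 0) = J.sum fun c z => if c = (x, y) then z else 0 := by
    refine Finsupp.sum_congr fun c _ => ?_
    simp only [Prod.ext_iff]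
    split_ifs <;> omega
  rw [this]
  exact Finsupp.sum_ite_self_eq' J (x, y)

lemma rowSum_consistent {q : ℤ} {J : V →₀ ℤ}
    (hJ : ∀ f : V → ℤ, J.sum (fun c z => z * (f (hi q c) - f (lo q c))) = 0) {x y : ℤ}
    (h : (x + y + q) % 2 = 0) : rowSum J (x, y) = rowSum J (x, y + 1) := by
  have := hJ fun v => if v.2 = y + 1 ∧ v.1 < x then 1 else 0
  have h2 : (J.sum fun c z => (if c.2 = y ∧ c.1 < x then z else 0) -
      if c.2 = y + 1 ∧ c.1 < x then z else 0) = 0 := by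
    refine Eq.trans ?_ this
    refine Finsupp.sum_congr fun c _ => ?_
    obtain ⟨a, b⟩ := c
    unfold hi lo
    by_cases hp : (a + b + q) % 2 = 0
    · simp only [hp, if_true]
      by_cases hb : b = y
      · subst hb
        have : a < x ↔ a + 1 < x := by omega
        simp [this]
      · have : b + 1 ≠ y + 1 := by omega
        simp [hb]
    · simp only [hp, if_false]
      by_cases hb : b = y
      · subst hb
        simp
      · have : b = y + 1 → (a < x ↔ a + 1 < x) := by omega
        by_cases hb2 : b = y + 1
        · simp [hb2, this hb2]
        · simp [hb, hb2]
  rw [Finsupp.sum_sub] at h2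
  unfold rowSum
  simp only
  linarith

lemma rowSum_total {q : ℤ} {J : V →₀ ℤ}
    (hJ : ∀ f : V → ℤ, J.sum (fun c z => z * (f (hi q c) - f (lo q c))) = 0) (y : ℤ) :
    (J.sum fun c z => if c.2 = y then z else 0) = 0 := by
  refine Eq.trans ?_ (hJ fun v => if y + 1 ≤ v.2 then 1 else 0)
  refine Finsupp.sum_congr fun c _ => ?_
  obtain ⟨a, b⟩ := c
  unfold hi lo
  split_ifs <;> simp only at * <;> omega

lemma rowSum_support {q : ℤ} {J : V →₀ ℤ}
    (hJ : ∀ f : V → ℤ, J.sum (fun c z => z * (f (hi q c) - f (lo q c))) = 0) :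
    (Function.support (rowSum J)).Finite := by
  classical
  apply Set.Finite.subset (Finset.finite_toSet
    (J.support.biUnion fun c => J.support.biUnion fun c' =>
      Finset.Icc c.1 c'.1 ×ˢ {c.2}))
  intro v hv
  rw [Function.mem_support] at hv
  obtain ⟨c, hc, hcz⟩ := Finset.exists_ne_zero_of_sum_ne_zero hv
  have h1 : c.2 = v.2 ∧ c.1 < v.1 := by
    by_contra hh
    exact hcz (if_neg hh)
  have h2 : (J.sum fun c z => if c.2 = v.2 ∧ ¬ c.1 < v.1 then z else 0) ≠ 0 := by
    intro h0
    apply hv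
    have h3 := rowSum_total hJ v.2
    have h4 : (J.sum fun c z => if c.2 = v.2 then z else 0)
        = (J.sum fun c z => if c.2 = v.2 ∧ ¬ c.1 < v.1 then z else 0) + rowSum J v := by
      unfold rowSum
      rw [← Finsupp.sum_add]
      refine Finsupp.sum_congr fun c _ => ?_
      by_cases ha : c.2 = v.2 <;> by_cases hb : c.1 < v.1 <;> simp [ha, hb]
    rw [h3, h0] at h4
    linarith
  obtain ⟨c', hc', hcz'⟩ := Finset.exists_ne_zero_of_sum_ne_zero h2
  have h5 : c'.2 = v.2 ∧ ¬ c'.1 < v.1 := by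
    by_contra hh
    exact hcz' (if_neg hh)
  simp only [Finset.coe_biUnion, Set.mem_iUnion, Finset.mem_coe, Finset.mem_product,
    Finset.mem_Icc, Finset.mem_singleton]
  exact ⟨c, hc, c', hc', ⟨by omega, by omega⟩, h1.1.symm⟩

lemma exists_stream {q : ℤ} {J : V →₀ ℤ}
    (hJ : ∀ f : V → ℤ, J.sum (fun c z => z * (f (hi q c) - f (lo q c))) = 0) :
    ∃ g : V → ℤ, (Function.support g).Finite ∧
      ∀ c, g (hi (q + 1) c) - g (lo (q + 1) c) = sg q c * J c := by
  refine ⟨rowSum J, rowSum_support hJ, fun c => ?_⟩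
  obtain ⟨x, y⟩ := c
  have hs := rowSum_succ J x y
  unfold hi lo sg
  by_cases hp : (x + y + q) % 2 = 0
  · have hp' : (x + y + (q + 1)) % 2 ≠ 0 := by omega
    simp only [hp, hp', if_true, if_false]
    have := rowSum_consistent hJ hp
    linarith
  · have hp' : (x + y + (q + 1)) % 2 = 0 := by omega
    simp only [hp, hp', if_true, if_false]
    have := rowSum_consistent hJ (x := x + 1) (y := y) (by omega)
    linarith

/-- A finitely supported potential separating the two sides of a cycle through `e`. -/
lemma exists_separating {q : ℤ} {B : Set V} {e : V} (he : e ∉ B)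
    (h : conn q B (lo q e) (hi q e)) :
    ∃ g : V → ℤ, (Function.support g).Finite ∧
      (∀ c, c ∉ B → c ≠ e → g (lo (q + 1) c) = g (hi (q + 1) c)) ∧
      g (lo (q + 1) e) ≠ g (hi (q + 1) e) := by
  obtain ⟨J, hJB, hJ⟩ := exists_flow h
  obtain ⟨g, hg, hgs⟩ := exists_stream (q := q) (J := J - Finsupp.single e 1) (by
    intro f
    rw [Finsupp.sum_sub_index (by intros; ring), hJ, Finsupp.sum_single_index (by simp)]
    ring)
  refine ⟨g, hg, fun c hc hce => ?_, ?_⟩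
  · have := hgs c
    rw [Finsupp.sub_apply, hJB c hc, Finsupp.single_eq_of_ne hce] at this
    linarith
  · have := hgs e
    rw [Finsupp.sub_apply, hJB e he, Finsupp.single_eq_same] at this
    intro h
    rw [h] at this
    have := sg_ne_zero q e
    simp_all

lemma cl_finite_of_ne_zero {p : ℤ} {A : Set V} {g : V → ℤ} (hg : (Function.support g).Finite)
    (h : ∀ c ∈ A, g (lo p c) = g (hi p c)) {u : V} (hu : g u ≠ 0) : (cl p A u).Finite := by
  apply hg.subset
  intro v hv
  rw [Function.mem_support, ← conn_inv g h hv]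
  exact hu

/-- Connectivity where all infinite clusters are identified. -/
def connI (p : ℤ) (A : Set V) : Setoid V where
  r u v := conn p A u v ∨ ((cl p A u).Infinite ∧ (cl p A v).Infinite)
  iseqv := by
    refine ⟨fun u => Or.inl (conn_refl _ _ _), ?_, ?_⟩
    · rintro u v (h | h)
      · exact Or.inl (conn_symm h)
      · exact Or.inr h.symm
    · rintro u v w (h | h) (h' | h')
      · exact Or.inl (conn_trans h h')
      · exact Or.inr ⟨by rw [cl_eq h]; exact h'.1, h'.2⟩
      · exact Or.inr ⟨h.1, by rw [← cl_eq h']; exact h.2⟩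
      · exact Or.inr ⟨h.1, h'.2⟩

lemma connI_def {p : ℤ} {A : Set V} {u v : V} :
    connI p A u v ↔ conn p A u v ∨ ((cl p A u).Infinite ∧ (cl p A v).Infinite) := Iff.rfl

/-- Planar duality at a single cell. -/
lemma connI_iff_not_dual (p : ℤ) (A : Set V) (e : V) :
    connI p (A \ {e}) (lo p e) (hi p e) ↔
      ¬ conn (p + 1) (Aᶜ \ {e}) (lo (p + 1) e) (hi (p + 1) e) := by
  constructor
  · rintro (h | h) h'
    · obtain ⟨g, hg, hg1, hg2⟩ := exists_separating (by simp) h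
      refine hg2 (conn_inv g (fun c hc => hg1 c ?_ hc.2) h')
      exact fun h => hc.1 h.1
    · obtain ⟨g, hg, hg1, hg2⟩ := exists_separating (by simp) h'
      rw [lo_period, hi_period] at *
      have hinv : ∀ c ∈ A \ {e}, g (lo p c) = g (hi p c) :=
        fun c hc => hg1 c (fun hh => hh.1 hc.1) hc.2
      by_cases h0 : g (lo p e) = 0
      · have h1 : g (hi p e) ≠ 0 := fun h1 => hg2 (h0.trans h1.symm)
        exact h.2 (cl_finite_of_ne_zero hg hinv h1)
      · exact h.1 (cl_finite_of_ne_zero hg hinv h0)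
  · intro h
    by_contra hn
    rw [connI_def, not_or, not_and_or, Set.not_infinite, Set.not_infinite] at hn
    rcases hn.2 with h1 | h1
    · exact h (conn_dual_of_finite (Or.inl ⟨rfl, rfl⟩) h1 hn.1)
    · exact h (conn_dual_of_finite (Or.inr ⟨rfl, rfl⟩) h1 fun hh => hn.1 (conn_symm hh))

/-- The vertex of parity `p` with first coordinate `x` on the row of cells at height `y`. -/
def zv (p y x : ℤ) : V := if (x + y + p) % 2 = 0 then (x, y) else (x, y + 1)

lemma conn_cell {p : ℤ} {A : Set V} {u v c : V} (h : c ∈ A)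
    (huv : (u = lo p c ∧ v = hi p c) ∨ (u = hi p c ∧ v = lo p c)) : conn p A u v := by
  rcases huv with ⟨rfl, rfl⟩ | ⟨rfl, rfl⟩
  · exact conn_step h
  · exact conn_symm (conn_step h)

lemma conn_row (p y x1 : ℤ) {A : Set V} (n : ℕ)
    (h : ∀ i, x1 ≤ i → i < x1 + n → ((i, y) : V) ∈ A) :
    conn p A (zv p y x1) (zv p y (x1 + n)) := by
  induction n with
  | zero => simp
  | succ n ih =>
    refine conn_trans (ih fun i h1 h2 => h i h1 (by push_cast; omega)) ?_
    refine conn_cell (h (x1 + n) (by omega) (by push_cast; omega)) ?_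
    unfold zv lo hi
    simp only
    have e : x1 + ((n + 1 : ℕ) : ℤ) = x1 + n + 1 := by push_cast; ring
    rw [e]
    by_cases hp : (x1 + ↑n + y + p) % 2 = 0
    · have : (x1 + ↑n + 1 + y + p) % 2 ≠ 0 := by omega
      simp [hp, this]
    · have : (x1 + ↑n + 1 + y + p) % 2 = 0 := by omega
      simp [hp, this]

lemma conn_row' (p y : ℤ) {x1 x2 : ℤ} (hx : x1 ≤ x2) {A : Set V}
    (h : ∀ i, x1 ≤ i → i < x2 → ((i, y) : V) ∈ A) :
    conn p A (zv p y x1) (zv p y x2) := by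
  obtain ⟨n, rfl⟩ := Int.le.dest hx
  exact conn_row p y x1 n h

lemma conn_row_vertices {p y x1 x2 : ℤ} (hx : x1 ≤ x2) {A : Set V}
    (h : ∀ i, x1 ≤ i → i < x2 → ((i, y) : V) ∈ A) (h1 : (x1 + y + p) % 2 = 0)
    (h2 : (x2 + y + p) % 2 = 0) : conn p A (x1, y) (x2, y) := by
  have := conn_row' p y hx h
  simpa [zv, h1, h2] using this

lemma hi_eq_lo_up (p x y : ℤ) : hi p (x, y) = lo p (x, y + 1) := by
  unfold hi lo
  by_cases hp : (x + y + p) % 2 = 0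
  · have : (x + (y + 1) + p) % 2 ≠ 0 := by omega
    simp [hp, this]
  · have : (x + (y + 1) + p) % 2 = 0 := by omega
    simp [hp, this]

lemma conn_col (p x y1 : ℤ) {A : Set V} (n : ℕ)
    (h : ∀ j, y1 ≤ j → j < y1 + n → ((x, j) : V) ∈ A) :
    conn p A (lo p (x, y1)) (lo p (x, y1 + n)) := by
  induction n with
  | zero => simp
  | succ n ih =>
    refine conn_trans (ih fun i h1 h2 => h i h1 (by push_cast; omega)) ?_
    have := conn_step (p := p) (h (y1 + n) (by omega) (by push_cast; omega))
    rw [hi_eq_lo_up] at this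
    convert this using 3
    push_cast; ring

lemma conn_col' (p x : ℤ) {y1 y2 : ℤ} (hy : y1 ≤ y2) {A : Set V}
    (h : ∀ j, y1 ≤ j → j < y2 → ((x, j) : V) ∈ A) :
    conn p A (lo p (x, y1)) (lo p (x, y2)) := by
  obtain ⟨n, rfl⟩ := Int.le.dest hy
  exact conn_col p x y1 n h

lemma lo_of_even {p x y : ℤ} (h : (x + y + p) % 2 = 0) : lo p (x, y) = (x, y) := by
  simp [lo, h]

lemma lo_parity (p : ℤ) (c : V) : ((lo p c).1 + (lo p c).2 + p) % 2 = 0 := by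
  unfold lo; split_ifs with h
  · exact h
  · simp only; omega

lemma hi_parity (p : ℤ) (c : V) : ((hi p c).1 + (hi p c).2 + p) % 2 = 0 := by
  unfold hi; split_ifs with h <;> simp only <;> omega

lemma lo_snd (p : ℤ) (c : V) : (lo p c).2 = c.2 := by unfold lo; split_ifs <;> rfl

lemma hi_snd (p : ℤ) (c : V) : (hi p c).2 = c.2 + 1 := by unfold hi; split_ifs <;> rfl

/-- The vertices of parity `p` in a half-plane are connected. -/
lemma conn_upper {p h : ℤ} {A : Set V} (hA : {c : V | h ≤ c.2} ⊆ A) {u v : V} (hu : h ≤ u.2)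
    (hv : h ≤ v.2) (hup : (u.1 + u.2 + p) % 2 = 0) (hvp : (v.1 + v.2 + p) % 2 = 0) :
    conn p A u v := by
  have key : ∀ w : V, h ≤ w.2 → (w.1 + w.2 + p) % 2 = 0 →
      conn p A w (lo p (w.1, h)) := by
    intro w hw hwp
    have := conn_col' p w.1 hw (A := A) fun j hj _ => hA hj
    rw [lo_of_even hwp] at this
    exact conn_symm this
  have row : ∀ x x' : ℤ, x ≤ x' → (x + h + p) % 2 = 0 → (x' + h + p) % 2 = 0 →
      conn p A (x, h) (x', h) := fun x x' hx h1 h2 =>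
    conn_row_vertices hx (fun i _ _ => hA (show h ≤ h from le_rfl)) h1 h2
  refine conn_trans (key u hu hup) (conn_trans ?_ (conn_symm (key v hv hvp)))
  have pu := lo_parity p (u.1, h)
  have pv := lo_parity p (v.1, h)
  have su := lo_snd p (u.1, h)
  have sv := lo_snd p (v.1, h)
  generalize lo p (u.1, h) = a at *
  generalize lo p (v.1, h) = b at *
  obtain ⟨a1, a2⟩ := a
  obtain ⟨b1, b2⟩ := b
  simp only at su sv pu pv
  subst su; subst sv
  rcases le_total a1 b1 with hab | hab
  · exact row _ _ hab pu pv
  · exact conn_symm (row _ _ hab pv pu)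

/-- The vertices of parity `p` in a lower half-plane are connected. -/
lemma conn_lower {p h : ℤ} {A : Set V} (hA : {c : V | c.2 < h} ⊆ A) {u v : V} (hu : u.2 ≤ h)
    (hv : v.2 ≤ h) (hup : (u.1 + u.2 + p) % 2 = 0) (hvp : (v.1 + v.2 + p) % 2 = 0) :
    conn p A u v := by
  have key : ∀ w : V, w.2 ≤ h → (w.1 + w.2 + p) % 2 = 0 →
      conn p A w (lo p (w.1, h)) := by
    intro w hw hwp
    have := conn_col' p w.1 hw (A := A) fun j _ hj => hA hj
    rwa [lo_of_even hwp] at this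
  have row : ∀ x x' : ℤ, x ≤ x' → (x + h + p) % 2 = 0 → (x' + h + p) % 2 = 0 →
      conn p A (x, h) (x', h) := by
    intro x x' hx h1 h2
    have := conn_row' p (h - 1) hx (A := A) fun i _ _ => hA (show h - 1 < h by omega)
    have e1 : (x + (h - 1) + p) % 2 ≠ 0 := by omega
    have e2 : (x' + (h - 1) + p) % 2 ≠ 0 := by omega
    simpa [zv, e1, e2] using this
  refine conn_trans (key u hu hup) (conn_trans ?_ (conn_symm (key v hv hvp)))
  have pu := lo_parity p (u.1, h)
  have pv := lo_parity p (v.1, h)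
  have su := lo_snd p (u.1, h)
  have sv := lo_snd p (v.1, h)
  generalize lo p (u.1, h) = a at *
  generalize lo p (v.1, h) = b at *
  obtain ⟨a1, a2⟩ := a
  obtain ⟨b1, b2⟩ := b
  simp only at su sv pu pv
  subst su; subst sv
  rcases le_total a1 b1 with hab | hab
  · exact row _ _ hab pu pv
  · exact conn_symm (row _ _ hab pv pu)

lemma conn_eq_or {p : ℤ} {A : Set V} {u v : V} (h : conn p A u v) :
    u = v ∨ ((u.1 + u.2 + p) % 2 = 0 ∧ (v.1 + v.2 + p) % 2 = 0) := by
  have := conn_inv (fun w : V => if (w.1 + w.2 + p) % 2 = 0 then none else some w)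
    (fun c _ => by simp [lo_parity, hi_parity, -EuclideanDomain.mod_eq_zero]) h
  split_ifs at this with h1 h2 h2
  · exact Or.inr ⟨h1, h2⟩
  · exact Or.inl (Option.some.inj this)

lemma conn_parity {p : ℤ} {A : Set V} {u v : V} (h : conn p A u v) (huv : u ≠ v) :
    (u.1 + u.2 + p) % 2 = 0 ∧ (v.1 + v.2 + p) % 2 = 0 := (conn_eq_or h).resolve_left huv

lemma cl_finite_of_parity {p : ℤ} {A : Set V} {u : V} (h : (u.1 + u.2 + p) % 2 ≠ 0) :
    (cl p A u).Finite := by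
  apply (Set.finite_singleton u).subset
  intro v hv
  rcases conn_eq_or hv with h' | h'
  · exact h'.symm
  · exact absurd h'.1 h

/-- A path in the upper half-plane joining two boundary points encloses the dual clusters
of the boundary points in between. -/
lemma enclosure {q : ℤ} {B : Set V} {x1 x2 x : ℤ} (hB : B ⊆ Hc)
    (h : conn q B (x1, 0) (x2, 0)) (h1 : x1 < x) (h2 : x < x2) :
    (cl (q + 1) (B ∪ {c | c.2 = -1 ∧ x1 ≤ c.1 ∧ c.1 < x2})ᶜ (x, 0)).Finite := by
  by_cases hx : (x + 0 + (q + 1)) % 2 = 0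
  swap
  · exact cl_finite_of_parity hx
  have hne : ((x1, 0) : V) ≠ (x2, 0) := by simp [Prod.ext_iff]; omega
  obtain ⟨p1, p2⟩ := conn_parity h hne
  simp only at p1 p2
  set Z : Set V := {c | c.2 = -1 ∧ x1 ≤ c.1 ∧ c.1 < x2} with hZ
  have he : ((x, -1) : V) ∉ (B ∪ Z) \ {(x, -1)} := by simp
  have hBe : B ⊆ (B ∪ Z) \ {(x, -1)} := by
    intro c hc
    refine ⟨Or.inl hc, ?_⟩
    rintro rfl
    have : (0 : ℤ) ≤ -1 := hB hc
    omega
  have z1 : zv q (-1) x1 = (x1, 0) := by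
    have : (x1 + -1 + q) % 2 ≠ 0 := by omega
    simp [zv, this]
  have z2 : zv q (-1) x2 = (x2, 0) := by
    have : (x2 + -1 + q) % 2 ≠ 0 := by omega
    simp [zv, this]
  have z3 : zv q (-1) x = lo q (x, -1) := by
    have e2 : (x + -1 + q) % 2 = 0 := by omega
    simp only [zv, e2, lo, if_true]
  have z4 : zv q (-1) (x + 1) = hi q (x, -1) := by
    have e1 : (x + 1 + -1 + q) % 2 ≠ 0 := by omega
    have e2 : (x + -1 + q) % 2 = 0 := by omega
    simp only [zv, e1, hi, e2, if_true, if_false]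
  have r1 := conn_row' q (-1) h1.le (A := (B ∪ Z) \ {(x, -1)}) (by
    intro i hi1 hi2
    refine ⟨Or.inr ⟨rfl, hi1, by simp only; omega⟩, ?_⟩
    simp only [Set.mem_singleton_iff, Prod.ext_iff, not_and]
    omega)
  have r2 := conn_row' q (-1) (show x + 1 ≤ x2 by omega) (A := (B ∪ Z) \ {(x, -1)}) (by
    intro i hi1 hi2
    refine ⟨Or.inr ⟨rfl, by simp only; omega, hi2⟩, ?_⟩
    simp only [Set.mem_singleton_iff, Prod.ext_iff, not_and]
    omega)
  rw [z1, z3] at r1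
  rw [z4, z2] at r2
  obtain ⟨g, hg, hg1, hg2⟩ := exists_separating he
    (conn_trans (conn_symm r1) (conn_trans (conn_mono hBe h) (conn_symm r2)))
  have hinv : ∀ c ∈ (B ∪ Z)ᶜ, g (lo (q + 1) c) = g (hi (q + 1) c) := by
    intro c hc
    refine hg1 c (fun hh => hc hh.1) ?_
    rintro rfl
    exact hc (Or.inr ⟨rfl, h1.le, h2⟩)
  have l1 : lo (q + 1) (x, -1) = (x + 1, -1) := by
    have : (x + -1 + (q + 1)) % 2 ≠ 0 := by omega
    simp only [lo, this, if_false]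
  have l2 : hi (q + 1) (x, -1) = (x, 0) := by
    have : (x + -1 + (q + 1)) % 2 ≠ 0 := by omega
    simp [hi, this]
  rw [l1, l2] at hg2
  have h0 : g (x + 1, -1) = 0 := by
    by_contra hne
    have := cl_finite_of_ne_zero hg hinv hne
    refine this.not_infinite (Set.infinite_of_injective_forall_mem
      (f := fun n : ℕ => ((x + 1 + 2 * n, -1) : V)) ?_ ?_)
    · intro m n hmn
      simp [Prod.ext_iff] at hmn
      exact hmn
    · intro n
      refine conn_lower (h := -1) ?_ le_rfl le_rfl ?_ ?_
      · rintro c hc (hcB | hcZ)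
        · have h1 : 0 ≤ c.2 := hB hcB
          have h2 : c.2 < -1 := hc
          omega
        · have h1 : c.2 = -1 := hcZ.1
          have h2 : c.2 < -1 := hc
          omega
      · simp only; omega
      · simp only; omega
  refine cl_finite_of_ne_zero hg hinv ?_
  rw [h0] at hg2
  exact fun h => hg2 h.symm

lemma conn_restrict {p : ℤ} {A : Set V} {u v : V} (h : conn p A u v) :
    conn p {c ∈ A | conn p A u (lo p c)} u v := by
  have key : ∀ a b, conn p A a b → conn p A u a → conn p {c ∈ A | conn p A u (lo p c)} a b := by
    intro a b hab
    induction hab with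
    | rel x y h =>
      obtain ⟨c, hc, rfl, rfl⟩ := h
      intro hu
      exact conn_step ⟨hc, hu⟩
    | refl x => intro _; exact conn_refl _ _ _
    | symm x y hxy ih =>
      intro hu
      exact conn_symm (ih (conn_trans hu (conn_symm hxy)))
    | trans x y z hxy _ ih1 ih2 =>
      intro hu
      exact conn_trans (ih1 hu) (ih2 (conn_trans hu hxy))
  exact key u v h (conn_refl _ _ _)

lemma lo_shift (p : ℤ) (c : V) : lo (p + 1) (c.1 + 1, c.2) = ((lo p c).1 + 1, (lo p c).2) := by
  unfold lo
  by_cases h : (c.1 + c.2 + p) % 2 = 0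
  · have : (c.1 + 1 + c.2 + (p + 1)) % 2 = 0 := by omega
    simp only [h, this, if_true]
  · have : (c.1 + 1 + c.2 + (p + 1)) % 2 ≠ 0 := by omega
    simp only [h, this, if_false]

lemma hi_shift (p : ℤ) (c : V) : hi (p + 1) (c.1 + 1, c.2) = ((hi p c).1 + 1, (hi p c).2) := by
  unfold hi
  by_cases h : (c.1 + c.2 + p) % 2 = 0
  · have : (c.1 + 1 + c.2 + (p + 1)) % 2 = 0 := by omega
    simp only [h, this, if_true]
  · have : (c.1 + 1 + c.2 + (p + 1)) % 2 ≠ 0 := by omega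
    simp only [h, this, if_false]

lemma lo_shift_touch (p : ℤ) (c : V) :
    lo p (c.1 + 1, c.2) = lo p c ∨ hi p (c.1 + 1, c.2) = hi p c := by
  unfold lo hi
  by_cases h : (c.1 + c.2 + p) % 2 = 0
  · right
    have : (c.1 + 1 + c.2 + p) % 2 ≠ 0 := by omega
    simp only [h, this, if_true, if_false]
  · left
    have : (c.1 + 1 + c.2 + p) % 2 = 0 := by omega
    simp only [h, this, if_true, if_false]

/-- A cluster squeezed between boundary points of another one is finite. -/
lemma finite_of_between {p : ℤ} {A : Set V} (hA : A ⊆ Hc) {x1 x2 x : ℤ}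
    (h : conn p A (x1, 0) (x2, 0)) (h1 : x1 < x) (h2 : x < x2)
    (hx : ¬ conn p A (x1, 0) (x, 0)) : (cl p A (x, 0)).Finite := by
  by_cases hpx : (x + 0 + p) % 2 = 0
  swap
  · exact cl_finite_of_parity hpx
  have hne : ((x1, 0) : V) ≠ (x2, 0) := by simp [Prod.ext_iff]; omega
  obtain ⟨p1, p2⟩ := conn_parity h hne
  simp only at p1 p2
  set B : Set V := {c ∈ A | conn p A (x1, 0) (lo p c)} with hB
  have hfin := enclosure (B := B) (fun c hc => hA hc.1) (conn_restrict h)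
    (show x1 < x + 1 by omega) (show x + 1 < x2 by omega)
  set D : Set V := (B ∪ {c | c.2 = -1 ∧ x1 ≤ c.1 ∧ c.1 < x2})ᶜ with hD
  have hinj : Function.Injective fun v : V => ((v.1 + 1, v.2) : V) := by
    rintro ⟨a, b⟩ ⟨c, d⟩ hh
    simpa [Prod.ext_iff] using hh
  refine Set.Finite.subset (hfin.preimage hinj.injOn) ?_
  intro v hv
  have key := conn_inv (p := p) (A := {c ∈ A | conn p A (x, 0) (lo p c)})
    (fun w : V => conn (p + 1) D (x + 1, 0) (w.1 + 1, w.2)) (by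
      rintro c ⟨hcA, hc⟩
      have hcD : ((c.1 + 1, c.2) : V) ∈ D := by
        rintro (⟨hc1, hc2⟩ | hc1)
        · apply hx
          rcases lo_shift_touch p c with ht | ht
          · rw [ht] at hc2
            exact conn_trans hc2 (conn_symm hc)
          · refine conn_trans hc2 (conn_trans (conn_step hc1) ?_)
            rw [ht]
            exact conn_symm (conn_trans hc (conn_step hcA))
        · have h3 : 0 ≤ c.2 := hA hcA
          have h4 : c.2 = -1 := hc1.1
          omega
      have hst := conn_step (p := p + 1) hcD
      rw [lo_shift, hi_shift] at hst
      exact propext ⟨fun hh => conn_trans hh hst, fun hh => conn_trans hh (conn_symm hst)⟩)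
    (conn_restrict hv)
  simp only [eq_iff_iff] at key
  exact key.1 (conn_refl _ _ _)

lemma conn_snd_nonneg {p : ℤ} {A : Set V} (hA : A ⊆ Hc) {u v : V} (hu : 0 ≤ u.2)
    (h : conn p A u v) : 0 ≤ v.2 := by
  have := conn_inv (fun w : V => 0 ≤ w.2) (by
    intro c hc
    have h1 : 0 ≤ c.2 := hA hc
    simp only [lo_snd, hi_snd, eq_iff_iff]
    omega) h
  simp only [eq_iff_iff] at this
  exact this.1 hu

lemma dual_finite_of_between {p : ℤ} {A : Set V} (hA : A ⊆ Hc) {x1 x2 x : ℤ}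
    (h : conn p A (x1, 0) (x2, 0)) (h1 : x1 < x) (h2 : x < x2) :
    (cl (p + 1) (Hc \ A) (x, 0)).Finite := by
  refine (enclosure hA h h1 h2).subset (cl_mono ?_ _)
  rintro c ⟨hc1, hc2⟩ (hc | hc)
  · exact hc2 hc
  · have h3 : 0 ≤ c.2 := hc1
    have h4 : c.2 = -1 := hc.1
    omega

lemma dual_finite_of_between' {p : ℤ} {A : Set V} (hA : A ⊆ Hc) {x1 x2 x : ℤ}
    (h : conn (p + 1) (Hc \ A) (x1, 0) (x2, 0)) (h1 : x1 < x) (h2 : x < x2) :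
    (cl p A (x, 0)).Finite := by
  have := dual_finite_of_between (fun c hc => hc.1) h h1 h2
  rwa [cl_period, Set.sdiff_sdiff_right_self, Set.inter_eq_right.2 hA] at this

/-- The dual cluster next to the leftmost boundary point of an infinite cluster is infinite. -/
lemma dual_infinite_of_leftmost {p : ℤ} {A : Set V} (hA : A ⊆ Hc) {a : ℤ}
    (hinf : (cl p A (a, 0)).Infinite) (hleft : ∀ x : ℤ, conn p A (a, 0) (x, 0) → a ≤ x) :
    (cl (p + 1) (Hc \ A) (a - 1, 0)).Infinite := by
  intro hfin
  have hpa : (a + 0 + p) % 2 = 0 := by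
    by_contra hh
    exact hinf (cl_finite_of_parity hh)
  set f := ind (cl p A (a, 0)) with hf
  set g := ind (cl (p + 1) (Hc \ A) (a - 1, 0)) with hg
  have hf0 : ∀ v : V, v.2 < 0 → f v = 0 := by
    intro v hv
    refine if_neg fun hh => ?_
    have := conn_snd_nonneg hA le_rfl hh
    omega
  have hg0 : ∀ v : V, v.2 < 0 → g v = 0 := by
    intro v hv
    refine if_neg fun hh => ?_
    have := conn_snd_nonneg (fun c hc => hc.1) le_rfl hh
    omega
  have hfa : f (a, 0) = 1 := if_pos (conn_refl _ _ _)
  have hga : g (a - 1, 0) = 1 := if_pos (conn_refl _ _ _)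
  have hneg : pairing p f g (a - 1, -1) < 0 := by
    have e1 : (a - 1 + -1 + p) % 2 = 0 := by omega
    have e2 : (a - 1 + -1 + (p + 1)) % 2 ≠ 0 := by omega
    unfold pairing sg lo hi
    simp only [e1, e2, if_true, if_false]
    rw [hf0 (a - 1, -1) (by norm_num), hg0 (a - 1 + 1, -1) (by norm_num)]
    simp [hfa, hga]
  obtain ⟨⟨x, y⟩, hc⟩ := exists_pairing_pos (Or.inr (by rw [hg, ind_support]; exact hfin)) hneg
  have hy : y = -1 := by
    rcases lt_trichotomy y (-1) with hy | hy | hy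
    · exfalso
      unfold pairing at hc
      rw [hf0 (hi p _), hf0 (lo p _)] at hc
      · simp at hc
      · rw [lo_snd]; simp only; omega
      · rw [hi_snd]; simp only; omega
    · exact hy
    · exfalso
      have hcH : ((x, y) : V) ∈ Hc := show 0 ≤ y by omega
      unfold pairing at hc
      by_cases hcA : ((x, y) : V) ∈ A
      · rw [hf, ind_cl_step hcA] at hc
        simp at hc
      · rw [hg, ind_cl_step (p := p + 1) (show ((x, y) : V) ∈ Hc \ A from ⟨hcH, hcA⟩)] at hc
        simp at hc
  subst hy
  unfold pairing at hc
  rw [hf0 (lo p _) (by rw [lo_snd]; norm_num), hg0 (lo (p + 1) _) (by rw [lo_snd]; norm_num)] at hc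
  have hfg : f (hi p (x, -1)) ≠ 0 ∧ g (hi (p + 1) (x, -1)) ≠ 0 := by
    constructor <;> intro hh <;> simp [hh] at hc
  have hf01 : ∀ v, f v = 0 ∨ f v = 1 := fun v => by rw [hf]; unfold ind; split_ifs <;> simp
  have hg01 : ∀ v, g v = 0 ∨ g v = 1 := fun v => by rw [hg]; unfold ind; split_ifs <;> simp
  have hf1 := (hf01 (hi p (x, -1))).resolve_left hfg.1
  have hg1 := (hg01 (hi (p + 1) (x, -1))).resolve_left hfg.2
  rw [hf1, hg1] at hc
  by_cases hp : (x + -1 + p) % 2 = 0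
  · simp [sg, hp, -EuclideanDomain.mod_eq_zero] at hc
  · have hp' : (x + -1 + (p + 1)) % 2 = 0 := by omega
    simp only [hi, hp, hp', if_true, if_false] at hf1 hg1
    norm_num at hf1 hg1
    have hfx : conn p A (a, 0) (x, 0) := by
      by_contra hh
      rw [hf] at hf1
      unfold ind at hf1
      rw [if_neg (show (x, 0) ∉ cl p A (a, 0) from hh)] at hf1
      exact zero_ne_one hf1
    have hgx : conn (p + 1) (Hc \ A) (a - 1, 0) (x + 1, 0) := by
      by_contra hh
      rw [hg] at hg1
      unfold ind at hg1
      rw [if_neg (show (x + 1, 0) ∉ cl (p + 1) (Hc \ A) (a - 1, 0) from hh)] at hg1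
      exact zero_ne_one hg1
    have hax := hleft x hfx
    exact hinf (dual_finite_of_between' hA hgx (by omega) (by omega))

/-- Infinitely many boundary points in each infinite cluster. -/
def TouchesLine (p : ℤ) (A : Set V) : Prop :=
  ∀ u : V, (cl p A u).Infinite → {x : ℤ | conn p A u (x, 0)}.Infinite

lemma exists_gt_or_lt {S : Set ℤ} (hS : S.Infinite) (m : ℤ) (h : ∀ x ∈ S, m ≤ x) (k : ℤ) :
    ∃ x ∈ S, k < x := by
  by_contra! hk
  exact hS ((Set.finite_Icc m k).subset fun x hx => ⟨h x hx, hk x hx⟩)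

lemma exists_lt_of_le {S : Set ℤ} (hS : S.Infinite) (m : ℤ) (h : ∀ x ∈ S, x ≤ m) (k : ℤ) :
    ∃ x ∈ S, x < k := by
  by_contra! hk
  exact hS ((Set.finite_Icc k m).subset fun x hx => ⟨hk x hx, h x hx⟩)

lemma unique_aux {p : ℤ} {A : Set V} (hA : A ⊆ Hc) (ht : TouchesLine p A)
    (ht' : TouchesLine (p + 1) (Hc \ A)) {u v : V} (hu : (cl p A u).Infinite)
    (hv : (cl p A v).Infinite) (huv : ¬ conn p A u v) {b c : ℤ} (hb : conn p A u (b, 0))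
    (hc : conn p A v (c, 0)) (hcb : c < b) : False := by
  have sep : ∀ b' c' : ℤ, conn p A u (b', 0) → conn p A v (c', 0) → c' < b' := by
    intro b' c' hb' hc'
    have hne : c' ≠ b' := by
      rintro rfl
      exact huv (conn_trans hb' (conn_symm hc'))
    by_contra hlt
    have hlt' : b' < c' := by omega
    rcases lt_trichotomy c' b with h | h | h
    · refine hv ?_
      rw [cl_eq hc']
      refine finite_of_between hA (conn_trans (conn_symm hb') hb) hlt' h fun hh => ?_
      exact huv (conn_trans (conn_trans hb' hh) (conn_symm hc'))
    · subst h
      exact huv (conn_trans hb (conn_symm hc'))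
    · refine hu ?_
      rw [cl_eq hb]
      refine finite_of_between hA (conn_trans (conn_symm hc) hc') hcb h fun hh => ?_
      exact huv (conn_symm (conn_trans (conn_trans hc hh) (conn_symm hb)))
  have hB1 := ht u hu
  have hB2 := ht v hv
  obtain ⟨a, ha, hmin⟩ : ∃ a : ℤ, conn p A u (a, 0) ∧ ∀ x : ℤ, conn p A u (x, 0) → a ≤ x := by
    classical
    have := Int.exists_least_of_bdd (P := fun x : ℤ => conn p A u (x, 0))
      ⟨c, fun z hz => (sep z c hz hc).le⟩ ⟨b, hb⟩
    exact this
  have hK : (cl (p + 1) (Hc \ A) (a - 1, 0)).Infinite := by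
    apply dual_infinite_of_leftmost hA
    · rwa [← cl_eq ha]
    · exact fun x hx => hmin x (conn_trans ha hx)
  have hKb := ht' _ hK
  have hKle : ∀ x ∈ {x : ℤ | conn (p + 1) (Hc \ A) (a - 1, 0) (x, 0)}, x ≤ a := by
    intro x hx
    by_contra! hlt
    obtain ⟨z, hz, hxz⟩ := exists_gt_or_lt hB1 a hmin x
    apply hK
    rw [cl_eq hx]
    exact dual_finite_of_between hA (conn_trans (conn_symm ha) hz) hlt hxz
  have hca := sep a c ha hc
  obtain ⟨k, hk, hkc⟩ := exists_lt_of_le hKb a hKle c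
  have hpc : c ≠ a - 1 := by
    intro h
    have e1 : (a + 0 + p) % 2 = 0 := by
      by_contra hh
      refine hu ?_
      rw [cl_eq ha]
      exact cl_finite_of_parity hh
    have e2 : (c + 0 + p) % 2 = 0 := by
      by_contra hh
      refine hv ?_
      rw [cl_eq hc]
      exact cl_finite_of_parity hh
    omega
  apply hv
  rw [cl_eq hc]
  exact dual_finite_of_between' hA (conn_symm hk) hkc (by omega)

/-- If infinite primal and dual clusters of a half-plane touch the boundary infinitely often,
the infinite cluster is unique. -/
lemma unique_of_touches {p : ℤ} {A : Set V} (hA : A ⊆ Hc) (ht : TouchesLine p A)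
    (ht' : TouchesLine (p + 1) (Hc \ A)) {u v : V} (hu : (cl p A u).Infinite)
    (hv : (cl p A v).Infinite) : conn p A u v := by
  by_contra huv
  obtain ⟨b, hb⟩ := (ht u hu).nonempty
  obtain ⟨c, hc⟩ := (ht v hv).nonempty
  rcases lt_trichotomy c b with h | h | h
  · exact unique_aux hA ht ht' hu hv huv hb hc h
  · subst h
    exact huv (conn_trans hb (conn_symm hc))
  · exact unique_aux hA ht ht' hv hu (fun h => huv (conn_symm h)) hc hb h

section FiniteVolume
open scoped Classical

/-- Endpoints of the diagonals of parity `p` of the cells of `D`. -/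
def verts (p : ℤ) (D : Finset V) : Finset V := D.image (lo p) ∪ D.image (hi p)

/-- Number of classes of `r` met by `W`. -/
def kk (W : Finset V) (r : Setoid V) : ℕ := (W.image (Quotient.mk r)).card

lemma lo_mem_verts {p : ℤ} {D : Finset V} {e : V} (he : e ∈ D) : lo p e ∈ verts p D :=
  Finset.mem_union_left _ (Finset.mem_image_of_mem _ he)

lemma hi_mem_verts {p : ℤ} {D : Finset V} {e : V} (he : e ∈ D) : hi p e ∈ verts p D :=
  Finset.mem_union_right _ (Finset.mem_image_of_mem _ he)

lemma mem_verts {p : ℤ} {D : Finset V} {v : V} :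
    v ∈ verts p D ↔ ∃ e ∈ D, lo p e = v ∨ hi p e = v := by
  simp only [verts, Finset.mem_union, Finset.mem_image]
  constructor
  · rintro (⟨e, he, h⟩ | ⟨e, he, h⟩)
    · exact ⟨e, he, Or.inl h⟩
    · exact ⟨e, he, Or.inr h⟩
  · rintro ⟨e, he, h | h⟩
    · exact Or.inl ⟨e, he, h⟩
    · exact Or.inr ⟨e, he, h⟩

lemma verts_mono {p : ℤ} {D D' : Finset V} (h : D ⊆ D') : verts p D ⊆ verts p D' :=
  Finset.union_subset_union (Finset.image_subset_image h) (Finset.image_subset_image h)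

lemma sup_conn_singleton {p : ℤ} {r : Setoid V} {e x y : V} :
    (r ⊔ conn p {e}) x y ↔ r x y ∨ (r x (lo p e) ∧ r (hi p e) y) ∨
      (r x (hi p e) ∧ r (lo p e) y) := by
  constructor
  · let t : Setoid V :=
      { r := fun x y => r x y ∨ (r x (lo p e) ∧ r (hi p e) y) ∨
          (r x (hi p e) ∧ r (lo p e) y)
        iseqv := by
          refine ⟨fun x => Or.inl (r.refl x), ?_, ?_⟩
          · rintro x y (h | ⟨h1, h2⟩ | ⟨h1, h2⟩)
            · exact Or.inl (r.symm h)
            · exact Or.inr (Or.inr ⟨r.symm h2, r.symm h1⟩)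
            · exact Or.inr (Or.inl ⟨r.symm h2, r.symm h1⟩)
          · rintro x y z (h | ⟨h1, h2⟩ | ⟨h1, h2⟩) (h' | ⟨h1', h2'⟩ | ⟨h1', h2'⟩)
            · exact Or.inl (r.trans h h')
            · exact Or.inr (Or.inl ⟨r.trans h h1', h2'⟩)
            · exact Or.inr (Or.inr ⟨r.trans h h1', h2'⟩)
            · exact Or.inr (Or.inl ⟨h1, r.trans h2 h'⟩)
            · exact Or.inr (Or.inl ⟨h1, h2'⟩)
            · exact Or.inl (r.trans h1 h2')
            · exact Or.inr (Or.inr ⟨h1, r.trans h2 h'⟩)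
            · exact Or.inl (r.trans h1 h2')
            · exact Or.inr (Or.inr ⟨h1, h2'⟩) }
    have h : r ⊔ conn p {e} ≤ t := by
      refine sup_le (fun x y h => Or.inl h) (conn_le_iff.2 ?_)
      rintro c rfl
      exact Or.inr (Or.inl ⟨r.refl _, r.refl _⟩)
    exact fun hh => h hh
  · have h1 : r ≤ r ⊔ conn p {e} := le_sup_left
    have h2 : conn p {e} ≤ r ⊔ conn p {e} := le_sup_right
    have h3 : (r ⊔ conn p {e}) (lo p e) (hi p e) := h2 (conn_step rfl)
    rintro (h | ⟨ha, hb⟩ | ⟨ha, hb⟩)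
    · exact h1 h
    · exact (r ⊔ conn p {e}).trans (h1 ha) ((r ⊔ conn p {e}).trans h3 (h1 hb))
    · exact (r ⊔ conn p {e}).trans (h1 ha)
        ((r ⊔ conn p {e}).trans ((r ⊔ conn p {e}).symm h3) (h1 hb))

lemma kk_merge_same {W : Finset V} {p : ℤ} {r : Setoid V} {e : V} (h : r (lo p e) (hi p e)) :
    kk W (r ⊔ conn p {e}) = kk W r := by
  rw [sup_eq_left.2]
  rw [conn_le_iff]
  rintro c rfl
  exact h

lemma kk_merge {W : Finset V} {p : ℤ} {r : Setoid V} {e : V} (h : ¬ r (lo p e) (hi p e))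
    (hl : lo p e ∈ W) (hh : hi p e ∈ W) : kk W (r ⊔ conn p {e}) + 1 = kk W r := by
  unfold kk
  have hle : r ≤ r ⊔ conn p {e} := le_sup_left
  have hm : Quotient.mk r (lo p e) ∈ W.image (Quotient.mk r) := Finset.mem_image_of_mem _ hl
  rw [← Finset.card_erase_add_one hm]
  congr 1
  let φ : Quotient r → Quotient (r ⊔ conn p {e}) := Quotient.map id fun a b hab => hle hab
  have : W.image (Quotient.mk (r ⊔ conn p {e}))
      = ((W.image (Quotient.mk r)).erase (Quotient.mk r (lo p e))).image φ := by
    ext z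
    simp only [Finset.mem_image, Finset.mem_erase]
    constructor
    · rintro ⟨w, hw, rfl⟩
      by_cases hwl : r w (lo p e)
      · refine ⟨Quotient.mk r (hi p e), ⟨?_, ⟨_, hh, rfl⟩⟩, ?_⟩
        · intro heq
          exact h (r.symm (Quotient.exact heq))
        · refine Quotient.sound (s := r ⊔ conn p {e}) ?_
          exact (r ⊔ conn p {e}).symm (sup_conn_singleton.2 (Or.inr (Or.inl ⟨hwl, r.refl _⟩)))
      · exact ⟨Quotient.mk r w, ⟨fun heq => hwl (Quotient.exact heq), ⟨w, hw, rfl⟩⟩, rfl⟩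
    · rintro ⟨a, ⟨_, w, hw, rfl⟩, rfl⟩
      exact ⟨w, hw, rfl⟩
  rw [this, Finset.card_image_of_injOn]
  intro a ha b hb hab
  simp only [Finset.coe_erase, Set.mem_sdiff, Set.mem_singleton_iff, Finset.mem_coe,
    Finset.mem_image] at ha hb
  obtain ⟨⟨x, _, rfl⟩, hxl⟩ := ha
  obtain ⟨⟨y, _, rfl⟩, hyl⟩ := hb
  have hxy : (r ⊔ conn p {e}) x y := Quotient.exact hab
  rcases sup_conn_singleton.1 hxy with h1 | ⟨h1, _⟩ | ⟨_, h1⟩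
  · exact Quotient.sound h1
  · exact absurd (Quotient.sound h1) hxl
  · exact absurd (Quotient.sound (r.symm h1)) hyl

lemma sup_conn_insert (p : ℤ) (s : Setoid V) (e : V) (ω : Finset V) :
    s ⊔ conn p ↑(insert e ω) = (s ⊔ conn p ↑ω) ⊔ conn p {e} := by
  rw [sup_assoc, ← conn_union, Finset.coe_insert, Set.insert_eq, Set.union_comm]

lemma sup_conn_mono {p : ℤ} (s : Setoid V) {a b : Finset V} (h : a ⊆ b) :
    s ⊔ conn p ↑a ≤ s ⊔ conn p ↑b := sup_le_sup_left (conn_mono (Finset.coe_subset.2 h)) s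

/-- The boundary condition `s₂` connects at least as much as `s₁` in `D`. -/
def Dom (p : ℤ) (s₁ s₂ : Setoid V) (D : Finset V) : Prop :=
  ∀ a ⊆ D, ∀ e ∈ D, (s₁ ⊔ conn p ↑a) (lo p e) (hi p e) → (s₂ ⊔ conn p ↑a) (lo p e) (hi p e)

lemma Dom.refl (p : ℤ) (s : Setoid V) (D : Finset V) : Dom p s s D := fun _ _ _ _ h => h

lemma Dom.of_le {p : ℤ} {s₁ s₂ : Setoid V} {D : Finset V} (h : s₁ ≤ s₂) : Dom p s₁ s₂ D :=
  fun a _ _ _ hh => (sup_le_sup_right h (conn p ↑a)) hh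

lemma kk_submodular {p : ℤ} {s₁ s₂ : Setoid V} {D W : Finset V} (hd : Dom p s₁ s₂ D)
    (hW : verts p D ⊆ W) {a b X : Finset V} (hab : a ⊆ b) (hb : b ⊆ D) (hX : X ⊆ D) :
    kk W (s₂ ⊔ conn p ↑b) + kk W (s₁ ⊔ conn p ↑(a ∪ X)) ≤
      kk W (s₁ ⊔ conn p ↑a) + kk W (s₂ ⊔ conn p ↑(b ∪ X)) := by
  induction X using Finset.induction_on with
  | empty => simp [add_comm]
  | insert e X _ ih =>
    have he : e ∈ D := hX (Finset.mem_insert_self _ _)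
    have hX' : X ⊆ D := (Finset.subset_insert _ _).trans hX
    have ih' := ih hX'
    rw [Finset.union_insert, Finset.union_insert, sup_conn_insert, sup_conn_insert]
    have hl := hW (lo_mem_verts (p := p) he)
    have hh := hW (hi_mem_verts (p := p) he)
    by_cases h2 : (s₂ ⊔ conn p ↑(b ∪ X)) (lo p e) (hi p e)
    · rw [kk_merge_same h2]
      by_cases h1 : (s₁ ⊔ conn p ↑(a ∪ X)) (lo p e) (hi p e)
      · rw [kk_merge_same h1]; exact ih'
      · have := kk_merge h1 hl hh
        omega
    · have h1 : ¬ (s₁ ⊔ conn p ↑(a ∪ X)) (lo p e) (hi p e) := by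
        intro h1
        apply h2
        exact sup_conn_mono s₂ (Finset.union_subset_union_left hab)
          (hd _ (Finset.union_subset (hab.trans hb) hX') e he h1)
      have e1 := kk_merge h1 hl hh
      have e2 := kk_merge h2 hl hh
      omega

lemma kk_window {p : ℤ} {D W W' : Finset V} (hW : verts p D ⊆ W) (hW' : verts p D ⊆ W')
    (r : Setoid V) {η : Finset V} (hη : η ⊆ D) :
    kk W (r ⊔ conn p ↑η) + kk W' r = kk W' (r ⊔ conn p ↑η) + kk W r := by
  induction η using Finset.induction_on with
  | empty =>
    have : conn p ↑(∅ : Finset V) ≤ r := conn_le_iff.2 (by simp)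
    rw [sup_eq_left.2 this, add_comm]
  | insert e X _ ih =>
    have he : e ∈ D := hη (Finset.mem_insert_self _ _)
    have ih' := ih ((Finset.subset_insert _ _).trans hη)
    rw [sup_conn_insert]
    by_cases h : (r ⊔ conn p ↑X) (lo p e) (hi p e)
    · rw [kk_merge_same h, kk_merge_same h]; exact ih'
    · have e1 := kk_merge h (hW (lo_mem_verts (p := p) he)) (hW (hi_mem_verts (p := p) he))
      have e2 := kk_merge h (hW' (lo_mem_verts (p := p) he)) (hW' (hi_mem_verts (p := p) he))
      omega

/-- Self-dual FK weight of the configuration `ω` in `D` with boundary condition `s`. -/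
def wt (q : ℝ) (p : ℤ) (s : Setoid V) (D ω : Finset V) : ℝ :=
  Real.sqrt q ^ ω.card * q ^ kk (verts p D) (s ⊔ conn p ↑ω)

/-- Total weight of the event `A`. -/
def mass (q : ℝ) (p : ℤ) (s : Setoid V) (D : Finset V) (A : Finset V → Prop) : ℝ :=
  ∑ ω ∈ D.powerset.filter A, wt q p s D ω

/-- Probability of `A` under the self-dual FK measure in `D` with boundary condition `s`. -/
def Pr (q : ℝ) (p : ℤ) (s : Setoid V) (D : Finset V) (A : Finset V → Prop) : ℝ :=
  mass q p s D A / mass q p s D fun _ => True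

variable {q : ℝ} {p : ℤ} {s : Setoid V} {D : Finset V}

lemma wt_pos (hq : 1 ≤ q) (p : ℤ) (s : Setoid V) (D ω : Finset V) : 0 < wt q p s D ω := by
  have : 0 < q := by linarith
  have := Real.sqrt_pos.2 this
  unfold wt; positivity

lemma mass_nonneg (hq : 1 ≤ q) (p : ℤ) (s : Setoid V) (D : Finset V) (A : Finset V → Prop) :
    0 ≤ mass q p s D A := Finset.sum_nonneg fun ω _ => (wt_pos hq p s D ω).le

lemma mass_true_pos (hq : 1 ≤ q) (p : ℤ) (s : Setoid V) (D : Finset V) :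
    0 < mass q p s D fun _ => True := by
  refine Finset.sum_pos (fun ω _ => wt_pos hq p s D ω) ⟨∅, ?_⟩
  simp

lemma mass_mono (hq : 1 ≤ q) {A B : Finset V → Prop} (h : ∀ ω ⊆ D, A ω → B ω) :
    mass q p s D A ≤ mass q p s D B := by
  refine Finset.sum_le_sum_of_subset_of_nonneg ?_ fun ω _ _ => (wt_pos hq p s D ω).le
  intro ω hω
  rw [Finset.mem_filter, Finset.mem_powerset] at hω ⊢
  exact ⟨hω.1, h ω hω.1 hω.2⟩

lemma mass_split (A B : Finset V → Prop) :
    mass q p s D B = mass q p s D (fun ω => B ω ∧ A ω) + mass q p s D fun ω => B ω ∧ ¬ A ω := by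
  unfold mass
  simp only [Finset.sum_filter]
  rw [← Finset.sum_add_distrib]
  refine Finset.sum_congr rfl fun ω _ => ?_
  by_cases h1 : B ω <;> by_cases h2 : A ω <;> simp [h1, h2]

lemma mass_le_of_or (hq : 1 ≤ q) {A B C : Finset V → Prop}
    (h : ∀ ω ⊆ D, A ω → B ω ∨ C ω) : mass q p s D A ≤ mass q p s D B + mass q p s D C := by
  rw [mass_split (B := A) B]
  exact add_le_add (mass_mono hq fun _ _ h => h.2)
    (mass_mono hq fun ω hω hh => (h ω hω hh.1).resolve_left hh.2)

lemma Pr_nonneg (hq : 1 ≤ q) (p : ℤ) (s : Setoid V) (D : Finset V) (A : Finset V → Prop) :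
    0 ≤ Pr q p s D A := div_nonneg (mass_nonneg hq _ _ _ _) (mass_nonneg hq _ _ _ _)

lemma Pr_mono (hq : 1 ≤ q) {A B : Finset V → Prop} (h : ∀ ω ⊆ D, A ω → B ω) :
    Pr q p s D A ≤ Pr q p s D B :=
  div_le_div_of_nonneg_right (mass_mono hq h) (mass_nonneg hq _ _ _ _)

lemma Pr_congr {A B : Finset V → Prop} (h : ∀ ω ⊆ D, (A ω ↔ B ω)) :
    Pr q p s D A = Pr q p s D B := by
  unfold Pr mass
  congr 1
  refine Finset.sum_congr (Finset.filter_congr fun ω hω => h ω (Finset.mem_powerset.1 hω))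
    fun _ _ => rfl

lemma Pr_true (hq : 1 ≤ q) (p : ℤ) (s : Setoid V) (D : Finset V) :
    Pr q p s D (fun _ => True) = 1 := div_self (mass_true_pos hq p s D).ne'

lemma Pr_le_one (hq : 1 ≤ q) (A : Finset V → Prop) : Pr q p s D A ≤ 1 := by
  rw [← Pr_true hq p s D]
  exact Pr_mono hq fun _ _ _ => trivial

lemma Pr_split (q : ℝ) (p : ℤ) (s : Setoid V) (D : Finset V) (A B : Finset V → Prop) :
    Pr q p s D B = Pr q p s D (fun ω => B ω ∧ A ω) + Pr q p s D fun ω => B ω ∧ ¬ A ω := by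
  unfold Pr
  rw [mass_split A B, add_div]

lemma Pr_not (hq : 1 ≤ q) (A : Finset V → Prop) :
    Pr q p s D (fun ω => ¬ A ω) = 1 - Pr q p s D A := by
  have := Pr_split q p s D A fun _ => True
  rw [Pr_true hq] at this
  simp only [true_and] at this
  linarith

lemma Pr_le_of_or (hq : 1 ≤ q) {A B C : Finset V → Prop}
    (h : ∀ ω ⊆ D, A ω → B ω ∨ C ω) : Pr q p s D A ≤ Pr q p s D B + Pr q p s D C := by
  unfold Pr
  rw [← add_div]
  exact div_le_div_of_nonneg_right (mass_le_of_or hq h) (mass_nonneg hq _ _ _ _)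

/-- Increasing events. -/
def Incr (D : Finset V) (A : Finset V → Prop) : Prop := ∀ a b, a ⊆ b → b ⊆ D → A a → A b

lemma wt_lattice (hq : 1 ≤ q) {s₁ s₂ : Setoid V} (hd : Dom p s₁ s₂ D) {a b : Finset V}
    (ha : a ⊆ D) (hb : b ⊆ D) :
    wt q p s₁ D a * wt q p s₂ D b ≤ wt q p s₁ D (a ∩ b) * wt q p s₂ D (a ∪ b) := by
  have hk := kk_submodular hd (Finset.Subset.refl _) (Finset.inter_subset_right (s₁ := a)) hb ha
  have e1 : a ∩ b ∪ a = a := Finset.union_eq_right.2 Finset.inter_subset_left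
  rw [e1, Finset.union_comm b a] at hk
  have hc := Finset.card_inter_add_card_union a b
  unfold wt
  have h0 : 0 < Real.sqrt q := Real.sqrt_pos.2 (by linarith)
  calc _ = Real.sqrt q ^ (a.card + b.card) * q ^ (kk (verts p D) (s₂ ⊔ conn p ↑b) +
        kk (verts p D) (s₁ ⊔ conn p ↑a)) := by rw [pow_add, pow_add]; ring
    _ ≤ Real.sqrt q ^ (a.card + b.card) * q ^ (kk (verts p D) (s₁ ⊔ conn p ↑(a ∩ b)) +
        kk (verts p D) (s₂ ⊔ conn p ↑(a ∪ b))) := by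
        gcongr
    _ = _ := by rw [← hc, pow_add, pow_add]; ring

lemma mass_incr (hq : 1 ≤ q) {s₁ s₂ : Setoid V} (hd : Dom p s₁ s₂ D) {A B : Finset V → Prop}
    (hA : Incr D A) (hB : Incr D B) :
    mass q p s₁ D A * mass q p s₂ D B ≤
      mass q p s₁ D (fun _ => True) * mass q p s₂ D fun ω => A ω ∧ B ω := by
  have h4 := Finset.four_functions_theorem (u := D)
    (f₁ := fun ω => if A ω then wt q p s₁ D ω else 0)
    (f₂ := fun ω => if B ω then wt q p s₂ D ω else 0)
    (f₃ := fun ω => wt q p s₁ D ω)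
    (f₄ := fun ω => if ω ⊆ D ∧ A ω ∧ B ω then wt q p s₂ D ω else 0)
    (fun ω => by dsimp only [Pi.zero_apply]; split_ifs; exacts [(wt_pos hq _ _ _ _).le, le_rfl])
    (fun ω => by dsimp only [Pi.zero_apply]; split_ifs; exacts [(wt_pos hq _ _ _ _).le, le_rfl])
    (fun ω => (wt_pos hq _ _ _ _).le)
    (fun ω => by dsimp only [Pi.zero_apply]; split_ifs; exacts [(wt_pos hq _ _ _ _).le, le_rfl])
    (fun a ha b hb => by
      by_cases h1 : A a
      · by_cases h2 : B b
        · have hu := Finset.union_subset ha hb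
          rw [if_pos h1, if_pos h2, if_pos ⟨hu, hA _ _ Finset.subset_union_left hu h1,
            hB _ _ Finset.subset_union_right hu h2⟩]
          exact wt_lattice hq hd ha hb
        · rw [if_neg h2, mul_zero]
          split_ifs
          · exact mul_nonneg (wt_pos hq _ _ _ _).le (wt_pos hq _ _ _ _).le
          · simp
      · rw [if_neg h1, zero_mul]
        split_ifs
        · exact mul_nonneg (wt_pos hq _ _ _ _).le (wt_pos hq _ _ _ _).le
        · simp)
    (𝒜 := D.powerset) (ℬ := D.powerset) (Finset.Subset.refl _) (Finset.Subset.refl _)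
  rw [← Finset.sum_filter, ← Finset.sum_filter] at h4
  refine h4.trans (mul_le_mul ?_ ?_ ?_ (mass_nonneg hq _ _ _ _))
  · unfold mass
    rw [Finset.filter_true]
    refine Finset.sum_le_sum_of_subset_of_nonneg ?_ fun ω _ _ => (wt_pos hq p _ D ω).le
    intro ω hω
    obtain ⟨a, ha, b, _, rfl⟩ := Finset.mem_infs.1 hω
    rw [Finset.mem_powerset] at ha ⊢
    exact Finset.inter_subset_left.trans ha
  · rw [← Finset.sum_filter]
    unfold mass
    refine Finset.sum_le_sum_of_subset_of_nonneg ?_ fun ω _ _ => (wt_pos hq p _ D ω).le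
    intro ω hω
    simp only [Finset.mem_filter, Finset.mem_powerset] at hω ⊢
    exact hω.2
  · exact Finset.sum_nonneg fun ω _ => by split_ifs; exacts [(wt_pos hq _ _ _ _).le, le_rfl]

/-- Monotonicity in boundary conditions. -/
lemma Pr_le_of_dom (hq : 1 ≤ q) {s₁ s₂ : Setoid V} (hd : Dom p s₁ s₂ D) {A : Finset V → Prop}
    (hA : Incr D A) : Pr q p s₁ D A ≤ Pr q p s₂ D A := by
  have := mass_incr hq hd hA (B := fun _ => True) fun _ _ _ _ _ => trivial
  simp only [and_true] at this
  unfold Pr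
  rw [div_le_div_iff₀ (mass_true_pos hq _ _ _) (mass_true_pos hq _ _ _)]
  linarith

/-- Positive association for increasing events. -/
lemma Pr_fkg (hq : 1 ≤ q) {A B : Finset V → Prop} (hA : Incr D A) (hB : Incr D B) :
    Pr q p s D A * Pr q p s D B ≤ Pr q p s D fun ω => A ω ∧ B ω := by
  have := mass_incr hq (Dom.refl p s D) hA hB
  have hZ := mass_true_pos hq p s D
  unfold Pr
  rw [div_mul_div_comm, div_le_div_iff₀ (mul_pos hZ hZ) hZ]
  nlinarith

/-- Positive association for decreasing events. -/
lemma Pr_fkg_decr (hq : 1 ≤ q) {A B : Finset V → Prop} (hA : Incr D fun ω => ¬ A ω)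
    (hB : Incr D fun ω => ¬ B ω) :
    Pr q p s D A * Pr q p s D B ≤ Pr q p s D fun ω => A ω ∧ B ω := by
  have h := Pr_fkg (s := s) (p := p) hq hA hB
  rw [Pr_not hq, Pr_not hq] at h
  have h1 := Pr_split q p s D B A
  have h2 := Pr_split q p s D A fun ω => ¬ B ω
  rw [Pr_not hq] at h2
  have h3 : Pr q p s D (fun ω => ¬ B ω ∧ A ω) = Pr q p s D fun ω => A ω ∧ ¬ B ω :=
    Pr_congr fun _ _ => and_comm
  have h4 : Pr q p s D (fun ω => ¬ B ω ∧ ¬ A ω) = Pr q p s D fun ω => ¬ A ω ∧ ¬ B ω :=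
    Pr_congr fun _ _ => and_comm
  nlinarith

end FiniteVolume

section Markov
open scoped Classical

variable {q : ℝ} {p : ℤ} {s : Setoid V} {D : Finset V}

lemma mass_eq_sum (A : Finset V → Prop) :
    mass q p s D A = ∑ ω ∈ D.powerset, if A ω then wt q p s D ω else 0 := by
  unfold mass
  rw [Finset.sum_filter]

lemma wt_markov (hq : 1 ≤ q) {D' ζ : Finset V} (hD : D' ⊆ D) (hζ : ζ ⊆ D \ D') :
    ∃ C : ℝ, 0 < C ∧ ∀ η ⊆ D', wt q p s D (ζ ∪ η) = C * wt q p (s ⊔ conn p ↑ζ) D' η := by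
  have h0 : 0 < q := by linarith
  have h1 : 0 < Real.sqrt q := Real.sqrt_pos.2 h0
  refine ⟨Real.sqrt q ^ ζ.card * q ^ kk (verts p D) (s ⊔ conn p ↑ζ) /
    q ^ kk (verts p D') (s ⊔ conn p ↑ζ), by positivity, fun η hη => ?_⟩
  have hdis : Disjoint ζ η := by
    rw [Finset.disjoint_left]
    intro x hx hx'
    exact (Finset.mem_sdiff.1 (hζ hx)).2 (hη hx')
  have hk := kk_window (verts_mono (p := p) hD) (Finset.Subset.refl (verts p D'))
    (s ⊔ conn p ↑ζ) hη
  unfold wt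
  rw [Finset.card_union_of_disjoint hdis, Finset.coe_union, conn_union, ← sup_assoc, pow_add]
  have hk' : q ^ kk (verts p D) (s ⊔ conn p ↑ζ ⊔ conn p ↑η) * q ^ kk (verts p D') (s ⊔ conn p ↑ζ)
      = q ^ kk (verts p D') (s ⊔ conn p ↑ζ ⊔ conn p ↑η) * q ^ kk (verts p D) (s ⊔ conn p ↑ζ) := by
    rw [← pow_add, ← pow_add, hk]
  field_simp
  linear_combination hk'

/-- Conditioning on the configuration outside a random set which is determined by it. -/
lemma Pr_explore_le (hq : 1 ≤ q) {G A : Finset V → Prop} {D' : Finset V → Finset V} {ε : ℝ}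
    (hsub : ∀ ω ⊆ D, G ω → D' ω ⊆ D)
    (hinv : ∀ ω ⊆ D, G ω → ∀ η ⊆ D' ω,
      D' (ω \ D' ω ∪ η) = D' ω ∧ G (ω \ D' ω ∪ η))
    (hbd : ∀ ω ⊆ D, G ω →
      Pr q p (s ⊔ conn p ↑(ω \ D' ω)) (D' ω) (fun η => A (ω \ D' ω ∪ η)) ≤ ε) :
    Pr q p s D (fun ω => G ω ∧ A ω) ≤ ε * Pr q p s D G := by
  let key : Finset V → Finset V × Finset V := fun ω => (D' ω, ω \ D' ω)
  let K := (D.powerset.filter G).image key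
  have hfib : ∀ ω₀ ⊆ D, G ω₀ → ∃ C : ℝ, 0 < C ∧ ∀ A : Finset V → Prop,
      ∑ ω ∈ (D.powerset.filter fun ω => G ω ∧ A ω).filter (fun ω => key ω = key ω₀),
        wt q p s D ω = C * mass q p (s ⊔ conn p ↑(ω₀ \ D' ω₀)) (D' ω₀)
          (fun η => A (ω₀ \ D' ω₀ ∪ η)) := by
    intro ω₀ h₀ hG
    obtain ⟨C, hC, hw⟩ := wt_markov (p := p) (s := s) hq (hsub ω₀ h₀ hG)
      (Finset.sdiff_subset_sdiff h₀ (Finset.Subset.refl (D' ω₀)))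
    refine ⟨C, hC, fun A => ?_⟩
    unfold mass
    rw [Finset.mul_sum]
    symm
    refine Finset.sum_bij (fun η _ => ω₀ \ D' ω₀ ∪ η) ?_ ?_ ?_ ?_
    · intro η hη
      simp only [Finset.mem_filter, Finset.mem_powerset] at hη ⊢
      obtain ⟨e1, e2⟩ := hinv ω₀ h₀ hG η hη.1
      refine ⟨⟨Finset.union_subset (Finset.sdiff_subset.trans h₀)
        (hη.1.trans (hsub ω₀ h₀ hG)), e2, hη.2⟩, ?_⟩
      simp only [key, e1, Prod.mk.injEq, true_and]
      ext x
      simp only [Finset.mem_sdiff, Finset.mem_union]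
      have := @hη.1 x
      tauto
    · intro a ha b hb hab
      simp only [Finset.mem_filter, Finset.mem_powerset] at ha hb
      ext x
      have h := Finset.ext_iff.1 hab x
      simp only [Finset.mem_sdiff, Finset.mem_union] at h
      have h1 := @ha.1 x
      have h2 := @hb.1 x
      tauto
    · intro ω hω
      simp only [Finset.mem_filter, Finset.mem_powerset, key, Prod.mk.injEq] at hω
      obtain ⟨⟨h1, h2, h3⟩, h4, h5⟩ := hω
      have h6 : ω₀ \ D' ω₀ ∪ ω ∩ D' ω₀ = ω := by
        rw [← h5, h4]; exact Finset.sdiff_union_inter ω _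
      refine ⟨ω ∩ D' ω₀, ?_, h6⟩
      simp only [Finset.mem_filter, Finset.mem_powerset]
      exact ⟨Finset.inter_subset_right, h6.symm ▸ h3⟩
    · intro η hη
      simp only [Finset.mem_filter, Finset.mem_powerset] at hη
      exact (hw η hη.1).symm
  have hsum : ∀ A : Finset V → Prop, mass q p s D (fun ω => G ω ∧ A ω) =
      ∑ k ∈ K, ∑ ω ∈ (D.powerset.filter fun ω => G ω ∧ A ω).filter (fun ω => key ω = k),
        wt q p s D ω := by
    intro A
    unfold mass
    refine Eq.symm ?_
    convert Finset.sum_fiberwise_of_maps_to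
      (s := D.powerset.filter fun ω => G ω ∧ A ω) (t := K) (g := key) (fun ω hω => ?_)
      (fun ω => wt q p s D ω)
    simp only [Finset.mem_filter, Finset.mem_powerset] at hω
    exact Finset.mem_image_of_mem _ (by simp [hω.1, hω.2.1])
  have hmain : mass q p s D (fun ω => G ω ∧ A ω) ≤ ε * mass q p s D (fun ω => G ω ∧ True) := by
    rw [hsum, hsum, Finset.mul_sum]
    refine Finset.sum_le_sum fun k hk => ?_
    obtain ⟨ω₀, h₀, rfl⟩ := Finset.mem_image.1 hk
    simp only [Finset.mem_filter, Finset.mem_powerset] at h₀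
    obtain ⟨C, hC, hC'⟩ := hfib ω₀ h₀.1 h₀.2
    rw [hC', hC']
    have h := hbd ω₀ h₀.1 h₀.2
    unfold Pr at h
    rw [div_le_iff₀ (mass_true_pos hq _ _ _)] at h
    nlinarith
  simp only [and_true] at hmain
  unfold Pr
  rw [← mul_div_assoc]
  exact div_le_div_of_nonneg_right hmain (mass_nonneg hq _ _ _ _)

lemma Pr_explore_ge (hq : 1 ≤ q) {G A : Finset V → Prop} {D' : Finset V → Finset V} {ε : ℝ}
    (hsub : ∀ ω ⊆ D, G ω → D' ω ⊆ D)
    (hinv : ∀ ω ⊆ D, G ω → ∀ η ⊆ D' ω,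
      D' (ω \ D' ω ∪ η) = D' ω ∧ G (ω \ D' ω ∪ η))
    (hbd : ∀ ω ⊆ D, G ω →
      ε ≤ Pr q p (s ⊔ conn p ↑(ω \ D' ω)) (D' ω) (fun η => A (ω \ D' ω ∪ η))) :
    ε * Pr q p s D G ≤ Pr q p s D (fun ω => G ω ∧ A ω) := by
  have h := Pr_explore_le (p := p) (s := s) hq (A := fun ω => ¬ A ω) (ε := 1 - ε) hsub hinv
    fun ω h1 h2 => by rw [Pr_not hq]; linarith [hbd ω h1 h2]
  have h2 := Pr_split q p s D A G
  linarith

lemma kk_antitone (W : Finset V) {r r' : Setoid V} (h : r ≤ r') : kk W r' ≤ kk W r := by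
  unfold kk
  have : W.image (Quotient.mk r') =
      (W.image (Quotient.mk r)).image (Quotient.map id fun a b hab => h hab) := by
    rw [Finset.image_image]; rfl
  rw [this]
  exact Finset.card_image_le

lemma kk_le_add_card {W : Finset V} {r : Setoid V} (hW : verts p D ⊆ W) :
    kk W r ≤ kk W (r ⊔ conn p ↑D) + D.card := by
  induction D using Finset.induction_on with
  | empty =>
    have : conn p ↑(∅ : Finset V) ≤ r := conn_le_iff.2 (by simp)
    rw [sup_eq_left.2 this]; simp
  | insert e X he ih =>
    have ih' := ih ((verts_mono (Finset.subset_insert _ _)).trans hW)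
    rw [sup_conn_insert, Finset.card_insert_of_notMem he]
    by_cases h : (r ⊔ conn p ↑X) (lo p e) (hi p e)
    · rw [kk_merge_same h]; omega
    · have := kk_merge h (hW (lo_mem_verts (Finset.mem_insert_self _ _)))
        (hW (hi_mem_verts (Finset.mem_insert_self _ _)))
      omega

/-- Lower bound for the probability of a prescribed configuration on `n` cells. -/
def fe (q : ℝ) (n : ℕ) : ℝ := ((2 * q ^ 2) ^ n)⁻¹

lemma fe_pos (hq : 1 ≤ q) (n : ℕ) : 0 < fe q n := by
  have : 0 < q := by linarith
  unfold fe; positivity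

lemma fe_antitone (hq : 1 ≤ q) {m n : ℕ} (h : m ≤ n) : fe q n ≤ fe q m := by
  unfold fe
  have h2 : 1 ≤ 2 * q ^ 2 := by nlinarith
  exact inv_anti₀ (by positivity) (pow_le_pow_right₀ h2 h)

lemma fe_le_one (hq : 1 ≤ q) (n : ℕ) : fe q n ≤ 1 := by
  have := fe_antitone hq (Nat.zero_le n)
  simpa [fe] using this

lemma Pr_eq_ge (hq : 1 ≤ q) {ω₀ : Finset V} (h₀ : ω₀ ⊆ D) :
    fe q D.card ≤ Pr q p s D (fun ω => ω = ω₀) := by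
  have h0 : 0 < q := by linarith
  have hs1 : 1 ≤ Real.sqrt q := Real.one_le_sqrt.2 hq
  have hsq : Real.sqrt q ≤ q := by
    nlinarith [Real.mul_self_sqrt h0.le]
  have hw : ∀ ω ⊆ D, wt q p s D ω ≤ (q ^ 2) ^ D.card * wt q p s D ω₀ := by
    intro ω hω
    unfold wt
    have e1 : kk (verts p D) (s ⊔ conn p ↑ω) ≤ kk (verts p D) (s ⊔ conn p ↑ω₀) + D.card :=
      (kk_antitone _ le_sup_left).trans ((kk_le_add_card (Finset.Subset.refl (verts p D))).trans
        (Nat.add_le_add_right (kk_antitone _ (sup_conn_mono s h₀)) _))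
    have e2 : Real.sqrt q ^ ω.card ≤ q ^ D.card :=
      (pow_le_pow_right₀ hs1 (Finset.card_le_card hω)).trans
        (pow_le_pow_left₀ (by linarith) hsq _)
    have e3 : (1:ℝ) ≤ Real.sqrt q ^ ω₀.card := one_le_pow₀ hs1
    calc _ ≤ q ^ D.card * q ^ (kk (verts p D) (s ⊔ conn p ↑ω₀) + D.card) :=
          mul_le_mul e2 (pow_le_pow_right₀ hq e1) (by positivity) (by positivity)
      _ = (q ^ 2) ^ D.card * (1 * q ^ kk (verts p D) (s ⊔ conn p ↑ω₀)) := by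
          rw [pow_add, ← pow_mul, mul_comm 2, pow_mul]; ring
      _ ≤ _ := by gcongr
  have hm : mass q p s D (fun ω => ω = ω₀) = wt q p s D ω₀ := by
    rw [mass_eq_sum]
    refine (Finset.sum_eq_single_of_mem ω₀ (Finset.mem_powerset.2 h₀) fun ω _ h => ?_).trans ?_
    · rw [if_neg h]
    · rw [if_pos rfl]
  have hZ : mass q p s D (fun _ => True) ≤ 2 ^ D.card * ((q ^ 2) ^ D.card * wt q p s D ω₀) := by
    unfold mass
    rw [Finset.filter_true]
    refine (Finset.sum_le_card_nsmul _ _ _ fun ω hω => hw ω (Finset.mem_powerset.1 hω)).trans ?_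
    rw [Finset.card_powerset, nsmul_eq_mul]; push_cast; rfl
  unfold Pr
  rw [hm, le_div_iff₀ (mass_true_pos hq _ _ _)]
  calc _ ≤ fe q D.card * (2 ^ D.card * ((q ^ 2) ^ D.card * wt q p s D ω₀)) :=
        mul_le_mul_of_nonneg_left hZ (fe_pos hq _).le
    _ = wt q p s D ω₀ := by
        unfold fe
        rw [← mul_assoc (2 ^ D.card), ← mul_pow, inv_mul_cancel_left₀ (by positivity)]

/-- Finite energy: the configuration on `B` can be prescribed at bounded cost. -/
lemma Pr_finite_energy (hq : 1 ≤ q) {B ω₀ : Finset V} (hB : B ⊆ D) (h₀ : ω₀ ⊆ B)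
    {E : Finset V → Prop} (hE : ∀ ω ⊆ D, (E ω ↔ E (ω \ B))) :
    fe q B.card * Pr q p s D E ≤ Pr q p s D (fun ω => E ω ∧ ω ∩ B = ω₀) := by
  have hB' : ∀ ω η : Finset V, η ⊆ B → (ω \ B ∪ η) \ B = ω \ B := by
    intro ω η hη
    ext x
    have := @hη x
    simp only [Finset.mem_sdiff, Finset.mem_union]
    tauto
  refine Pr_explore_ge hq (D' := fun _ => B) (fun _ _ _ => hB) ?_ ?_
  · intro ω hω hEω η hη
    refine ⟨rfl, ?_⟩
    rw [hE _ (Finset.union_subset (Finset.sdiff_subset.trans hω) (hη.trans hB)), hB' ω η hη]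
    exact (hE ω hω).1 hEω
  · intro ω hω _
    refine (Pr_eq_ge hq h₀).trans (Pr_mono hq ?_)
    rintro η hη rfl
    ext x
    have := @hη x
    simp only [Finset.mem_sdiff, Finset.mem_union, Finset.mem_inter]
    tauto

lemma Pr_blocks (hq : 1 ≤ q) (B : ℕ → Finset V) (m : ℕ) (hm : ∀ i, (B i).card ≤ m)
    (n : ℕ) (hB : ∀ i < n, B i ⊆ D)
    (hdis : ∀ i < n, ∀ j < i, Disjoint (B j) (B i)) :
    Pr q p s D (fun ω => ∀ i < n, ω ∩ B i ≠ ∅) ≤ (1 - fe q m) ^ n := by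
  induction n with
  | zero => simpa using Pr_le_one hq _
  | succ n ih =>
    have ih' := ih (fun i hi => hB i (by omega)) fun i hi => hdis i (by omega)
    have h1 := Pr_finite_energy (p := p) (s := s) (B := B n) (ω₀ := ∅) hq (hB n (by omega))
      (Finset.empty_subset _) (E := fun ω => ∀ i < n, ω ∩ B i ≠ ∅) (by
        intro ω _
        refine forall₂_congr fun i hi => ?_
        rw [show ω \ B n ∩ B i = ω ∩ B i from ?_]
        have := Finset.disjoint_left.1 (hdis n (by omega) i hi)
        ext x
        have := @this x
        simp only [Finset.mem_sdiff, Finset.mem_inter]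
        tauto)
    have h2 := Pr_split q p s D (fun ω => ω ∩ B n = ∅) (fun ω => ∀ i < n, ω ∩ B i ≠ ∅)
    have h3 : Pr q p s D (fun ω => ∀ i < n + 1, ω ∩ B i ≠ ∅) =
        Pr q p s D (fun ω => (∀ i < n, ω ∩ B i ≠ ∅) ∧ ¬ ω ∩ B n = ∅) := by
      refine Pr_congr fun ω _ => ?_
      constructor
      · exact fun h => ⟨fun i hi => h i (by omega), h n (by omega)⟩
      · rintro ⟨h, h'⟩ i hi
        rcases Nat.lt_succ_iff_lt_or_eq.1 hi with h'' | rfl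
        · exact h i h''
        · exact h'
    have h4 := mul_le_mul_of_nonneg_right (fe_antitone hq (hm n))
      (Pr_nonneg hq p s D (fun ω => ∀ i < n, ω ∩ B i ≠ ∅))
    have h5 := fe_le_one hq m
    rw [h3, pow_succ]
    nlinarith

/-- Planar duality for the self-dual FK measure. -/
lemma Pr_dual (hq : 1 ≤ q) {s' : Setoid V}
    (h : ∀ ω ⊆ D, ∀ e ∈ D, e ∉ ω → ((s ⊔ conn p ↑ω) (lo p e) (hi p e) ↔
      ¬ (s' ⊔ conn (p + 1) ↑(D \ insert e ω)) (lo (p + 1) e) (hi (p + 1) e)))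
    (A : Finset V → Prop) :
    Pr q p s D A = Pr q (p + 1) s' D (fun ω => A (D \ ω)) := by
  have h0 : 0 < q := by linarith
  have hs0 : 0 < Real.sqrt q := Real.sqrt_pos.2 h0
  have hk : ∀ ω ⊆ D, kk (verts p D) (s ⊔ conn p ↑ω) + ω.card +
      kk (verts (p + 1) D) (s' ⊔ conn (p + 1) ↑D) =
      kk (verts (p + 1) D) (s' ⊔ conn (p + 1) ↑(D \ ω)) +
        kk (verts p D) (s ⊔ conn p ↑(∅ : Finset V)) := by
    intro ω
    induction ω using Finset.induction_on with
    | empty => intro _; simp [add_comm]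
    | insert e X he ih =>
      intro hω
      have hX := (Finset.subset_insert _ _).trans hω
      have heD : e ∈ D := hω (Finset.mem_insert_self _ _)
      have ih' := ih hX
      have hins : D \ X = insert e (D \ insert e X) := by
        ext x
        by_cases hx : x = e
        · subst hx; simp [heD, he]
        · simp [hx]
      rw [hins, sup_conn_insert] at ih'
      rw [sup_conn_insert, Finset.card_insert_of_notMem he]
      have hh := h X hX e heD he
      by_cases h1 : (s ⊔ conn p ↑X) (lo p e) (hi p e)
      · rw [kk_merge_same h1]
        have := kk_merge (hh.1 h1) (lo_mem_verts heD) (hi_mem_verts heD)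
        omega
      · have h2 := not_not.1 (fun h2 => h1 (hh.2 h2))
        rw [kk_merge_same h2] at ih'
        have := kk_merge h1 (lo_mem_verts heD) (hi_mem_verts heD)
        omega
  have hw : ∀ ω ⊆ D, wt q p s D ω * (q ^ kk (verts (p + 1) D) (s' ⊔ conn (p + 1) ↑D) *
      Real.sqrt q ^ D.card) = wt q (p + 1) s' D (D \ ω) *
        q ^ kk (verts p D) (s ⊔ conn p ↑(∅ : Finset V)) := by
    intro ω hω
    unfold wt
    have hc := Finset.card_sdiff_add_card_eq_card hω
    have e1 : Real.sqrt q ^ ω.card * Real.sqrt q ^ ω.card = q ^ ω.card := by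
      rw [← mul_pow, Real.mul_self_sqrt h0.le]
    have e2 : q ^ kk (verts p D) (s ⊔ conn p ↑ω) * q ^ ω.card *
        q ^ kk (verts (p + 1) D) (s' ⊔ conn (p + 1) ↑D) =
        q ^ kk (verts (p + 1) D) (s' ⊔ conn (p + 1) ↑(D \ ω)) *
        q ^ kk (verts p D) (s ⊔ conn p ↑(∅ : Finset V)) := by
      rw [← pow_add, ← pow_add, ← pow_add, hk ω hω]
    rw [← hc, pow_add]
    linear_combination Real.sqrt q ^ (D \ ω).card * (q ^ kk (verts p D) (s ⊔ conn p ↑ω) *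
        q ^ kk (verts (p + 1) D) (s' ⊔ conn (p + 1) ↑D) * e1 + e2)
  have hm : ∀ A : Finset V → Prop, mass q p s D A *
      (q ^ kk (verts (p + 1) D) (s' ⊔ conn (p + 1) ↑D) * Real.sqrt q ^ D.card) =
      mass q (p + 1) s' D (fun ω => A (D \ ω)) *
        q ^ kk (verts p D) (s ⊔ conn p ↑(∅ : Finset V)) := by
    intro A
    unfold mass
    rw [Finset.sum_mul, Finset.sum_mul]
    refine Finset.sum_bij (fun ω _ => D \ ω) ?_ ?_ ?_ ?_
    · intro ω hω
      simp only [Finset.mem_filter, Finset.mem_powerset] at hω ⊢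
      refine ⟨Finset.sdiff_subset, ?_⟩
      rw [Finset.sdiff_sdiff_eq_self hω.1]
      exact hω.2
    · intro a ha b hb hab
      simp only [Finset.mem_filter, Finset.mem_powerset] at ha hb
      rw [← Finset.sdiff_sdiff_eq_self ha.1, hab, Finset.sdiff_sdiff_eq_self hb.1]
    · intro ω hω
      simp only [Finset.mem_filter, Finset.mem_powerset] at hω
      refine ⟨D \ ω, ?_, Finset.sdiff_sdiff_eq_self hω.1⟩
      simp only [Finset.mem_filter, Finset.mem_powerset]
      exact ⟨Finset.sdiff_subset, hω.2⟩
    · intro ω hω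
      simp only [Finset.mem_filter, Finset.mem_powerset] at hω
      exact hw ω hω.1
  unfold Pr
  have hc1 : (0:ℝ) < q ^ kk (verts (p + 1) D) (s' ⊔ conn (p + 1) ↑D) * Real.sqrt q ^ D.card := by
    positivity
  have hc2 : (0:ℝ) < q ^ kk (verts p D) (s ⊔ conn p ↑(∅ : Finset V)) := by positivity
  rw [← mul_div_mul_right _ _ hc1.ne', hm, hm, mul_div_mul_right _ _ hc2.ne']

/-- A lattice isomorphism acting on vertices by `σ` and on cells by `γ`. -/
structure Sym (p p' : ℤ) where
  σ : V ≃ V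
  γ : V ≃ V
  compat : ∀ c, (σ (lo p c) = lo p' (γ c) ∧ σ (hi p c) = hi p' (γ c)) ∨
    (σ (lo p c) = hi p' (γ c) ∧ σ (hi p c) = lo p' (γ c))

namespace Sym
variable {p' : ℤ} (S : Sym p p')

lemma conn_iff (A : Set V) (u v : V) :
    conn p' (S.γ '' A) (S.σ u) (S.σ v) ↔ conn p A u v := by
  constructor
  · intro h
    have : conn p' (S.γ '' A) ≤ Setoid.comap S.σ.symm (conn p A) := by
      rw [conn_le_iff]
      rintro _ ⟨c, hc, rfl⟩
      change conn p A (S.σ.symm _) (S.σ.symm _)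
      rcases S.compat c with ⟨h1, h2⟩ | ⟨h1, h2⟩
      · rw [← h1, ← h2]; simpa using conn_step hc
      · rw [← h1, ← h2]; simpa using conn_symm (conn_step hc)
    have h' : conn p A (S.σ.symm (S.σ u)) (S.σ.symm (S.σ v)) := this h
    simpa using h'
  · intro h
    have : conn p A ≤ Setoid.comap S.σ (conn p' (S.γ '' A)) := by
      rw [conn_le_iff]
      intro c hc
      change conn p' _ (S.σ _) (S.σ _)
      have hm := conn_step (p := p') (Set.mem_image_of_mem S.γ hc)
      rcases S.compat c with ⟨h1, h2⟩ | ⟨h1, h2⟩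
      · rw [h1, h2]; exact hm
      · rw [h1, h2]; exact conn_symm hm
    exact this h

lemma cl_eq_image (A : Set V) (u : V) : cl p' (S.γ '' A) (S.σ u) = S.σ '' cl p A u := by
  ext v
  obtain ⟨w, rfl⟩ := S.σ.surjective v
  rw [Set.mem_image_equiv, Equiv.symm_apply_apply]
  exact S.conn_iff A u w

lemma infinite_iff (A : Set V) (u : V) :
    (cl p' (S.γ '' A) (S.σ u)).Infinite ↔ (cl p A u).Infinite := by
  rw [S.cl_eq_image, Set.infinite_image_iff S.σ.injective.injOn]

lemma verts_map (D : Finset V) :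
    verts p' (D.map S.γ.toEmbedding) = (verts p D).map S.σ.toEmbedding := by
  ext v
  simp only [mem_verts, Finset.mem_map, Equiv.coe_toEmbedding]
  constructor
  · rintro ⟨_, ⟨c, hc, rfl⟩, h⟩
    rcases S.compat c with ⟨h1, h2⟩ | ⟨h1, h2⟩ <;> rw [← h1, ← h2] at h <;>
      rcases h with h | h
    · exact ⟨_, ⟨c, hc, Or.inl rfl⟩, h⟩
    · exact ⟨_, ⟨c, hc, Or.inr rfl⟩, h⟩
    · exact ⟨_, ⟨c, hc, Or.inr rfl⟩, h⟩
    · exact ⟨_, ⟨c, hc, Or.inl rfl⟩, h⟩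
  · rintro ⟨w, ⟨c, hc, h⟩, rfl⟩
    refine ⟨_, ⟨c, hc, rfl⟩, ?_⟩
    rcases S.compat c with ⟨h1, h2⟩ | ⟨h1, h2⟩ <;> rw [← h1, ← h2] <;> rcases h with rfl | rfl <;>
      simp

lemma kk_map {W : Finset V} {r r' : Setoid V} (h : ∀ u v, r' (S.σ u) (S.σ v) ↔ r u v) :
    kk (W.map S.σ.toEmbedding) r' = kk W r := by
  unfold kk
  let φ : Quotient r → Quotient r' := Quotient.map S.σ fun a b hab => (h a b).2 hab
  have : (W.map S.σ.toEmbedding).image (Quotient.mk r') = (W.image (Quotient.mk r)).image φ := by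
    rw [Finset.image_image, Finset.map_eq_image, Finset.image_image]; rfl
  rw [this, Finset.card_image_of_injective]
  intro a b
  refine Quotient.inductionOn₂ a b fun x y hxy => ?_
  exact Quotient.sound ((h x y).1 (Quotient.exact hxy))

lemma Pr_map (F : Set V) (D : Finset V) (A : Finset V → Prop) :
    Pr q p' (conn p' (S.γ '' F)) (D.map S.γ.toEmbedding) A =
      Pr q p (conn p F) D (fun ω => A (ω.map S.γ.toEmbedding)) := by
  have hw : ∀ ω, wt q p' (conn p' (S.γ '' F)) (D.map S.γ.toEmbedding)
      (ω.map S.γ.toEmbedding) = wt q p (conn p F) D ω := by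
    intro ω
    unfold wt
    rw [Finset.card_map, S.verts_map, ← conn_union, ← conn_union, S.kk_map]
    intro u v
    rw [← S.conn_iff, Set.image_union, Finset.coe_map]
  have hm : ∀ A : Finset V → Prop, mass q p' (conn p' (S.γ '' F)) (D.map S.γ.toEmbedding) A =
      mass q p (conn p F) D (fun ω => A (ω.map S.γ.toEmbedding)) := by
    intro A
    unfold mass
    symm
    refine Finset.sum_bij (fun ω _ => ω.map S.γ.toEmbedding) ?_ ?_ ?_ ?_
    · intro ω hω
      simp only [Finset.mem_filter, Finset.mem_powerset] at hω ⊢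
      exact ⟨Finset.map_subset_map.2 hω.1, hω.2⟩
    · intro a _ b _ hab
      exact Finset.map_injective _ hab
    · intro ω hω
      simp only [Finset.mem_filter, Finset.mem_powerset] at hω
      obtain ⟨u, hu, rfl⟩ := Finset.subset_map_iff.1 hω.1
      refine ⟨u, ?_, rfl⟩
      simp only [Finset.mem_filter, Finset.mem_powerset]
      exact ⟨hu, hω.2⟩
    · intro ω _
      exact (hw ω).symm
  unfold Pr
  rw [hm, hm]

end Sym

end Markov

section Wired
open scoped Classical

variable {q : ℝ} {p : ℤ}

/-- Probability in `D`, a finite set of cells of the half-plane, with all the cells of the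
half-plane outside `D` open. -/
def Wp (q : ℝ) (p : ℤ) (D : Finset V) (A : Finset V → Prop) : ℝ :=
  Pr q p (conn p (Hc \ ↑D)) D A

/-- The cluster of `u` reaches the wired exterior of `D`. -/
def esc (p : ℤ) (D : Finset V) (u : V) (ω : Finset V) : Prop :=
  (cl p (Hc \ ↑D ∪ ↑ω) u).Infinite

lemma esc_incr (p : ℤ) (D : Finset V) (u : V) : Incr D (esc p D u) := fun _ _ hab _ h =>
  h.mono (cl_mono (Set.union_subset_union_right _ (Finset.coe_subset.2 hab)) u)

lemma esc_restrict {D E : Finset V} (hE : (E : Set V) ⊆ Hc) (hDE : D ⊆ E) {u : V}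
    {ω : Finset V} (hω : ω ⊆ E) (h : esc p E u ω) : esc p D u (ω ∩ D) := by
  refine h.mono (cl_mono ?_ u)
  rintro c (⟨h1, h2⟩ | h1)
  · exact Or.inl ⟨h1, fun h3 => h2 (hDE h3)⟩
  · by_cases h3 : c ∈ D
    · exact Or.inr (Finset.mem_coe.2 (Finset.mem_inter.2 ⟨h1, h3⟩))
    · exact Or.inl ⟨hE (hω h1), h3⟩

lemma Wp_explore (hq : 1 ≤ q) {D E : Finset V} (hE : (E : Set V) ⊆ Hc) (hDE : D ⊆ E)
    {G A B : Finset V → Prop} (hG : ∀ ω ⊆ E, (G ω ↔ G (ω \ D))) (hB : Incr D B)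
    (hAB : ∀ ω ⊆ E, A ω → B (ω ∩ D)) :
    Wp q p E (fun ω => G ω ∧ A ω) ≤ Wp q p D B * Wp q p E G := by
  refine Pr_explore_le hq (D' := fun _ => D) (fun _ _ _ => hDE) ?_ ?_
  · intro ω hω hGω η hη
    refine ⟨rfl, ?_⟩
    rw [hG _ (Finset.union_subset (Finset.sdiff_subset.trans hω) (hη.trans hDE)),
      show (ω \ D ∪ η) \ D = ω \ D from ?_]
    · exact (hG ω hω).1 hGω
    · ext x
      have := @hη x
      simp only [Finset.mem_sdiff, Finset.mem_union]
      tauto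
  · intro ω hω _
    refine le_trans (Pr_mono hq (B := B) fun η hη h => ?_) (Pr_le_of_dom hq (Dom.of_le ?_) hB)
    · have h' := hAB _ (Finset.union_subset (Finset.sdiff_subset.trans hω) (hη.trans hDE)) h
      rwa [show (ω \ D ∪ η) ∩ D = η from ?_] at h'
      ext x
      have := @hη x
      simp only [Finset.mem_sdiff, Finset.mem_union, Finset.mem_inter]
      tauto
    · rw [← conn_union]
      refine conn_mono ?_
      rintro c (⟨h1, h2⟩ | h1)
      · exact ⟨h1, fun h3 => h2 (hDE h3)⟩
      · have h1' := Finset.mem_sdiff.1 (Finset.mem_coe.1 h1)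
        exact ⟨hE (hω h1'.1), h1'.2⟩

lemma Wp_antitone (hq : 1 ≤ q) {D E : Finset V} (hE : (E : Set V) ⊆ Hc) (hDE : D ⊆ E)
    {A B : Finset V → Prop} (hB : Incr D B) (hAB : ∀ ω ⊆ E, A ω → B (ω ∩ D)) :
    Wp q p E A ≤ Wp q p D B := by
  have h := Wp_explore (p := p) hq hE hDE (G := fun _ => True) (fun _ _ => Iff.rfl) hB hAB
  have h1 : Wp q p E (fun _ => True) = 1 := Pr_true hq _ _ _
  rw [h1, mul_one] at h
  simpa using h

/-- Horizontal translation. -/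
def shiftSym (p p' t : ℤ) (h : (t + p' - p) % 2 = 0) : Sym p p' where
  σ := (Equiv.addRight t).prodCongr (Equiv.refl ℤ)
  γ := (Equiv.addRight t).prodCongr (Equiv.refl ℤ)
  compat c := by
    left
    by_cases hp : (c.1 + c.2 + p) % 2 = 0
    · have hp' : (c.1 + t + c.2 + p') % 2 = 0 := by omega
      simp only [lo, hi, Equiv.prodCongr_apply, Prod.map, Equiv.coe_addRight, Equiv.refl_apply,
        hp, hp', if_true]
      exact ⟨trivial, by ext <;> simp; ring⟩
    · have hp' : (c.1 + t + c.2 + p') % 2 ≠ 0 := by omega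
      simp only [lo, hi, Equiv.prodCongr_apply, Prod.map, Equiv.coe_addRight, Equiv.refl_apply,
        hp, hp', if_false]
      exact ⟨by ext <;> simp; ring, trivial⟩

lemma exists_shift (p p' t : ℤ) (h : (t + p' - p) % 2 = 0) : ∃ S : Sym p p', S.γ '' Hc = Hc ∧
    (∀ v, S.σ v = (v.1 + t, v.2)) ∧ ∀ v, S.γ v = (v.1 + t, v.2) := by
  refine ⟨shiftSym p p' t h, ?_, fun _ => rfl, fun _ => rfl⟩
  ext c
  rw [Set.mem_image_equiv]
  simp [shiftSym, Hc]

/-- Horizontal reflection. -/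
def reflSym (p : ℤ) : Sym p p where
  σ := (Equiv.neg ℤ).prodCongr (Equiv.refl ℤ)
  γ := (Equiv.subLeft (-1 : ℤ)).prodCongr (Equiv.refl ℤ)
  compat c := by
    by_cases hp : (c.1 + c.2 + p) % 2 = 0
    · have hp' : (-1 - c.1 + c.2 + p) % 2 ≠ 0 := by omega
      left
      simp only [lo, hi, Equiv.prodCongr_apply, Prod.map, Equiv.subLeft_apply, Equiv.neg_apply,
        Equiv.refl_apply, hp, hp', if_true, if_false]
      exact ⟨by ext <;> simp; omega, by ext <;> simp; omega⟩
    · have hp' : (-1 - c.1 + c.2 + p) % 2 = 0 := by omega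
      left
      simp only [lo, hi, Equiv.prodCongr_apply, Prod.map, Equiv.subLeft_apply, Equiv.neg_apply,
        Equiv.refl_apply, hp, hp', if_true, if_false]
      exact ⟨by ext <;> simp; omega, by ext <;> simp; omega⟩

lemma exists_refl (p : ℤ) : ∃ S : Sym p p, S.γ '' Hc = Hc ∧
    (∀ v, S.σ v = (-v.1, v.2)) ∧ ∀ v, S.γ v = (-1 - v.1, v.2) := by
  refine ⟨reflSym p, ?_, fun _ => rfl, fun _ => rfl⟩
  ext c
  rw [Set.mem_image_equiv]
  simp [reflSym, Hc]

section
variable {p' : ℤ} (S : Sym p p')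

lemma Sym.image_ext (hS : S.γ '' Hc = Hc) (D ω : Finset V) :
    S.γ '' (Hc \ ↑D ∪ ↑ω) = Hc \ ↑(D.map S.γ.toEmbedding) ∪ ↑(ω.map S.γ.toEmbedding) := by
  rw [Set.image_union, Set.image_sdiff S.γ.injective, hS, Finset.coe_map, Finset.coe_map]
  rfl

lemma Sym.Wp_map (hS : S.γ '' Hc = Hc) (D : Finset V) (A : Finset V → Prop) :
    Wp q p' (D.map S.γ.toEmbedding) A = Wp q p D (fun ω => A (ω.map S.γ.toEmbedding)) := by
  unfold Wp
  rw [← S.Pr_map, Set.image_sdiff S.γ.injective, hS, Finset.coe_map]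
  rfl

lemma Sym.esc_map (hS : S.γ '' Hc = Hc) (D ω : Finset V) (u : V) :
    esc p' (D.map S.γ.toEmbedding) (S.σ u) (ω.map S.γ.toEmbedding) ↔ esc p D u ω := by
  unfold esc
  rw [← S.image_ext hS, S.infinite_iff]

lemma Sym.map_Hc (hS : S.γ '' Hc = Hc) {D : Finset V} (hD : (D : Set V) ⊆ Hc) :
    ((D.map S.γ.toEmbedding : Finset V) : Set V) ⊆ Hc := by
  rw [Finset.coe_map, ← hS]
  exact Set.image_mono hD

lemma Sym.exists_map_eq (hS : S.γ '' Hc = Hc) {E : Finset V} (hE : (E : Set V) ⊆ Hc) :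
    ∃ F : Finset V, (F : Set V) ⊆ Hc ∧ F.map S.γ.toEmbedding = E := by
  have h : (E.map S.γ.symm.toEmbedding).map S.γ.toEmbedding = E := by
    ext c
    simp only [Finset.mem_map, Equiv.coe_toEmbedding]
    constructor
    · rintro ⟨_, ⟨c, hc, rfl⟩, rfl⟩
      simpa using hc
    · exact fun hc => ⟨_, ⟨c, hc, rfl⟩, by simp⟩
  refine ⟨_, fun c hc => ?_, h⟩
  have h1 : S.γ c ∈ S.γ '' Hc := by
    rw [hS]
    apply hE
    rw [← h]
    exact Finset.mem_coe.2 (Finset.mem_map.2 ⟨c, hc, rfl⟩)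
  simpa using h1

end

/-- Finite sets of cells of the half-plane. -/
abbrev Dm : Type := {D : Finset V // (D : Set V) ⊆ Hc}

/-- Infimum over domains of the probability that some point of `[-k, k]` escapes. -/
def cinf (q : ℝ) (k : ℤ) : ℝ :=
  ⨅ D : Dm, Wp q 0 D.1 fun ω => ∃ x : ℤ, |x| ≤ k ∧ esc 0 D.1 (x, 0) ω

lemma Wp_nonneg (hq : 1 ≤ q) (p : ℤ) (D : Finset V) (A : Finset V → Prop) : 0 ≤ Wp q p D A :=
  Pr_nonneg hq _ _ _ _

lemma cinf_bdd (hq : 1 ≤ q) (A : Dm → Finset V → Prop) :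
    BddBelow (Set.range fun D : Dm => Wp q p D.1 (A D)) :=
  ⟨0, by rintro _ ⟨D, rfl⟩; exact Wp_nonneg hq _ _ _⟩

instance : Nonempty Dm := ⟨⟨∅, by simp⟩⟩

lemma cinf_le (hq : 1 ≤ q) (k : ℤ) (D : Dm) :
    cinf q k ≤ Wp q 0 D.1 fun ω => ∃ x : ℤ, |x| ≤ k ∧ esc 0 D.1 (x, 0) ω :=
  ciInf_le (cinf_bdd hq _) D

lemma cinf_mono (hq : 1 ≤ q) {k l : ℤ} (h : k ≤ l) : cinf q k ≤ cinf q l :=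
  ciInf_mono (cinf_bdd hq _) fun _ => Pr_mono hq fun _ _ ⟨x, h1, h2⟩ => ⟨x, h1.trans h, h2⟩

lemma cinf_le_one (hq : 1 ≤ q) (k : ℤ) : cinf q k ≤ 1 :=
  (cinf_le hq k ⟨∅, by simp⟩).trans (Pr_le_one hq _)

lemma cinf_nonneg (hq : 1 ≤ q) (k : ℤ) : 0 ≤ cinf q k := le_ciInf fun _ => Wp_nonneg hq _ _ _

lemma exists_disjoint_shift (D : Finset V) : ∃ t : ℤ, t % 2 = 0 ∧ 0 ≤ t ∧
    ∀ c ∈ D, ∀ d ∈ D, (c.1 + t, c.2) ≠ d := by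
  obtain ⟨m, hm⟩ : ∃ m : ℤ, ∀ c ∈ D, |c.1| ≤ m := by
    obtain ⟨m, hm⟩ := (D.image fun c : V => |c.1|).bddAbove
    exact ⟨m, fun c hc => hm (Finset.mem_coe.2 (Finset.mem_image_of_mem _ hc))⟩
  refine ⟨2 * |m| + 2, by omega, by positivity, ?_⟩
  rintro c hc d hd rfl
  have h1 := abs_le.1 (hm c hc)
  have h2 := abs_le.1 (hm _ hd)
  have := le_abs_self m
  dsimp only at h2
  omega

lemma Pr_and_ge (q : ℝ) (p : ℤ) (s : Setoid V) (D : Finset V) (A B : Finset V → Prop) :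
    Pr q p s D A + Pr q p s D B - Pr q p s D (fun ω => A ω ∨ B ω) ≤
      Pr q p s D (fun ω => A ω ∧ B ω) := by
  have h3 := Pr_split q p s D A (fun ω => A ω ∨ B ω)
  have h4 := Pr_split q p s D A B
  have h5 : Pr q p s D (fun ω => (A ω ∨ B ω) ∧ A ω) = Pr q p s D A :=
    Pr_congr fun ω _ => by tauto
  have h6 : Pr q p s D (fun ω => (A ω ∨ B ω) ∧ ¬ A ω) = Pr q p s D (fun ω => B ω ∧ ¬ A ω) :=
    Pr_congr fun ω _ => by tauto
  have h7 : Pr q p s D (fun ω => B ω ∧ A ω) = Pr q p s D (fun ω => A ω ∧ B ω) :=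
    Pr_congr fun ω _ => and_comm
  linarith

lemma Incr.exists {α : Type*} {D : Finset V} {A : α → Finset V → Prop} (h : ∀ x, Incr D (A x)) :
    Incr D fun ω => ∃ x, A x ω := fun a b hab hb ⟨x, hx⟩ => ⟨x, h x a b hab hb hx⟩

lemma Incr.and {D : Finset V} {A : Prop} {B : Finset V → Prop} (h : Incr D B) :
    Incr D fun ω => A ∧ B ω := fun a b hab hb ⟨h1, h2⟩ => ⟨h1, h a b hab hb h2⟩

lemma cinf_step (hq : 1 ≤ q) {k : ℤ} {ε M : ℝ} (hε : 0 < ε) (hM : ∀ l, cinf q l ≤ M) :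
    2 * cinf q k - M - ε ≤ (cinf q k + ε) ^ 2 := by
  obtain ⟨⟨D, hD⟩, hDk⟩ := exists_lt_of_ciInf_lt (lt_add_of_pos_right (cinf q k) hε)
  dsimp only at hDk
  obtain ⟨t, ht, ht0, hdis⟩ := exists_disjoint_shift D
  obtain ⟨⟨E₀, hE₀⟩, hE₀k⟩ := exists_lt_of_ciInf_lt (lt_add_of_pos_right (cinf q (k + t)) hε)
  dsimp only at hE₀k
  have hpar : (t + 0 - 0) % 2 = 0 := by omega
  obtain ⟨S, hS, hSσ, hSγ⟩ := exists_shift 0 0 t hpar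
  let D₂ := D.map S.γ.toEmbedding
  have hD₂ : (D₂ : Set V) ⊆ Hc := S.map_Hc hS hD
  let E := E₀ ∪ (D ∪ D₂)
  have hE : (E : Set V) ⊆ Hc := by
    simp only [E, Finset.coe_union]
    exact Set.union_subset hE₀ (Set.union_subset hD hD₂)
  have hDE : D ⊆ E := fun c hc => Finset.mem_union_right _ (Finset.mem_union_left _ hc)
  have hD₂E : D₂ ⊆ E := fun c hc => Finset.mem_union_right _ (Finset.mem_union_right _ hc)
  have hdis' : Disjoint D₂ D := by
    rw [Finset.disjoint_left]
    intro c hc hc'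
    obtain ⟨d, hd, rfl⟩ := Finset.mem_map.1 hc
    exact hdis d hd _ hc' (hSγ d).symm
  let A : Finset V → Finset V → Prop := fun F ω => ∃ x : ℤ, |x| ≤ k ∧ esc 0 F (x, 0) ω
  let A₂ : Finset V → Finset V → Prop := fun F ω => ∃ x : ℤ, |x| ≤ k ∧ esc 0 F (x + t, 0) ω
  have hAi : ∀ F, Incr F (A F) := fun F => Incr.exists fun x => (esc_incr _ _ _).and
  have hA₂i : ∀ F, Incr F (A₂ F) := fun F => Incr.exists fun x => (esc_incr _ _ _).and
  have hAr : ∀ F ⊆ E, ∀ ω ⊆ E, A E ω → A F (ω ∩ F) := fun F hF ω hω ⟨x, h1, h2⟩ =>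
    ⟨x, h1, esc_restrict hE hF hω h2⟩
  have hA₂r : ∀ F ⊆ E, ∀ ω ⊆ E, A₂ E ω → A₂ F (ω ∩ F) := fun F hF ω hω ⟨x, h1, h2⟩ =>
    ⟨x, h1, esc_restrict hE hF hω h2⟩
  have hshift : ∀ F : Finset V, Wp q 0 (F.map S.γ.toEmbedding) (A₂ (F.map S.γ.toEmbedding)) =
      Wp q 0 F (A F) := by
    intro F
    rw [S.Wp_map hS]
    refine Pr_congr fun ω _ => exists_congr fun x => and_congr Iff.rfl ?_
    have := S.esc_map hS F ω (x, 0)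
    rwa [hSσ] at this
  have hu : Wp q 0 E (fun ω => A₂ D₂ (ω ∩ D₂) ∧ A E ω) ≤ Wp q 0 D (A D) * Wp q 0 D (A D) := by
    refine (Wp_explore hq hE hDE ?_ (hAi D) (hAr D hDE)).trans
      (mul_le_mul_of_nonneg_left ?_ (Wp_nonneg hq _ _ _))
    · intro ω _
      rw [show ω \ D ∩ D₂ = ω ∩ D₂ from ?_]
      ext c
      have := fun h : c ∈ D₂ => Finset.disjoint_left.1 hdis' h
      simp only [Finset.mem_inter, Finset.mem_sdiff]
      tauto
    · rw [← hshift D]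
      exact Wp_antitone hq hE hD₂E (hA₂i D₂) fun ω _ h => h
  have hu' : Wp q 0 E (fun ω => A E ω ∧ A₂ E ω) ≤ Wp q 0 D (A D) * Wp q 0 D (A D) :=
    (Pr_mono hq fun ω hω h => ⟨hA₂r D₂ hD₂E ω hω h.2, h.1⟩).trans hu
  have hor : Wp q 0 E (fun ω => A E ω ∨ A₂ E ω) ≤ M + ε := by
    have : Wp q 0 E (fun ω => A E ω ∨ A₂ E ω) ≤
        Wp q 0 E₀ fun ω => ∃ x : ℤ, |x| ≤ k + t ∧ esc 0 E₀ (x, 0) ω := by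
      refine Wp_antitone hq hE Finset.subset_union_left
        (Incr.exists fun x => (esc_incr _ _ _).and) ?_
      rintro ω hω (⟨x, h1, h2⟩ | ⟨x, h1, h2⟩)
      · exact ⟨x, by omega, esc_restrict hE Finset.subset_union_left hω h2⟩
      · refine ⟨x + t, ?_, esc_restrict hE Finset.subset_union_left hω h2⟩
        exact (abs_add_le x t).trans (by rw [abs_of_nonneg ht0]; omega)
    have := hM (k + t)
    linarith
  have h1 : cinf q k ≤ Wp q 0 E (A E) := cinf_le hq k ⟨E, hE⟩
  have h2 : cinf q k ≤ Wp q 0 E (A₂ E) := by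
    obtain ⟨F, hF, hFE⟩ := S.exists_map_eq hS hE
    have := hshift F
    rw [hFE] at this
    rw [this]
    exact cinf_le hq k ⟨F, hF⟩
  have h3 : Wp q 0 E (A E) + Wp q 0 E (A₂ E) - Wp q 0 E (fun ω => A E ω ∨ A₂ E ω) ≤
      Wp q 0 E (fun ω => A E ω ∧ A₂ E ω) := Pr_and_ge _ _ _ _ _ _
  have h8 : Wp q 0 D (A D) * Wp q 0 D (A D) ≤ (cinf q k + ε) ^ 2 := by
    rw [sq]
    exact mul_self_le_mul_self (Wp_nonneg hq _ _ _) hDk.le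
  linarith

/-- The supremum of `cinf` is `0` or `1`. -/
lemma exists_cinf_gt (hq : 1 ≤ q) (h0 : 0 < cinf q 0) {δ : ℝ} (hδ : 0 < δ) :
    ∃ k : ℤ, 1 - δ < cinf q k := by
  have hb : BddAbove (Set.range (cinf q)) := ⟨1, by rintro _ ⟨k, rfl⟩; exact cinf_le_one hq k⟩
  set M := ⨆ k, cinf q k with hM
  have hle : ∀ k, cinf q k ≤ M := fun k => le_ciSup hb k
  have hM0 : 0 < M := h0.trans_le (hle 0)
  have hM1 : M ≤ 1 := ciSup_le (cinf_le_one hq)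
  have hMM : M ≤ M ^ 2 := by
    refine le_of_forall_pos_le_add fun ε hε => ?_
    have hε' : 0 < min (ε / 6) 1 := by positivity
    set d := min (ε / 6) 1 with hd
    have hd1 : d ≤ 1 := min_le_right _ _
    have hd2 : d ≤ ε / 6 := min_le_left _ _
    obtain ⟨k, hk⟩ := exists_lt_of_lt_ciSup (sub_lt_self M hε')
    have h1 := cinf_step (k := k) hq hε' hle
    have h2 := hle k
    have h3 := cinf_nonneg hq k
    have h4 : (cinf q k + d) ^ 2 ≤ (M + d) ^ 2 := by gcongr
    nlinarith
  have hM1' : 1 ≤ M := by nlinarith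
  exact exists_lt_of_lt_ciSup (by linarith : 1 - δ < ⨆ k, cinf q k)

end Wired

section Columns
open scoped Classical

/-- The cells above height `h`. -/
def Up (h : ℤ) : Set V := {c | h ≤ c.2}

lemma verts_of_conn {p : ℤ} {A : Set V} {u v : V} (h : conn p A u v) :
    v = u ∨ ∃ c ∈ A, lo p c = v ∨ hi p c = v := by
  have := conn_inv (fun w : V => if ∃ c ∈ A, lo p c = w ∨ hi p c = w then none else some w)
    (fun c hc => by
      rw [if_pos ⟨c, hc, Or.inl rfl⟩, if_pos ⟨c, hc, Or.inr rfl⟩]) h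
  split_ifs at this with h1 h2 h2
  · exact Or.inr h2
  · exact Or.inl (Option.some.inj this).symm

lemma cl_finite_of_finite {p : ℤ} (ω : Finset V) (u : V) : (cl p ↑ω u).Finite := by
  refine ((verts p ω).finite_toSet.union (Set.finite_singleton u)).subset fun v hv => ?_
  rcases verts_of_conn hv with h | ⟨c, hc, h⟩
  · exact Or.inr h
  · exact Or.inl (Finset.mem_coe.2 (mem_verts.2 ⟨c, hc, h⟩))

lemma reaches_top {p h : ℤ} {A : Set V} {ω : Finset V} (hA : A ⊆ Up h ∪ ↑ω) {u : V}
    (hu : (cl p A u).Infinite) : ∃ v, h ≤ v.2 ∧ (v.1 + v.2 + p) % 2 = 0 ∧ conn p A u v := by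
  by_contra! hcon
  refine hu (((verts p ω).finite_toSet.union (Set.finite_singleton u)).subset fun v hv => ?_)
  rcases verts_of_conn hv with hh | ⟨c, hc, hh⟩
  · exact Or.inr hh
  · rcases hA hc with h1 | h1
    · have h1' : h ≤ c.2 := h1
      exfalso
      have hlo := lo_snd p c
      have hhi := hi_snd p c
      have plo := lo_parity p c
      have phi := hi_parity p c
      rcases hh with rfl | rfl
      · exact hcon _ (by omega) plo hv
      · exact hcon _ (by omega) phi hv
    · exact Or.inl (Finset.mem_coe.2 (mem_verts.2 ⟨c, h1, hh⟩))

lemma infinite_of_reaches_top {p h : ℤ} {A : Set V} (hA : Up h ⊆ A) {u v : V} (hv : h ≤ v.2)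
    (hvp : (v.1 + v.2 + p) % 2 = 0) (huv : conn p A u v) : (cl p A u).Infinite := by
  have hinj : Function.Injective fun m : ℕ => ((v.1 + 2 * (m : ℤ), v.2) : V) := by
    intro a b hab
    have := congrArg Prod.fst hab
    dsimp only at this
    omega
  refine (Set.infinite_range_of_injective hinj).mono ?_
  rintro _ ⟨m, rfl⟩
  exact conn_trans huv (conn_upper hA hv hv hvp (by dsimp only; omega))

lemma slab_conn {p h I J : ℤ} {F a : Set V}
    (hF : ∀ c ∈ F, h ≤ c.2 ∨ c.1 < I ∨ J < c.1) (ha : ∀ c ∈ a, I < c.1 ∧ c.1 < J)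
    {t : V} (ht : h ≤ t.2) (htp : (t.1 + t.2 + p) % 2 = 0) {u v : V} (huv : conn p (F ∪ a) u v) :
    (if (I < u.1 ∧ u.1 ≤ J) ∨ h ≤ u.2 then Quotient.mk (conn p (Up h ∪ a)) u else
      Quotient.mk _ t) =
    (if (I < v.1 ∧ v.1 ≤ J) ∨ h ≤ v.2 then Quotient.mk (conn p (Up h ∪ a)) v else
      Quotient.mk _ t) := by
  refine conn_inv (fun u : V => if (I < u.1 ∧ u.1 ≤ J) ∨ h ≤ u.2 then
    Quotient.mk (conn p (Up h ∪ a)) u else Quotient.mk _ t) (fun c hc => ?_) huv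
  have h1 := lo_snd p c
  have h2 := hi_snd p c
  have h3 := lo_parity p c
  have h4 := hi_parity p c
  have h5 : c.1 ≤ (lo p c).1 ∧ (lo p c).1 ≤ c.1 + 1 := by unfold lo; split_ifs <;> simp
  have h6 : c.1 ≤ (hi p c).1 ∧ (hi p c).1 ≤ c.1 + 1 := by unfold hi; split_ifs <;> simp
  by_cases hcB : c ∈ Up h ∪ a
  · have hr : (I < (lo p c).1 ∧ (lo p c).1 ≤ J) ∨ h ≤ (lo p c).2 := by
      rcases hcB with hc' | hc'
      · exact Or.inr (by have : h ≤ c.2 := hc'; omega)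
      · have := ha c hc'
        left; omega
    have hr' : (I < (hi p c).1 ∧ (hi p c).1 ≤ J) ∨ h ≤ (hi p c).2 := by
      rcases hcB with hc' | hc'
      · exact Or.inr (by have : h ≤ c.2 := hc'; omega)
      · have := ha c hc'
        left; omega
    rw [if_pos hr, if_pos hr']
    exact Quotient.sound (conn_step hcB)
  · have hcF : c ∈ F := hc.resolve_right fun h' => hcB (Or.inr h')
    have hlt : ¬ h ≤ c.2 := fun h' => hcB (Or.inl h')
    have hout := (hF c hcF).resolve_left hlt
    rw [if_neg (by omega)]
    split_ifs with hi'
    · exact Quotient.sound (conn_upper (h := h) Set.subset_union_left ht (by omega) htp h4)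
    · rfl

lemma slab_infinite {p h I J : ℤ} (h0 : 0 < h) {F a : Set V} (hFH : F ⊆ Hc) (haH : a ⊆ Hc)
    (hF : ∀ c ∈ F, h ≤ c.2 ∨ c.1 < I ∨ J < c.1) (ha : ∀ c ∈ a, I < c.1 ∧ c.1 < J)
    {x : ℤ} (hx : I < x ∧ x ≤ J) (hinf : (cl p (F ∪ a) (x, 0)).Infinite) :
    (cl p (Up h ∪ a) (x, 0)).Infinite := by
  obtain ⟨t, ht, htp⟩ : ∃ t : V, h ≤ t.2 ∧ (t.1 + t.2 + p) % 2 = 0 :=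
    ⟨(-h - p, h), le_rfl, by dsimp only; omega⟩
  obtain ⟨v, hv, hv'⟩ : ∃ v ∈ cl p (F ∪ a) (x, 0),
      v ∉ Finset.Icc (I + 1) J ×ˢ Finset.Icc 0 (h - 1) := by
    by_contra! hcon
    exact hinf ((Finset.finite_toSet _).subset fun v hv => Finset.mem_coe.2 (hcon v hv))
  have hv0 := conn_snd_nonneg (Set.union_subset hFH haH) (by simp) hv
  have hne : ((x, 0) : V) ≠ v := by
    rintro rfl
    apply hv'
    simp only [Finset.mem_product, Finset.mem_Icc]
    omega
  have hvp := (conn_parity hv hne).2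
  have key := slab_conn hF ha ht htp hv
  rw [if_pos (Or.inl hx)] at key
  simp only [Finset.mem_product, Finset.mem_Icc] at hv'
  split_ifs at key with hc
  · exact infinite_of_reaches_top Set.subset_union_left (by omega) hvp (Quotient.exact key)
  · exact infinite_of_reaches_top Set.subset_union_left ht htp (Quotient.exact key)

/-- The rectangle `[-n, n) × [0, h)` of cells. -/
def box (n h : ℕ) : Finset V := Finset.Ico (-(n : ℤ)) n ×ˢ Finset.Ico 0 (h : ℤ)

lemma mem_box {n h : ℕ} {c : V} : c ∈ box n h ↔ (-(n : ℤ) ≤ c.1 ∧ c.1 < n) ∧ 0 ≤ c.2 ∧ c.2 < h := by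
  simp [box]

lemma box_Hc (n h : ℕ) : (box n h : Set V) ⊆ Hc := fun _ hc =>
  (mem_box.1 (Finset.mem_coe.1 hc)).2.1

/-- The column `i` is closed up to height `h`. -/
def colC (h : ℕ) (ω : Finset V) (i : ℤ) : Prop := ∀ y : ℤ, 0 ≤ y → y < h → (i, y) ∉ ω

/-- There are closed columns on both sides of the origin. -/
def Col (n h : ℕ) (ω : Finset V) : Prop :=
  (∃ i : ℤ, (-(n : ℤ) ≤ i ∧ i < 0) ∧ colC h ω i) ∧ ∃ j : ℤ, (0 ≤ j ∧ j < n) ∧ colC h ω j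

lemma Col.exists_extremal {n h : ℕ} {ω : Finset V} (hc : Col n h ω) :
    ∃ I J : ℤ, -(n : ℤ) ≤ I ∧ I < 0 ∧ 0 ≤ J ∧ J < n ∧ colC h ω I ∧ colC h ω J ∧
      (∀ i : ℤ, -(n : ℤ) ≤ i → i < I → ¬ colC h ω i) ∧ ∀ j : ℤ, j < n → J < j → ¬ colC h ω j := by
  obtain ⟨⟨i, hi, hic⟩, j, hj, hjc⟩ := hc
  obtain ⟨I, hI, hI'⟩ := Int.exists_least_of_bdd
    (P := fun i : ℤ => (-(n : ℤ) ≤ i ∧ i < 0) ∧ colC h ω i) ⟨-n, fun z hz => hz.1.1⟩ ⟨i, hi, hic⟩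
  obtain ⟨J, hJ, hJ'⟩ := Int.exists_greatest_of_bdd
    (P := fun j : ℤ => (0 ≤ j ∧ j < n) ∧ colC h ω j) ⟨n, fun z hz => hz.1.2.le⟩ ⟨j, hj, hjc⟩
  refine ⟨I, J, hI.1.1, hI.1.2, hJ.1.1, hJ.1.2, hI.2, hJ.2, fun i h1 h2 h3 => ?_,
    fun j h1 h2 h3 => ?_⟩
  · exact absurd (hI' i ⟨⟨h1, h2.trans hI.1.2⟩, h3⟩) (not_le.2 h2)
  · exact absurd (hJ' j ⟨⟨hJ.1.1.trans h2.le, h1⟩, h3⟩) (not_le.2 h2)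

/-- The cells of the box strictly between the outermost closed columns. -/
def inner (n h : ℕ) (ω : Finset V) : Finset V :=
  (box n h).filter fun c => (∃ i : ℤ, (-(n : ℤ) ≤ i ∧ i < 0) ∧ colC h ω i ∧ i < c.1) ∧
    ∃ j : ℤ, (0 ≤ j ∧ j < n) ∧ colC h ω j ∧ c.1 < j

lemma inner_eq {n h : ℕ} {ω : Finset V} {I J : ℤ} (h1 : -(n : ℤ) ≤ I) (h2 : I < 0) (h3 : 0 ≤ J)
    (h4 : J < n) (h5 : colC h ω I) (h6 : colC h ω J)
    (h7 : ∀ i : ℤ, -(n : ℤ) ≤ i → i < I → ¬ colC h ω i)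
    (h8 : ∀ j : ℤ, j < n → J < j → ¬ colC h ω j) :
    inner n h ω = (box n h).filter fun c => I < c.1 ∧ c.1 < J := by
  unfold inner
  refine Finset.filter_congr fun c _ => ?_
  constructor
  · rintro ⟨⟨i, hi, hic, hi'⟩, j, hj, hjc, hj'⟩
    constructor
    · by_contra hcon
      exact h7 i hi.1 (by omega) hic
    · by_contra hcon
      exact h8 j hj.2 (by omega) hjc
  · rintro ⟨hI, hJ⟩
    exact ⟨⟨I, ⟨h1, h2⟩, h5, hI⟩, J, ⟨h3, h4⟩, h6, hJ⟩

lemma inner_stable {n h : ℕ} {ω η : Finset V} (hc : Col n h ω) (hη : η ⊆ inner n h ω) :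
    inner n h (ω \ inner n h ω ∪ η) = inner n h ω ∧ Col n h (ω \ inner n h ω ∪ η) := by
  obtain ⟨I, J, h1, h2, h3, h4, h5, h6, h7, h8⟩ := hc.exists_extremal
  have he := inner_eq h1 h2 h3 h4 h5 h6 h7 h8
  have hout : ∀ i : ℤ, i ≤ I ∨ J ≤ i → (colC h (ω \ inner n h ω ∪ η) i ↔ colC h ω i) := by
    intro i hi
    refine forall_congr' fun y => forall₂_congr fun _ _ => not_congr ?_
    have hn : (i, y) ∉ inner n h ω := by
      rw [he, Finset.mem_filter]
      dsimp only
      omega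
    have hn' : (i, y) ∉ η := fun h' => hn (hη h')
    simp [hn, hn']
  have h5' := (hout I (Or.inl le_rfl)).2 h5
  have h6' := (hout J (Or.inr le_rfl)).2 h6
  refine ⟨?_, ⟨I, ⟨h1, h2⟩, h5'⟩, J, ⟨h3, h4⟩, h6'⟩
  have hnew := inner_eq h1 h2 h3 h4 h5' h6'
    (fun i hi hiI => by rw [hout i (Or.inl hiI.le)]; exact h7 i hi hiI)
    (fun j hj hjJ => by rw [hout j (Or.inr hjJ.le)]; exact h8 j hj hjJ)
  rw [hnew, ← he]

variable {q : ℝ}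

lemma Wp_col (hq : 1 ≤ q) {n h : ℕ} (h0 : 0 < h) :
    Wp q 0 (box n h) (fun ω => Col n h ω ∧ esc 0 (box n h) (0, 0) ω) ≤
      Pr q 0 (conn 0 (Up h)) (box n h) (fun ω => (cl 0 (Up h ∪ ↑ω) (0, 0)).Infinite) := by
  set X := Pr q 0 (conn 0 (Up h)) (box n h) (fun ω => (cl 0 (Up h ∪ ↑ω) (0, 0)).Infinite) with hX
  have hX0 : 0 ≤ X := Pr_nonneg hq _ _ _ _
  have hinc : ∀ D, Incr D fun ω => (cl 0 (Up h ∪ ↑ω) (0, 0)).Infinite := fun D a b hab _ hh =>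
    hh.mono (cl_mono (Set.union_subset_union_right _ (Finset.coe_subset.2 hab)) _)
  have hmain : Wp q 0 (box n h) (fun ω => Col n h ω ∧ esc 0 (box n h) (0, 0) ω) ≤
      X * Wp q 0 (box n h) (Col n h) := by
    refine Pr_explore_le hq (D' := inner n h) (fun _ _ _ => Finset.filter_subset _ _)
      (fun ω _ hω η hη => inner_stable hω hη) fun ω hωD hω => ?_
    obtain ⟨I, J, h1, h2, h3, h4, h5, h6, h7, h8⟩ := hω.exists_extremal
    have he := inner_eq h1 h2 h3 h4 h5 h6 h7 h8
    have hsub : inner n h ω ⊆ box n h := Finset.filter_subset _ _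
    have hF : ∀ c ∈ Hc \ ↑(box n h) ∪ ↑(ω \ inner n h ω), (h : ℤ) ≤ c.2 ∨ c.1 < I ∨ J < c.1 := by
      rintro c (⟨hc1, hc2⟩ | hc)
      · have hc1' : 0 ≤ c.2 := hc1
        rw [Finset.mem_coe, mem_box] at hc2
        omega
      · rw [Finset.mem_coe, Finset.mem_sdiff, he, Finset.mem_filter] at hc
        have hb := hωD hc.1
        have hb' := mem_box.1 hb
        have hI : c.1 ≠ I := by
          intro hh
          exact h5 c.2 hb'.2.1 hb'.2.2 (hh ▸ hc.1)
        have hJ : c.1 ≠ J := by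
          intro hh
          exact h6 c.2 hb'.2.1 hb'.2.2 (hh ▸ hc.1)
        have : ¬ (I < c.1 ∧ c.1 < J) := fun hh => hc.2 ⟨hb, hh⟩
        omega
    have ha : ∀ a ⊆ inner n h ω, ∀ c ∈ (a : Set V), I < c.1 ∧ c.1 < J := by
      intro a ha c hc
      have := ha hc
      rw [he, Finset.mem_filter] at this
      exact this.2
    have hFH : Hc \ ↑(box n h) ∪ ↑(ω \ inner n h ω) ⊆ Hc := by
      rintro c (hc | hc)
      · exact hc.1
      · exact box_Hc n h (hωD (Finset.mem_sdiff.1 hc).1)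
    calc Pr q 0 (conn 0 (Hc \ ↑(box n h)) ⊔ conn 0 ↑(ω \ inner n h ω)) (inner n h ω)
          (fun η => esc 0 (box n h) (0, 0) (ω \ inner n h ω ∪ η))
        ≤ Pr q 0 (conn 0 (Hc \ ↑(box n h)) ⊔ conn 0 ↑(ω \ inner n h ω)) (inner n h ω)
          (fun η => (cl 0 (Up h ∪ ↑η) (0, 0)).Infinite) := by
          refine Pr_mono hq fun η hη hesc => ?_
          refine slab_infinite (by omega) hFH (fun c hc => box_Hc n h (hsub (hη hc))) hF (ha η hη)
            ⟨h2, h3⟩ ?_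
          unfold esc at hesc
          rwa [Finset.coe_union, ← Set.union_assoc] at hesc
      _ ≤ Pr q 0 (conn 0 (Up h)) (inner n h ω)
          (fun η => (cl 0 (Up h ∪ ↑η) (0, 0)).Infinite) := by
          refine Pr_le_of_dom hq ?_ (hinc _)
          intro a haD e he' hconn
          rw [← conn_union, ← conn_union] at hconn
          rw [← conn_union]
          have hk := slab_conn (t := (-(h:ℤ), (h:ℤ))) hF (ha a haD) le_rfl (by simp) hconn
          have e1 := ha _ (Finset.Subset.refl _) e he'
          have e5 : e.1 ≤ (lo 0 e).1 ∧ (lo 0 e).1 ≤ e.1 + 1 := by unfold lo; split_ifs <;> simp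
          have e6 : e.1 ≤ (hi 0 e).1 ∧ (hi 0 e).1 ≤ e.1 + 1 := by unfold hi; split_ifs <;> simp
          rw [if_pos (Or.inl (by omega)), if_pos (Or.inl (by omega))] at hk
          exact Quotient.exact hk
      _ ≤ X := by
          have hx := Pr_explore_ge (q := q) (p := 0) (s := conn 0 (Up h)) (D := box n h) hq
            (G := fun _ => True) (A := fun ω => (cl 0 (Up h ∪ ↑ω) (0, 0)).Infinite)
            (D' := fun _ => inner n h ω)
            (ε := Pr q 0 (conn 0 (Up h)) (inner n h ω)
              (fun η => (cl 0 (Up h ∪ ↑η) (0, 0)).Infinite))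
            (fun _ _ _ => hsub) (fun _ _ _ _ _ => ⟨rfl, trivial⟩) (by
              intro ω' _ _
              refine (Pr_mono hq fun η hη hh => ?_).trans
                (Pr_le_of_dom hq (Dom.of_le le_sup_left) ?_)
              · exact hinc (ω' \ inner n h ω ∪ η) _ _ Finset.subset_union_right
                  (Finset.Subset.refl _) hh
              · intro a b hab hb hh
                exact hinc (ω' \ inner n h ω ∪ b) _ _ (Finset.union_subset_union_right hab)
                  (Finset.Subset.refl _) hh)
          rw [Pr_true hq, mul_one] at hx
          simpa using hx
  exact hmain.trans (mul_le_of_le_one_right hX0 (Pr_le_one hq _))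

end Columns

section DualTouch
open scoped Classical
variable {q : ℝ}

lemma Wp_not_Col (hq : 1 ≤ q) (n h : ℕ) :
    Wp q 0 (box n h) (fun ω => ¬ Col n h ω) ≤ 2 * (1 - fe q h) ^ n := by
  have key : ∀ f : ℕ → ℤ, Function.Injective f → (∀ i < n, -(n : ℤ) ≤ f i ∧ f i < n) →
      Wp q 0 (box n h) (fun ω => ∀ i < n, ω ∩ (Finset.Ico 0 (h : ℤ)).image (Prod.mk (f i)) ≠ ∅) ≤
        (1 - fe q h) ^ n := by
    intro f hf hb
    refine Pr_blocks hq _ h (fun i => ?_) n (fun i hi c hc => ?_) fun i _ j hj => ?_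
    · exact Finset.card_image_le.trans (by simp)
    · rw [Finset.mem_image] at hc
      obtain ⟨y, hy, rfl⟩ := hc
      rw [Finset.mem_Ico] at hy
      exact mem_box.2 ⟨hb i hi, hy⟩
    · rw [Finset.disjoint_left]
      intro c hc hc'
      rw [Finset.mem_image] at hc hc'
      obtain ⟨y, hy, rfl⟩ := hc
      obtain ⟨y', hy', he⟩ := hc'
      have := hf (congrArg Prod.fst he)
      omega
  have h1 := key (fun i => -1 - (i : ℤ)) (fun i j hij => by dsimp only at hij; omega)
    (fun i hi => by omega)
  have h2 := key (fun i => (i : ℤ)) (fun i j hij => by dsimp only at hij; omega)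
    (fun i hi => by omega)
  have h3 : Wp q 0 (box n h) (fun ω => ¬ Col n h ω) ≤ _ :=
    (Pr_le_of_or hq fun ω hω hcol => ?_).trans (add_le_add h1 h2)
  · linarith
  have hne : ∀ i : ℤ, ¬ colC h ω i →
      ω ∩ (Finset.Ico 0 (h : ℤ)).image (Prod.mk i) ≠ ∅ := by
    intro i hi he
    unfold colC at hi
    push Not at hi
    obtain ⟨y, hy0, hyh, hy⟩ := hi
    have : (i, y) ∈ ω ∩ (Finset.Ico 0 (h : ℤ)).image (Prod.mk i) :=
      Finset.mem_inter.2 ⟨hy, Finset.mem_image_of_mem _ (Finset.mem_Ico.2 ⟨hy0, hyh⟩)⟩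
    simp [he] at this
  unfold Col at hcol
  rw [not_and_or] at hcol
  push Not at hcol
  refine hcol.imp (fun hc i hi => hne _ (hc _ ⟨?_, ?_⟩)) (fun hc i hi => hne _ (hc _ ⟨?_, ?_⟩)) <;>
    omega

/-- Vertical reflection of the strip of height `h`. -/
def vreflSym (h : ℤ) (hh : h % 2 = 1) : Sym 0 1 where
  σ := (Equiv.refl ℤ).prodCongr (Equiv.subLeft h)
  γ := (Equiv.refl ℤ).prodCongr (Equiv.subLeft (h - 1))
  compat c := by
    by_cases hp : (c.1 + c.2 + 0) % 2 = 0
    · have hp' : (c.1 + (h - 1 - c.2) + 1) % 2 ≠ 0 := by omega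
      right
      simp only [lo, hi, Equiv.prodCongr_apply, Prod.map, Equiv.subLeft_apply,
        Equiv.refl_apply, hp, hp', if_true, if_false]
      exact ⟨by ext <;> dsimp only <;> omega, by ext <;> dsimp only <;> omega⟩
    · have hp' : (c.1 + (h - 1 - c.2) + 1) % 2 = 0 := by omega
      right
      simp only [lo, hi, Equiv.prodCongr_apply, Prod.map, Equiv.subLeft_apply,
        Equiv.refl_apply, hp, hp', if_true, if_false]
      exact ⟨by ext <;> dsimp only <;> omega, by ext <;> dsimp only <;> omega⟩

lemma exists_vrefl (h : ℤ) (hh : h % 2 = 1) : ∃ S : Sym 0 1,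
    (∀ v, S.σ v = (v.1, h - v.2)) ∧ ∀ v, S.γ v = (v.1, h - 1 - v.2) :=
  ⟨vreflSym h hh, fun _ => rfl, fun _ => rfl⟩

lemma Pr_upper_dual (hq : 1 ≤ q) (n h : ℕ) (A : Finset V → Prop) :
    Pr q 0 (conn 0 (Up h)) (box n h) A =
      Pr q 1 (conn 1 ((Up h)ᶜ \ ↑(box n h))) (box n h) fun ω => A (box n h \ ω) := by
  refine Pr_dual hq (p := 0) (fun ω hω e he heω => ?_) A
  have heb := mem_box.1 he
  have hd := connI_iff_not_dual 0 (Up h ∪ ↑ω) e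
  have h1 : (Up h ∪ (ω : Set V)) \ {e} = Up h ∪ ↑ω := by
    refine Set.sdiff_singleton_eq_self ?_
    rintro (h' | h')
    · have : (h : ℤ) ≤ e.2 := h'
      omega
    · exact heω h'
  have h2 : (Up h ∪ (ω : Set V))ᶜ \ {e} =
      (Up h)ᶜ \ ↑(box n h) ∪ ↑(box n h \ insert e ω) := by
    ext c
    have hcb : c ∈ box n h → c ∉ Up h := fun hc hc' => by
      have h1 := (mem_box.1 hc).2.2
      have h2 : (h : ℤ) ≤ c.2 := hc'
      omega
    have hcω : c ∈ ω → c ∈ box n h := fun h => hω h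
    have hce : c = e → c ∈ box n h := fun h => h ▸ he
    simp only [Set.mem_sdiff, Set.mem_compl_iff, Set.mem_union, Set.mem_singleton_iff,
      Finset.mem_coe, Finset.mem_sdiff, Finset.mem_insert, not_or]
    by_cases c1 : c ∈ box n h
    · simp [hcb c1, c1, and_comm]
    · simp [c1, mt hcω c1, mt hce c1]
  rw [h1, h2] at hd
  rw [conn_union (0 + 1)] at hd
  rw [← conn_union]
  refine Iff.trans ?_ hd
  rw [connI_def]
  refine ⟨Or.inl, fun hh => hh.elim id fun hh => ?_⟩
  obtain ⟨v, hv, hvp, hv'⟩ := reaches_top le_rfl hh.1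
  obtain ⟨w, hw, hwp, hw'⟩ := reaches_top le_rfl hh.2
  exact conn_trans hv' (conn_trans (conn_upper (h := (h : ℤ)) Set.subset_union_left hv hw hvp hwp)
    (conn_symm hw'))

lemma bottom_of_infinite {p : ℤ} {a : Finset V} (ha : (a : Set V) ⊆ Hc) {u : V} (hu : 0 ≤ u.2)
    (h : (cl p ({c | c.2 < 0} ∪ ↑a) u).Infinite) : ∃ x : ℤ, conn p ↑a u (x, 0) := by
  by_contra! hcon
  refine h ((cl_finite_of_finite (p := p) a u).subset fun v hv => ?_)
  have hpos : ∀ v, conn p ↑a u v → 0 < v.2 := by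
    intro v hv
    have h1 := conn_snd_nonneg ha hu hv
    have h2 : v.2 ≠ 0 := by
      intro h0
      exact hcon v.1 (by rw [← h0]; exact hv)
    omega
  have hinv := conn_inv (fun v : V => conn p (↑a : Set V) u v) (fun c hc => by
    rcases hc with hc | hc
    · have hc' : c.2 < 0 := hc
      have h1 := lo_snd p c
      have h2 := hi_snd p c
      refine propext ⟨fun h => ?_, fun h => ?_⟩
      · have := hpos _ h
        omega
      · have := hpos _ h
        omega
    · exact propext ⟨fun h => conn_trans h (conn_step hc),
        fun h => conn_trans h (conn_symm (conn_step hc))⟩) hv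
  have : conn p (↑a : Set V) u v := by
    have h0 : conn p (↑a : Set V) u u := (conn p ↑a).refl u
    exact hinv ▸ h0
  exact this

lemma Pr_upper_le (hq : 1 ≤ q) {n h : ℕ} (hh : h % 2 = 1) :
    Pr q 0 (conn 0 (Up h)) (box n h) (fun ω => (cl 0 (Up h ∪ ↑ω) (0, 0)).Infinite) ≤
      Wp q 0 (box n h) (fun ω => ∃ x : ℤ, conn 1 ↑(box n h \ ω) (0, h) (x, 0)) := by
  obtain ⟨S, hσ, hγ⟩ := exists_vrefl h (by omega)
  have hmem : ∀ (A : Set V) (c : V), c ∈ S.γ '' A ↔ (c.1, (h : ℤ) - 1 - c.2) ∈ A := by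
    intro A c
    constructor
    · rintro ⟨d, hd, rfl⟩
      rw [hγ]
      simpa using hd
    · intro hc
      exact ⟨_, hc, by rw [hγ]; simp⟩
  have hbox : (box n h).map S.γ.toEmbedding = box n h := by
    rw [← Finset.coe_inj, Finset.coe_map]
    ext c
    refine (hmem _ _).trans ?_
    rw [Finset.mem_coe, Finset.mem_coe, mem_box, mem_box]
    dsimp only
    omega
  have himg : S.γ '' (Hc \ ↑(box n h)) = (Up h)ᶜ \ ↑(box n h) := by
    rw [Set.image_sdiff S.γ.injective, ← Equiv.coe_toEmbedding, ← Finset.coe_map, hbox]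
    congr 1
    ext c
    rw [Equiv.coe_toEmbedding, hmem]
    simp only [Hc, Up, Set.mem_ofPred_eq, Set.mem_compl_iff]
    omega
  have h1 := S.Pr_map (q := q) (Hc \ ↑(box n h)) (box n h)
    (fun ω => (cl 0 (Up h ∪ ↑(box n h \ ω)) (0, 0)).Infinite)
  rw [himg, hbox] at h1
  rw [Pr_upper_dual hq, h1]
  refine Pr_mono hq fun ω hω hinf => ?_
  rw [← S.infinite_iff, hσ] at hinf
  refine bottom_of_infinite (fun c hc => ?_) (by simp) (u := (0, (h : ℤ))) ?_
  · exact box_Hc n h (Finset.mem_sdiff.1 hc).1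
  · convert hinf using 2
    · ext c
      rw [hmem]
      have e1 : (c.1, (h : ℤ) - 1 - c.2) ∈ box n h ↔ c ∈ box n h := by
        rw [mem_box, mem_box]; dsimp only; omega
      have e2 : (c.1, (h : ℤ) - 1 - c.2) ∈ ω.map S.γ.toEmbedding ↔ c ∈ ω := by
        rw [← Finset.mem_coe, Finset.coe_map]
        refine (hmem _ _).trans ?_
        simp
      simp only [Set.mem_union, Set.mem_ofPred_eq, Up, Finset.mem_coe, Finset.mem_sdiff, e1, e2]
      exact or_congr (by omega) Iff.rfl
    · simp

lemma exists_dual_touch (hq : 1 ≤ q) (h0 : 0 < cinf q 0) {h : ℕ} (hh : h % 2 = 1) : ∃ n : ℕ,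
    cinf q 0 / 4 ≤ Wp q 0 (box n h)
      (fun ω => ∃ x : ℤ, x < 0 ∧ conn 1 ↑(box n h \ ω) (0, h) (x, 0)) ∧
    cinf q 0 / 4 ≤ Wp q 0 (box n h)
      (fun ω => ∃ x : ℤ, 0 < x ∧ conn 1 ↑(box n h \ ω) (0, h) (x, 0)) := by
  have hlim : Tendsto (fun n : ℕ => 2 * (1 - fe q h) ^ n) atTop (nhds (2 * 0)) :=
    (tendsto_pow_atTop_nhds_zero_of_lt_one (by linarith [fe_le_one hq h])
      (by linarith [fe_pos hq h])).const_mul 2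
  rw [mul_zero] at hlim
  obtain ⟨n, hn⟩ := (hlim.eventually (gt_mem_nhds (half_pos h0))).exists
  refine ⟨n, ?_⟩
  have h1 : cinf q 0 ≤ Wp q 0 (box n h) (esc 0 (box n h) (0, 0)) := by
    refine (cinf_le hq 0 ⟨box n h, box_Hc n h⟩).trans (Pr_mono hq ?_)
    rintro ω _ ⟨x, hx, hesc⟩
    rwa [abs_nonpos_iff.1 hx] at hesc
  have h2 : Wp q 0 (box n h) (esc 0 (box n h) (0, 0)) ≤
      Wp q 0 (box n h) (fun ω => Col n h ω ∧ esc 0 (box n h) (0, 0) ω) +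
        Wp q 0 (box n h) (fun ω => ¬ Col n h ω) :=
    Pr_le_of_or hq fun ω _ he => by tauto
  have h3 := (Wp_col hq (n := n) (h := h) (by omega)).trans (Pr_upper_le hq hh)
  have h4 := Wp_not_Col hq n h
  have h5 : Wp q 0 (box n h) (fun ω => ∃ x : ℤ, conn 1 ↑(box n h \ ω) (0, h) (x, 0)) ≤
      Wp q 0 (box n h) (fun ω => ∃ x : ℤ, x < 0 ∧ conn 1 ↑(box n h \ ω) (0, h) (x, 0)) +
      Wp q 0 (box n h) (fun ω => ∃ x : ℤ, 0 < x ∧ conn 1 ↑(box n h \ ω) (0, h) (x, 0)) := by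
    refine Pr_le_of_or hq ?_
    rintro ω _ ⟨x, hx⟩
    have hp := (conn_parity hx (by intro he; have := congrArg Prod.snd he; dsimp only at this; omega)).2
    dsimp only at hp
    rcases lt_trichotomy x 0 with h' | h' | h'
    · exact Or.inl ⟨x, h', hx⟩
    · omega
    · exact Or.inr ⟨x, h', hx⟩
  have h6 : Wp q 0 (box n h) (fun ω => ∃ x : ℤ, x < 0 ∧ conn 1 ↑(box n h \ ω) (0, h) (x, 0)) =
      Wp q 0 (box n h) (fun ω => ∃ x : ℤ, 0 < x ∧ conn 1 ↑(box n h \ ω) (0, h) (x, 0)) := by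
    obtain ⟨S, hS, hσ, hγ⟩ := exists_refl 0
    obtain ⟨S', -, hσ', hγ'⟩ := exists_refl 1
    have hmem : ∀ (A : Set V) (c : V), c ∈ S'.γ '' A ↔ (-1 - c.1, c.2) ∈ A := by
      intro A c
      constructor
      · rintro ⟨d, hd, rfl⟩
        rw [hγ']
        simpa using hd
      · intro hc
        exact ⟨_, hc, by rw [hγ']; simp⟩
    have hSS : S.γ = S'.γ := Equiv.ext fun v => by rw [hγ, hγ']
    have hbox : (box n h).map S.γ.toEmbedding = box n h := by
      rw [← Finset.coe_inj, Finset.coe_map, hSS]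
      ext c
      refine (hmem _ _).trans ?_
      rw [Finset.mem_coe, Finset.mem_coe, mem_box, mem_box]
      dsimp only
      omega
    have h7 := S.Wp_map hS (q := q) (box n h)
      (fun ω => ∃ x : ℤ, x < 0 ∧ conn 1 ↑(box n h \ ω) (0, h) (x, 0))
    rw [hbox] at h7
    rw [h7]
    refine Pr_congr fun ω _ => ?_
    have hc : ∀ x : ℤ, conn 1 ↑(box n h \ ω.map S.γ.toEmbedding) (0, (h : ℤ)) (x, 0) ↔
        conn 1 ↑(box n h \ ω) (0, (h : ℤ)) (-x, 0) := by
      intro x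
      rw [← S'.conn_iff, hσ', hσ', Finset.coe_sdiff, Finset.coe_sdiff, Set.image_sdiff S'.γ.injective,
        ← hSS, ← Equiv.coe_toEmbedding, ← Finset.coe_map, ← Finset.coe_map, hbox]
      have e : (ω.map S.γ.toEmbedding).map S.γ.toEmbedding = ω := by
        rw [← Finset.coe_inj, Finset.coe_map, Finset.coe_map, hSS]
        ext c
        refine (hmem _ _).trans ((hmem _ _).trans ?_)
        simp
      rw [e, neg_zero]
    simp only [hc]
    constructor
    · rintro ⟨x, hx, h⟩
      exact ⟨-x, by omega, h⟩
    · rintro ⟨x, hx, h⟩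
      exact ⟨-x, by omega, by rwa [neg_neg]⟩
  constructor <;> linarith

end DualTouch

section Enclosing
open scoped Classical
variable {q : ℝ}

/-- The closed cells of `D` below height `h`. -/
def below (D : Finset V) (h : ℤ) (ω : Finset V) : Set V := {c | c ∈ D ∧ c.2 < h ∧ c ∉ ω}

lemma touch_shift (hq : 1 ≤ q) {t : ℤ} (ht : t % 2 = 0) {h n : ℕ} {P : ℤ → Prop} {ε : ℝ}
    (hε : ε ≤ Wp q 0 (box n h)
      (fun ω => ∃ x : ℤ, P x ∧ conn 1 ↑(box n h \ ω) (0, h) (x, 0)))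
    {D : Finset V} (hD : (D : Set V) ⊆ Hc) (hsub : ∀ c ∈ box n h, (c.1 + t, c.2) ∈ D) :
    ε ≤ Wp q 0 D (fun ω => ∃ x : ℤ, P (x - t) ∧ conn 1 (below D h ω) (t, h) (x, 0)) := by
  obtain ⟨S, hS, hσ, hγ⟩ := exists_shift 0 0 t (by omega)
  obtain ⟨S', -, hσ', hγ'⟩ := exists_shift 1 1 t (by omega)
  have hSS : S.γ = S'.γ := Equiv.ext fun v => by rw [hγ, hγ']
  set B := (box n h).map S.γ.toEmbedding with hB
  have hBD : B ⊆ D := by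
    intro c hc
    obtain ⟨d, hd, rfl⟩ := Finset.mem_map.1 hc
    rw [Equiv.coe_toEmbedding, hγ]
    exact hsub d hd
  have hBh : ∀ c ∈ B, c.2 < h := by
    intro c hc
    obtain ⟨d, hd, rfl⟩ := Finset.mem_map.1 hc
    rw [Equiv.coe_toEmbedding, hγ]
    exact (mem_box.1 hd).2.2
  have h1 := S.Wp_map hS (q := q) (box n h)
    (fun ω => ∃ x : ℤ, P (x - t) ∧ conn 1 ↑(B \ ω) (t, h) (x, 0))
  have h2 : Wp q 0 (box n h) (fun ω => ∃ x : ℤ, P x ∧ conn 1 ↑(box n h \ ω) (0, h) (x, 0)) =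
      Wp q 0 (box n h) fun ω => ∃ x : ℤ, P (x - t) ∧
        conn 1 ↑(B \ ω.map S.γ.toEmbedding) (t, (h : ℤ)) (x, 0) := by
    refine Pr_congr fun ω _ => ?_
    have hc : ∀ x : ℤ, conn 1 ↑(B \ ω.map S.γ.toEmbedding) (t, (h : ℤ)) (x + t, 0) ↔
        conn 1 ↑(box n h \ ω) (0, (h : ℤ)) (x, 0) := by
      intro x
      have hh := S'.conn_iff ↑(box n h \ ω) (0, (h : ℤ)) (x, 0)
      rw [hσ', hσ', Finset.coe_sdiff, Set.image_sdiff S'.γ.injective, ← hSS,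
        ← Equiv.coe_toEmbedding, ← Finset.coe_map, ← Finset.coe_map, ← hB, ← Finset.coe_sdiff,
        ← Finset.coe_sdiff] at hh
      simpa using hh
    constructor
    · rintro ⟨x, hx, hh⟩
      exact ⟨x + t, by simpa using hx, (hc x).2 hh⟩
    · rintro ⟨x, hx, hh⟩
      refine ⟨x - t, hx, (hc (x - t)).1 ?_⟩
      rwa [sub_add_cancel]
  rw [← hB, ← h2] at h1
  have h3 : Wp q 0 D (fun ω => ¬ ∃ x : ℤ, P (x - t) ∧ conn 1 (below D h ω) (t, h) (x, 0)) ≤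
      Wp q 0 B (fun ω => ¬ ∃ x : ℤ, P (x - t) ∧ conn 1 ↑(B \ ω) (t, h) (x, 0)) := by
    refine Wp_antitone hq hD hBD ?_ ?_
    · rintro a b hab _ hn ⟨x, hx, hh⟩
      exact hn ⟨x, hx, conn_mono (Finset.coe_subset.2 (Finset.sdiff_subset_sdiff le_rfl hab)) hh⟩
    · rintro ω _ hn ⟨x, hx, hh⟩
      refine hn ⟨x, hx, conn_mono ?_ hh⟩
      intro c hc
      obtain ⟨hc1, hc2⟩ := Finset.mem_sdiff.1 (Finset.mem_coe.1 hc)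
      exact ⟨hBD hc1, hBh c hc1, fun hcω => hc2 (Finset.mem_inter.2 ⟨hcω, hc1⟩)⟩
  unfold Wp at h1 h3 hε ⊢
  rw [Pr_not hq, Pr_not hq] at h3
  linarith

/-- The two points `(∓K, h)` are connected in the dual to the bottom line, outside `[-K, K]`. -/
def Arms (K : ℤ) (D : Finset V) (h : ℤ) (ω : Finset V) : Prop :=
  (∃ x : ℤ, x < -K ∧ conn 1 (below D h ω) (-K, h) (x, 0)) ∧
    ∃ x : ℤ, K < x ∧ conn 1 (below D h ω) (K, h) (x, 0)

/-- The row of cells joining `(-K, h)` to `(K, h)`. -/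
def bridge (K h : ℤ) : Finset V := (Finset.Ico (-K) K).image fun x => (x, h)

lemma mem_bridge {K h : ℤ} {c : V} : c ∈ bridge K h ↔ (-K ≤ c.1 ∧ c.1 < K) ∧ c.2 = h := by
  unfold bridge
  rw [Finset.mem_image]
  constructor
  · rintro ⟨x, hx, rfl⟩
    exact ⟨Finset.mem_Ico.1 hx, rfl⟩
  · rintro ⟨h1, rfl⟩
    exact ⟨c.1, Finset.mem_Ico.2 h1, rfl⟩

lemma Arms_congr {K : ℤ} {D : Finset V} {h : ℤ} {ω ω' : Finset V}
    (hω : ∀ c ∈ D, c.2 < h → (c ∈ ω ↔ c ∈ ω')) : Arms K D h ω ↔ Arms K D h ω' := by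
  have : below D h ω = below D h ω' := by
    ext c
    unfold below
    constructor
    · rintro ⟨h1, h2, h3⟩
      exact ⟨h1, h2, fun hh => h3 ((hω c h1 h2).2 hh)⟩
    · rintro ⟨h1, h2, h3⟩
      exact ⟨h1, h2, fun hh => h3 ((hω c h1 h2).1 hh)⟩
  unfold Arms
  rw [this]

lemma Arms_ge (hq : 1 ≤ q) (h0 : 0 < cinf q 0) {K : ℤ} (hK : K % 2 = 0) {h : ℕ}
    (hh : h % 2 = 1) : ∃ n : ℕ, ∀ D : Finset V, (D : Set V) ⊆ Hc →
      (∀ c : V, |c.1| ≤ n → 0 ≤ c.2 → c.2 < h → c ∈ D) →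
      (cinf q 0 / 4) ^ 2 ≤ Wp q 0 D (Arms K D h) := by
  obtain ⟨n, hn1, hn2⟩ := exists_dual_touch hq h0 hh
  refine ⟨n + K.natAbs, fun D hD hsub => ?_⟩
  have h1 := touch_shift hq (t := -K) (by omega) hn1 hD fun c hc => by
    have := mem_box.1 hc
    refine hsub _ (abs_le.2 ?_) ?_ ?_ <;> dsimp only <;> omega
  have h2 := touch_shift hq (t := K) (by omega) hn2 hD fun c hc => by
    have := mem_box.1 hc
    refine hsub _ (abs_le.2 ?_) ?_ ?_ <;> dsimp only <;> omega
  have hdecr : ∀ (t : ℤ) (P : ℤ → Prop), Incr D fun ω => ¬ ∃ x : ℤ, P (x - t) ∧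
      conn 1 (below D h ω) (t, (h : ℤ)) (x, 0) := by
    rintro t P a b hab _ hn ⟨x, hx, hc⟩
    exact hn ⟨x, hx, conn_mono (fun c (hc : c ∈ below D h b) =>
      (⟨hc.1, hc.2.1, fun hca => hc.2.2 (hab hca)⟩ : c ∈ below D h a)) hc⟩
  have h3 := Pr_fkg_decr (p := 0) (s := conn 0 (Hc \ ↑D)) hq
    (hdecr (-K) fun x => x < 0) (hdecr K fun x => 0 < x)
  rw [pow_two]
  refine (mul_le_mul h1 h2 (by positivity) (Wp_nonneg hq _ _ _)).trans (h3.trans ?_)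
  refine Pr_mono hq ?_
  rintro ω _ ⟨⟨x, hx, hc⟩, y, hy, hc'⟩
  exact ⟨⟨x, by omega, hc⟩, y, by omega, hc'⟩

lemma not_esc_of_arms {k K h : ℤ} (hkK : k ≤ K) (hK0 : 0 ≤ K)
    (hpar : (K + h) % 2 = 1) {D ω : Finset V} (hD : (D : Set V) ⊆ Hc)
    (hω : ω ⊆ D) (hbr : bridge K h ⊆ D) (hA : Arms K D h ω) (hb : ω ∩ bridge K h = ∅) {x : ℤ}
    (hx : |x| ≤ k) : ¬ esc 0 D (x, 0) ω := by
  obtain ⟨⟨x1, hx1, hc1⟩, x2, hx2, hc2⟩ := hA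
  have hx' := abs_le.1 hx
  set B : Set V := {c | c ∈ D ∧ c ∉ ω} with hB
  have hbB : below D h ω ⊆ B := fun c hc => ⟨hc.1, hc.2.2⟩
  have hrow : conn 1 B (-K, h) (K, h) := by
    refine conn_row_vertices (by omega) (fun i h1 h2 => ?_) (by omega) (by omega)
    have hi : (i, h) ∈ bridge K h := mem_bridge.2 ⟨⟨h1, h2⟩, rfl⟩
    refine ⟨hbr hi, fun hiω => ?_⟩
    have : (i, h) ∈ ω ∩ bridge K h := Finset.mem_inter.2 ⟨hiω, hi⟩
    simp [hb] at this
  have hconn : conn 1 B (x1, 0) (x2, 0) :=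
    conn_trans (conn_symm (conn_mono hbB hc1)) (conn_trans hrow (conn_mono hbB hc2))
  have hfin := enclosure (fun c hc => hD hc.1) hconn (x := x) (by omega) (by omega)
  have hper := cl_period 0
  rw [zero_add] at hper
  rw [hper] at hfin
  refine fun hesc => hesc (hfin.subset (cl_mono ?_ _))
  rintro c (hc | hc) (hcB | hcB)
  · exact hc.2 hcB.1
  · have h1 : (0 : ℤ) ≤ c.2 := hc.1
    have h2 := hcB.1
    omega
  · exact hcB.2 hc
  · have h1 : (0 : ℤ) ≤ c.2 := hD (hω hc)
    have h2 := hcB.1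
    omega

lemma arms_iterate (hq : 1 ≤ q) {K : ℤ} {b : ℝ} {D : Finset V} {m : ℕ}
    (hb : ∀ i < m, b ≤ Wp q 0 D (Arms K D (2 * (i : ℤ) + 1)))
    (hD : ∀ i < m, bridge K (2 * (i : ℤ) + 1) ⊆ D) :
    b - Wp q 0 D (fun ω => ∃ i < m, Arms K D (2 * (i : ℤ) + 1) ω ∧
      ω ∩ bridge K (2 * (i : ℤ) + 1) = ∅) ≤ (1 - fe q (2 * K).toNat) ^ m * b := by
  induction m with
  | zero =>
    rw [pow_zero, one_mul, sub_le_self_iff]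
    exact Wp_nonneg hq _ _ _
  | succ m ih =>
    have ih' := ih (fun i hi => hb i (by omega)) (fun i hi => hD i (by omega))
    set G : Finset V → Prop := fun ω => ∃ i < m, Arms K D (2 * (i : ℤ) + 1) ω ∧
      ω ∩ bridge K (2 * (i : ℤ) + 1) = ∅ with hG
    set T : Finset V → Prop := Arms K D (2 * (m : ℤ) + 1) with hT
    set δ := fe q (2 * K).toNat with hδ
    have hδ0 : 0 < δ := fe_pos hq _
    have hδ1 : δ ≤ 1 := fe_le_one hq _
    have hcard : (bridge K (2 * (m : ℤ) + 1)).card ≤ (2 * K).toNat := by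
      refine Finset.card_image_le.trans ?_
      rw [Int.card_Ico]
      exact (congrArg Int.toNat (by ring : K - -K = 2 * K)).le
    have hfe : δ * Wp q 0 D (fun ω => T ω ∧ ¬ G ω) ≤
        Wp q 0 D (fun ω => (T ω ∧ ¬ G ω) ∧ ω ∩ bridge K (2 * (m : ℤ) + 1) = ∅) := by
      refine (mul_le_mul_of_nonneg_right (fe_antitone hq hcard) (Wp_nonneg hq _ _ _)).trans
        (Pr_finite_energy hq (hD m (by omega)) (Finset.empty_subset _) fun ω _ => ?_)
      have hmem : ∀ c : V, c.2 < 2 * (m : ℤ) + 1 →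
          (c ∈ ω ↔ c ∈ ω \ bridge K (2 * (m : ℤ) + 1)) := by
        intro c hc
        rw [Finset.mem_sdiff, mem_bridge]
        constructor
        · exact fun h => ⟨h, by omega⟩
        · exact fun h => h.1
      refine and_congr (Arms_congr fun c _ hc => hmem c hc) (not_congr ?_)
      refine exists_congr fun i => and_congr_right fun hi => and_congr
        (Arms_congr fun c _ hc => hmem c (by omega)) ?_
      have : ω ∩ bridge K (2 * (i : ℤ) + 1) =
          (ω \ bridge K (2 * (m : ℤ) + 1)) ∩ bridge K (2 * (i : ℤ) + 1) := by
        ext c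
        rw [Finset.mem_inter, Finset.mem_inter]
        refine and_congr_left fun hc => hmem c ?_
        have := (mem_bridge.1 hc).2
        omega
      rw [this]
    have hsplit := Pr_split q 0 (conn 0 (Hc \ ↑D)) D G T
    have hTG : Pr q 0 (conn 0 (Hc \ ↑D)) D (fun ω => T ω ∧ G ω) ≤ Wp q 0 D G :=
      Pr_mono hq fun ω _ h => h.2
    have hbT : b ≤ Wp q 0 D T := hb m (by omega)
    set G' : Finset V → Prop := fun ω => ∃ i < m + 1, Arms K D (2 * (i : ℤ) + 1) ω ∧
      ω ∩ bridge K (2 * (i : ℤ) + 1) = ∅ with hG'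
    have hsplit' := Pr_split q 0 (conn 0 (Hc \ ↑D)) D G G'
    have e1 : Pr q 0 (conn 0 (Hc \ ↑D)) D (fun ω => G' ω ∧ G ω) = Wp q 0 D G := by
      refine Pr_congr fun ω _ => ⟨fun h => h.2, fun h => ⟨?_, h⟩⟩
      obtain ⟨i, hi, hh⟩ := h
      exact ⟨i, by omega, hh⟩
    have e2 : Wp q 0 D (fun ω => (T ω ∧ ¬ G ω) ∧ ω ∩ bridge K (2 * (m : ℤ) + 1) = ∅) ≤
        Pr q 0 (conn 0 (Hc \ ↑D)) D (fun ω => G' ω ∧ ¬ G ω) :=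
      Pr_mono hq fun ω _ h => ⟨⟨m, by omega, h.1.1, h.2⟩, h.1.2⟩
    have e3 : b - Wp q 0 D G ≤ Wp q 0 D (fun ω => T ω ∧ ¬ G ω) := by
      unfold Wp at *
      linarith
    have e4 : Wp q 0 D G + δ * Wp q 0 D (fun ω => T ω ∧ ¬ G ω) ≤ Wp q 0 D G' := by
      unfold Wp at *
      linarith
    have e5 := mul_le_mul_of_nonneg_left e3 hδ0.le
    have e6 := mul_le_mul_of_nonneg_left ih' (by linarith : 0 ≤ 1 - δ)
    rw [pow_succ]
    nlinarith

/-- Under the most wired boundary conditions in the half-plane, bottom points escape with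
arbitrarily small probability. -/
theorem cinf_eq_zero (hq : 1 ≤ q) : cinf q 0 = 0 := by
  by_contra hne
  have h0 : 0 < cinf q 0 := lt_of_le_of_ne (cinf_nonneg hq 0) (Ne.symm hne)
  set b := (cinf q 0 / 4) ^ 2 with hb
  have hb0 : 0 < b := by positivity
  obtain ⟨k₀, hk₀⟩ := exists_cinf_gt hq h0 (half_pos hb0)
  set k := max k₀ 0 with hk
  have hk1 : 1 - b / 2 < cinf q k := hk₀.trans_le (cinf_mono hq (le_max_left _ _))
  have hk0 : 0 ≤ k := le_max_right _ _
  set K := 2 * k with hK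
  have hlim : Tendsto (fun m : ℕ => (1 - fe q (2 * K).toNat) ^ m * b) atTop (nhds (0 * b)) :=
    (tendsto_pow_atTop_nhds_zero_of_lt_one (by linarith [fe_le_one hq (2 * K).toNat])
      (by linarith [fe_pos hq (2 * K).toNat])).mul_const b
  rw [zero_mul] at hlim
  obtain ⟨m, hm⟩ := (hlim.eventually (gt_mem_nhds (half_pos hb0))).exists
  choose n hn using fun i : ℕ =>
    Arms_ge hq h0 (K := K) (by omega) (h := 2 * i + 1) (by omega)
  obtain ⟨N, hN⟩ : ∃ N : ℕ, ∀ i < m, n i ≤ N :=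
    ⟨(Finset.range m).sup n, fun i hi => Finset.le_sup (Finset.mem_range.2 hi)⟩
  set D := box (N + K.toNat + 1) (2 * m + 2) with hD
  have hDH : (D : Set V) ⊆ Hc := box_Hc _ _
  have hbr : ∀ i < m, bridge K (2 * (i : ℤ) + 1) ⊆ D := by
    intro i hi c hc
    have := mem_bridge.1 hc
    rw [hD, mem_box]
    push_cast
    omega
  have h1 := arms_iterate hq (K := K) (b := b) (D := D) (m := m) (fun i hi => ?_) hbr
  · have h2 := cinf_le hq k ⟨D, hDH⟩
    have h3 : Wp q 0 D (fun ω => ∃ x : ℤ, |x| ≤ k ∧ esc 0 D (x, 0) ω) ≤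
        Wp q 0 D (fun ω => ¬ ∃ i < m, Arms K D (2 * (i : ℤ) + 1) ω ∧
          ω ∩ bridge K (2 * (i : ℤ) + 1) = ∅) := by
      refine Pr_mono hq ?_
      rintro ω hω ⟨x, hx, hesc⟩ ⟨i, hi, hA, hAb⟩
      exact not_esc_of_arms (by omega) (by omega) (by omega) hDH hω (hbr i hi) hA hAb
        hx hesc
    have h4 := Pr_not (s := conn 0 (Hc \ ↑D)) (p := 0) (D := D) hq
      (fun ω => ∃ i < m, Arms K D (2 * (i : ℤ) + 1) ω ∧ ω ∩ bridge K (2 * (i : ℤ) + 1) = ∅)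
    unfold Wp at *
    dsimp only at h2
    linarith
  · have := hn i D hDH fun c hc hc0 hch => by
      have h5 := hN i hi
      rw [hD, mem_box]
      have := abs_le.1 hc
      push_cast at *
      omega
    push_cast at this
    exact this

end Enclosing

section EscapeSmall
open scoped Classical
variable {q : ℝ}

lemma snd_nonneg_of_infinite {p : ℤ} {A : Set V} (hA : A ⊆ Hc) {u : V} (h : (cl p A u).Infinite) :
    0 ≤ u.2 ∧ (u.1 + u.2 + p) % 2 = 0 := by
  obtain ⟨v, hv, hvu⟩ : ∃ v ∈ cl p A u, v ≠ u := by
    by_contra! hcon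
    exact h ((Set.finite_singleton u).subset fun v hv => hcon v hv)
  refine ⟨?_, (conn_parity hv hvu.symm).1⟩
  rcases verts_of_conn (conn_symm hv) with h' | ⟨c, hc, h'⟩
  · exact absurd h'.symm hvu
  · have hc0 : 0 ≤ c.2 := hA hc
    have h1 := lo_snd p c
    have h2 := hi_snd p c
    rcases h' with rfl | rfl <;> omega

lemma esc_small_mono (hq : 1 ≤ q) {p : ℤ} {u : V} {D D' : Finset V} (hD' : (D' : Set V) ⊆ Hc)
    (h : D ⊆ D') : Wp q p D' (esc p D' u) ≤ Wp q p D (esc p D u) :=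
  Wp_antitone hq hD' h (esc_incr p D u) fun _ hω he => esc_restrict hD' h hω he

lemma exists_path_bottom (p : ℤ) (n : ℕ) : ∀ a : ℤ, (a + n + p) % 2 = 0 →
    ∃ (B : Finset V) (x : ℤ), (B : Set V) ⊆ Hc ∧ (x + p) % 2 = 0 ∧
      conn p ↑B (a, (n : ℤ)) (x, 0) := by
  induction n with
  | zero => exact fun a ha => ⟨∅, a, by simp, by simpa using ha, conn_refl _ _ _⟩
  | succ n ih =>
    intro a ha
    push_cast at ha
    obtain ⟨B, x, hB, hx, hc⟩ := ih (a + 1) (by omega)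
    refine ⟨insert (a, (n : ℤ)) B, x, ?_, hx, conn_trans ?_ (conn_mono ?_ hc)⟩
    · intro c hc
      rcases Finset.mem_insert.1 (Finset.mem_coe.1 hc) with rfl | hc
      · exact Int.natCast_nonneg n
      · exact hB hc
    · refine conn_cell (c := (a, (n : ℤ))) (by simp) ?_
      have hp : (a + n + p) % 2 ≠ 0 := by omega
      simp only [lo, hi, hp, if_false]
      push_cast
      simp
    · intro c hc
      exact Finset.mem_coe.2 (Finset.mem_insert_of_mem hc)

/-- Any vertex escapes to the maximally wired boundary with arbitrarily small probability. -/
theorem exists_esc_le (hq : 1 ≤ q) (p : ℤ) (u : V) {ε : ℝ} (hε : 0 < ε) :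
    ∃ D : Finset V, (D : Set V) ⊆ Hc ∧
      ∀ D' : Finset V, (D' : Set V) ⊆ Hc → D ⊆ D' → Wp q p D' (esc p D' u) ≤ ε := by
  suffices h : ∃ D : Finset V, (D : Set V) ⊆ Hc ∧ Wp q p D (esc p D u) ≤ ε by
    obtain ⟨D, hD, hle⟩ := h
    exact ⟨D, hD, fun D' hD' hs => (esc_small_mono hq hD' hs).trans hle⟩
  by_cases hu : 0 ≤ u.2 ∧ (u.1 + u.2 + p) % 2 = 0
  swap
  · refine ⟨∅, by simp, ?_⟩
    refine le_trans (le_of_eq (b := 0) ?_) hε.le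
    have : Wp q p ∅ (esc p ∅ u) = Wp q p ∅ fun _ => ¬ True := by
      refine Pr_congr fun ω hω => ?_
      simp only [not_true_eq_false, iff_false]
      refine fun he => hu (snd_nonneg_of_infinite (Set.union_subset Set.sdiff_subset ?_) he)
      rw [Finset.subset_empty.1 hω]
      simp
    rw [this]
    unfold Wp
    rw [Pr_not hq, Pr_true hq, sub_self]
  have hbot : ∀ x : ℤ, (x + p) % 2 = 0 → ∀ ε > 0, ∃ D : Finset V, (D : Set V) ⊆ Hc ∧
      Wp q p D (esc p D (x, 0)) ≤ ε := by
    intro x hx ε hε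
    obtain ⟨S, hS, hσ, -⟩ := exists_shift 0 p x (by omega)
    obtain ⟨⟨D, hD⟩, hlt⟩ := exists_lt_of_ciInf_lt (lt_of_eq_of_lt (cinf_eq_zero hq) hε)
    refine ⟨D.map S.γ.toEmbedding, S.map_Hc hS hD, ?_⟩
    rw [S.Wp_map hS]
    refine le_trans (Pr_mono hq fun ω _ he => ?_) hlt.le
    refine ⟨0, by simp, (S.esc_map hS D ω (0, 0)).1 ?_⟩
    rw [hσ]
    simpa using he
  obtain ⟨B, x, hB, hx, hc⟩ := exists_path_bottom p u.2.toNat u.1 (by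
    rw [Int.toNat_of_nonneg hu.1]; exact hu.2)
  rw [Int.toNat_of_nonneg hu.1] at hc
  obtain ⟨D, hD, hle⟩ := hbot x hx (fe q B.card * ε) (mul_pos (fe_pos hq _) hε)
  have hBD : ((D ∪ B : Finset V) : Set V) ⊆ Hc := by
    rw [Finset.coe_union]
    exact Set.union_subset hD hB
  refine ⟨D ∪ B, hBD, ?_⟩
  have h1 := (esc_small_mono hq (u := (x, 0)) (p := p) hBD Finset.subset_union_left).trans hle
  have h2 := Pr_fkg (q := q) (p := p) (s := conn p (Hc \ ↑(D ∪ B))) (D := D ∪ B) hq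
    (A := fun ω => B ⊆ ω) (B := esc p (D ∪ B) u) (fun a b hab _ h => h.trans hab)
    (esc_incr p _ u)
  have h3 : Pr q p (conn p (Hc \ ↑(D ∪ B))) (D ∪ B) (fun ω => B ⊆ ω ∧ esc p (D ∪ B) u ω) ≤
      Wp q p (D ∪ B) (esc p (D ∪ B) (x, 0)) := by
    refine Pr_mono hq fun ω _ hh => ?_
    have hcl := cl_eq (conn_mono (A := (B : Set V)) (B := Hc \ ↑(D ∪ B) ∪ ↑ω)
      (fun c hc => Or.inr (hh.1 hc)) hc)
    have he := hh.2
    unfold esc at he ⊢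
    rwa [hcl] at he
  have h4 := Pr_finite_energy (q := q) (p := p) (s := conn p (Hc \ ↑(D ∪ B))) (D := D ∪ B) hq
    (B := B) (ω₀ := B) Finset.subset_union_right (Finset.Subset.refl _) (E := fun _ => True)
    (fun _ _ => Iff.rfl)
  have h5 : Pr q p (conn p (Hc \ ↑(D ∪ B))) (D ∪ B) (fun ω => True ∧ ω ∩ B = B) ≤
      Pr q p (conn p (Hc \ ↑(D ∪ B))) (D ∪ B) (fun ω => B ⊆ ω) :=
    Pr_mono hq fun ω _ hh => Finset.inter_eq_right.1 hh.2
  rw [Pr_true hq, mul_one] at h4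
  have h6 : 0 ≤ Wp q p (D ∪ B) (esc p (D ∪ B) u) := Wp_nonneg hq _ _ _
  have h7 := mul_le_mul_of_nonneg_right (h4.trans h5) h6
  have h8 : fe q B.card * Wp q p (D ∪ B) (esc p (D ∪ B) u) ≤ fe q B.card * ε :=
    h7.trans (h2.trans (h3.trans h1))
  exact le_of_mul_le_mul_left h8 (fe_pos hq _)

end EscapeSmall

section Avoid
open scoped Classical
variable {q : ℝ}

/-- The equivalence relation obtained from `r` by merging the classes of `z` and of the points
of `P`. -/
def lump (P : Finset V) (z : V) (r : Setoid V) : Setoid V where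
  r u v := r u v ∨ (∃ x ∈ insert z P, r x u) ∧ ∃ x ∈ insert z P, r x v
  iseqv := by
    refine ⟨fun u => Or.inl (r.refl u), ?_, ?_⟩
    · rintro u v (h | ⟨h, h'⟩)
      · exact Or.inl (r.symm h)
      · exact Or.inr ⟨h', h⟩
    · rintro u v w (h | ⟨h, h'⟩) (k | ⟨k, k'⟩)
      · exact Or.inl (r.trans h k)
      · obtain ⟨x, hx, hxv⟩ := k
        exact Or.inr ⟨⟨x, hx, r.trans hxv (r.symm h)⟩, k'⟩
      · obtain ⟨x, hx, hxv⟩ := h'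
        exact Or.inr ⟨h, x, hx, r.trans hxv k⟩
      · exact Or.inr ⟨h, k'⟩

lemma le_lump (P : Finset V) (z : V) (r : Setoid V) : r ≤ lump P z r := fun _ _ h => Or.inl h

lemma lump_mono (P : Finset V) (z : V) {r r' : Setoid V} (h : r ≤ r') :
    lump P z r ≤ lump P z r' := by
  rintro u v (h1 | ⟨⟨x, hx, h1⟩, y, hy, h2⟩)
  · exact Or.inl (h h1)
  · exact Or.inr ⟨⟨x, hx, h h1⟩, y, hy, h h2⟩

lemma kk_le_lump (W P : Finset V) (z : V) (r : Setoid V) :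
    kk W r ≤ kk W (lump P z r) + P.card := by
  set W' := W.filter fun w => ∀ x ∈ P, ¬ r x w with hW'
  have h1 : W.image (Quotient.mk r) ⊆ W'.image (Quotient.mk r) ∪ P.image (Quotient.mk r) := by
    intro c hc
    obtain ⟨w, hw, rfl⟩ := Finset.mem_image.1 hc
    by_cases h : ∀ x ∈ P, ¬ r x w
    · exact Finset.mem_union_left _ (Finset.mem_image_of_mem _ (Finset.mem_filter.2 ⟨hw, h⟩))
    · push Not at h
      obtain ⟨x, hx, hxw⟩ := h
      exact Finset.mem_union_right _ (Finset.mem_image.2 ⟨x, hx, Quotient.sound hxw⟩)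
  have h2 : (W'.image (Quotient.mk r)).card ≤ (W'.image (Quotient.mk (lump P z r))).card := by
    refine Finset.card_le_card_of_injOn (Quotient.map' id (le_lump P z r)) ?_ ?_
    · intro c hc
      obtain ⟨w, hw, rfl⟩ := Finset.mem_image.1 hc
      exact Finset.mem_image_of_mem _ hw
    · intro c hc d hd hcd
      obtain ⟨w, hw, rfl⟩ := Finset.mem_image.1 hc
      obtain ⟨w', hw', rfl⟩ := Finset.mem_image.1 hd
      have h3 : lump P z r w w' := Quotient.exact hcd
      have hw := (Finset.mem_filter.1 hw).2
      have hw' := (Finset.mem_filter.1 hw').2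
      refine Quotient.sound ?_
      rcases h3 with h | ⟨⟨x, hx, h⟩, y, hy, h'⟩
      · exact h
      · rcases Finset.mem_insert.1 hx with rfl | hx
        · rcases Finset.mem_insert.1 hy with rfl | hy
          · exact r.trans (r.symm h) h'
          · exact absurd h' (hw' y hy)
        · exact absurd h (hw x hx)
  calc kk W r ≤ _ := Finset.card_le_card h1
    _ ≤ _ := Finset.card_union_le _ _
    _ ≤ _ := Nat.add_le_add ((h2.trans
      (Finset.card_le_card (Finset.image_subset_image (Finset.filter_subset _ _)))))
        Finset.card_image_le

lemma Pr_lump_le (hq : 1 ≤ q) (p : ℤ) (P : Finset V) (z : V) (r : Setoid V) (D : Finset V)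
    (A : Finset V → Prop) : Pr q p (lump P z r) D A ≤ q ^ P.card * Pr q p r D A := by
  have hq0 : (0:ℝ) ≤ q := by linarith
  have key : ∀ ω : Finset V, wt q p (lump P z r) D ω ≤ wt q p r D ω ∧
      wt q p r D ω ≤ q ^ P.card * wt q p (lump P z r) D ω := by
    intro ω
    unfold wt
    constructor
    · refine mul_le_mul_of_nonneg_left (pow_le_pow_right₀ hq ?_) (by positivity)
      exact kk_antitone _ (sup_le_sup_right (le_lump P z r) _)
    · have h1 : lump P z r ⊔ conn p ↑ω ≤ lump P z (r ⊔ conn p ↑ω) :=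
        sup_le (lump_mono P z le_sup_left) (le_sup_right.trans (le_lump P z _))
      have h2 := (kk_le_lump (verts p D) P z (r ⊔ conn p ↑ω)).trans
        (Nat.add_le_add_right (kk_antitone (verts p D) h1) _)
      calc _ ≤ √q ^ ω.card * q ^ (kk (verts p D) (lump P z r ⊔ conn p ↑ω) + P.card) :=
            mul_le_mul_of_nonneg_left (pow_le_pow_right₀ hq h2) (by positivity)
        _ = _ := by rw [pow_add]; ring
  unfold Pr
  rw [← mul_div_assoc, div_le_div_iff₀ (mass_true_pos hq _ _ _) (mass_true_pos hq _ _ _)]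
  have h1 : mass q p (lump P z r) D A ≤ mass q p r D A :=
    Finset.sum_le_sum fun ω _ => (key ω).1
  have h2 : mass q p r D (fun _ => True) ≤ q ^ P.card * mass q p (lump P z r) D fun _ => True := by
    unfold mass
    rw [Finset.mul_sum]
    exact Finset.sum_le_sum fun ω _ => (key ω).2
  calc _ ≤ mass q p r D A * (q ^ P.card * mass q p (lump P z r) D fun _ => True) :=
        mul_le_mul h1 h2 (mass_true_pos hq _ _ _).le (mass_nonneg hq _ _ _ _)
    _ = _ := by ring

lemma Pr_subdomain_le (hq : 1 ≤ q) {p : ℤ} {s : Setoid V} {D D' : Finset V} (h : D' ⊆ D)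
    {A : Finset V → Prop} (hA : Incr D A) : Pr q p s D' A ≤ Pr q p s D A := by
  have := Pr_explore_ge (q := q) (p := p) (s := s) (D := D) hq (G := fun _ => True) (A := A)
    (D' := fun _ => D') (ε := Pr q p s D' A) (fun _ _ _ => h)
    (fun _ _ _ _ _ => ⟨rfl, trivial⟩) (fun ω hω _ => ?_)
  · simpa [Pr_true hq] using this
  · have hA' : Incr D' A := fun a b hab hb => hA a b hab (hb.trans h)
    refine (Pr_le_of_dom hq (Dom.of_le le_sup_left) hA').trans (Pr_mono hq fun η hη hη' => ?_)
    exact hA _ _ Finset.subset_union_right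
      (Finset.union_subset (Finset.sdiff_subset.trans hω) (hη.trans h)) hη'

/-- The vertices connected in `ω` to the bad set `B`. -/
def reach (p : ℤ) (B : Set V) (ω : Finset V) : Set V := {v | ∃ b ∈ B, conn p ↑ω b v}

lemma reach_closed {p : ℤ} {B : Set V} {ω : Finset V} {c : V} (hc : c ∈ ω) :
    lo p c ∈ reach p B ω ↔ hi p c ∈ reach p B ω := by
  have h := conn_step (p := p) (A := (ω : Set V)) (Finset.mem_coe.2 hc)
  exact ⟨fun ⟨b, hb, h1⟩ => ⟨b, hb, conn_trans h1 h⟩,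
    fun ⟨b, hb, h1⟩ => ⟨b, hb, conn_trans h1 (conn_symm h)⟩⟩

lemma reach_inv {p : ℤ} {B : Set V} {ω ω' : Finset V}
    (h1 : ∀ c ∈ ω', c ∉ ω → lo p c ∉ reach p B ω ∧ hi p c ∉ reach p B ω)
    (h2 : ∀ c ∈ ω, lo p c ∈ reach p B ω → c ∈ ω') : reach p B ω' = reach p B ω := by
  ext v
  constructor
  · rintro ⟨b, hb, h⟩
    have := conn_inv (fun v => v ∈ reach p B ω) (fun c hc => ?_) h
    · exact this.mp ⟨b, hb, conn_refl p _ b⟩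
    · by_cases hcω : c ∈ ω
      · exact propext (reach_closed hcω)
      · simp only [h1 c hc hcω]
  · rintro ⟨b, hb, h⟩
    have := conn_inv (fun v => v ∈ reach p B ω ∧ v ∈ reach p B ω') (fun c hc => ?_) h
    · exact (this.mp ⟨⟨b, hb, conn_refl p _ b⟩, ⟨b, hb, conn_refl p _ b⟩⟩).2
    · have h3 := reach_closed (p := p) (B := B) (Finset.mem_coe.1 hc)
      by_cases hlo : lo p c ∈ reach p B ω
      · have h4 := reach_closed (p := p) (B := B) (h2 c hc hlo)
        simp only [h3, h4]
      · have hh : hi p c ∉ reach p B ω := fun h => hlo (h3.2 h)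
        simp only [hlo, hh, false_and]

/-- The corner of the box, through which its outer boundary is connected. -/
def corner (p : ℤ) (N : ℕ) : V := lo p (N, N)

lemma conn_corner {p : ℤ} {N : ℕ} {v : V} (hp : (v.1 + v.2 + p) % 2 = 0) (h0 : 0 ≤ v.2)
    (h : (N:ℤ) ≤ v.2 ∨ (N:ℤ) = v.1 ∨ -(N:ℤ) = v.1) :
    conn p (Hc \ ↑(box N N)) v (corner p N) := by
  have hup : {c : V | (N:ℤ) ≤ c.2} ⊆ Hc \ ↑(box N N) := by
    intro c hc
    have hc : (N:ℤ) ≤ c.2 := hc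
    refine ⟨show 0 ≤ c.2 by omega, ?_⟩
    rw [Finset.mem_coe, mem_box]; omega
  have hcor : (N:ℤ) ≤ (corner p N).2 := by rw [corner, lo_snd]
  have hcor' := lo_parity p (N, N)
  by_cases hN : (N:ℤ) ≤ v.2
  · exact conn_upper hup hN hcor hp hcor'
  push Not at hN
  obtain ⟨x, y⟩ := v
  simp only at hp h0 h hN
  rcases h with h | rfl | rfl
  · omega
  · have h1 := conn_col' p N hN.le (A := Hc \ ↑(box N N)) fun j h1 h2 =>
      ⟨show 0 ≤ j by omega, by rw [Finset.mem_coe, mem_box]; simp only; omega⟩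
    rwa [lo_of_even hp] at h1
  · have h1 := conn_col' p (-N - 1) hN.le (A := Hc \ ↑(box N N)) fun j h1 h2 =>
      ⟨show 0 ≤ j by omega, by rw [Finset.mem_coe, mem_box]; simp only; omega⟩
    have h2 : lo p (-(N:ℤ) - 1, y) = (-(N:ℤ), y) := by
      have : (-(N:ℤ) - 1 + y + p) % 2 ≠ 0 := by omega
      simp only [lo, this, if_false]; ring_nf
    rw [h2] at h1
    refine conn_trans h1 (conn_upper hup ?_ hcor (lo_parity p _) hcor')
    rw [lo_snd]

lemma corner_infinite (p : ℤ) (N : ℕ) : (cl p (Hc \ ↑(box N N)) (corner p N)).Infinite := by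
  have h2 : Set.Infinite (Set.range fun n : ℕ => lo p ((N:ℤ) + 2 * n, N)) := by
    refine Set.infinite_range_of_injective fun a b h => ?_
    have h3 := congrArg Prod.fst h
    simp only [lo] at h3
    split_ifs at h3 <;> simp only at h3 <;> omega
  refine h2.mono ?_
  rintro _ ⟨n, rfl⟩
  exact conn_symm (conn_corner (lo_parity p _) (by rw [lo_snd]; simp) (Or.inl (by rw [lo_snd])))

lemma outside_vertex {p : ℤ} {N : ℕ} {v c : V} (hv : v ∈ verts p (box N N)) (hc : c ∉ box N N)
    (h : lo p c = v ∨ hi p c = v) : (v.1 + v.2 + p) % 2 = 0 ∧ 0 ≤ v.2 ∧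
      (v.2 = 0 ∨ (N:ℤ) ≤ v.2 ∨ (N:ℤ) = v.1 ∨ -(N:ℤ) = v.1) := by
  obtain ⟨e, he, h'⟩ := mem_verts.1 hv
  rw [mem_box] at he hc
  unfold lo hi at h h'
  refine ⟨?_, ?_, ?_⟩
  · rcases h with rfl | rfl <;> split_ifs <;> (try simp only) <;> omega
  · rcases h' with rfl | rfl <;> split_ifs <;> (try simp only) <;> omega
  · have h1 : -(N:ℤ) ≤ v.1 ∧ v.1 ≤ N ∧ 0 ≤ v.2 ∧ v.2 ≤ N := by
      rcases h' with rfl | rfl <;> split_ifs <;> (try simp only) <;> omega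
    have h2 : (c.1 = v.1 ∨ c.1 + 1 = v.1) ∧ (c.2 = v.2 ∨ c.2 + 1 = v.2) := by
      rcases h with rfl | rfl <;> split_ifs <;> simp
    omega

end Avoid

section AvoidBound
open scoped Classical
variable {q : ℝ}

/-- A boundary condition on `D`: it only wires vertices of `D` incident to the outside. -/
def Adm (p : ℤ) (D : Finset V) (s : Setoid V) : Prop :=
  ∀ v w, s v w → v = w ∨ ((v ∈ verts p D ∧ ∃ c ∉ D, lo p c = v ∨ hi p c = v) ∧
    (w ∈ verts p D ∧ ∃ c ∉ D, lo p c = w ∨ hi p c = w))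

/-- The points of `D` on the boundary line at distance more than `k` from the origin. -/
def bad (p : ℤ) (D : Finset V) (k : ℕ) : Set V :=
  {v | v ∈ verts p D ∧ v.2 = 0 ∧ (k:ℤ) < |v.1|}

/-- The cells of `D` not touching the set explored from the bad points. -/
def unexplored (p : ℤ) (D : Finset V) (k : ℕ) (ω : Finset V) : Finset V :=
  D.filter fun c => lo p c ∉ reach p (bad p D k) ω ∧ hi p c ∉ reach p (bad p D k) ω

lemma esc_unexplored {p : ℤ} {N k : ℕ} {u : V} {ω η : Finset V} (hω : ω ⊆ box N N)
    (hu : u ∉ reach p (bad p (box N N) k) ω) (hη : η ⊆ unexplored p (box N N) k ω)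
    (h : esc p (box N N) u (ω \ unexplored p (box N N) k ω ∪ η)) : esc p (box N N) u η := by
  unfold esc at h ⊢
  set F := Hc \ (box N N : Set V) with hF
  by_contra hfin
  rw [Set.not_infinite] at hfin
  set S := reach p (bad p (box N N) k) ω with hS
  have htouch : ∀ v, (∃ c ∈ F, lo p c = v ∨ hi p c = v) → ¬ conn p (F ∪ ↑η) u v := by
    rintro v ⟨c, hc, hcv⟩ huv
    refine (corner_infinite p N).mono (fun w hw => ?_) hfin
    have hv : conn p F v (corner p N) := by
      have hc0 : 0 ≤ c.2 := hc.1
      have hcb := hc.2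
      rw [Finset.mem_coe, mem_box] at hcb
      by_cases hcN : (N:ℤ) ≤ c.2
      · rcases hcv with rfl | rfl
        · exact conn_corner (lo_parity p c) (by rwa [lo_snd]) (Or.inl (by rwa [lo_snd]))
        · exact conn_corner (hi_parity p c) (by rw [hi_snd]; omega)
            (Or.inl (by rw [hi_snd]; omega))
      · have h1 : conn p F (lo p c) (lo p (c.1, N)) :=
          conn_col' p c.1 (y1 := c.2) (by omega) fun j h1 h2 =>
            ⟨show 0 ≤ j by omega, by rw [Finset.mem_coe, mem_box]; simp only; omega⟩
        have h2 : conn p F (lo p (c.1, N)) (corner p N) :=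
          conn_corner (lo_parity p _) (by rw [lo_snd]; simp) (Or.inl (by rw [lo_snd]))
        have h3 := conn_trans h1 h2
        rcases hcv with rfl | rfl
        · exact h3
        · exact conn_trans (conn_symm (conn_step hc)) h3
    exact conn_trans huv (conn_mono Set.subset_union_left (conn_trans hv hw))
  have hnot : ∀ v, conn p (F ∪ ↑η) u v → v ∉ S := by
    intro v huv hvS
    have := conn_inv (fun v => conn p (F ∪ ↑η) u v ∧ v ∈ S) (fun c hc => ?_) huv
    · exact hu (this.mpr ⟨huv, hvS⟩).2
    · rcases hc with hc | hc
      · have h1 := htouch (lo p c) ⟨c, hc, Or.inl rfl⟩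
        have h2 := htouch (hi p c) ⟨c, hc, Or.inr rfl⟩
        simp only [h1, h2, false_and]
      · have h1 := (Finset.mem_filter.1 (hη hc)).2
        simp only [← hS] at h1
        simp only [h1.1, h1.2, and_false]
  refine h (hfin.subset fun v hv => ?_)
  have := conn_inv (fun v => conn p (F ∪ ↑η) u v) (fun c hc => ?_) hv
  · exact this.mp (conn_refl p _ u)
  · have hstep : ∀ c ∈ F ∪ ↑η, conn p (F ∪ ↑η) u (lo p c) = conn p (F ∪ ↑η) u (hi p c) :=
      fun c hc => propext ⟨fun h => conn_trans h (conn_step hc),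
        fun h => conn_trans h (conn_symm (conn_step hc))⟩
    rcases hc with hc | hc
    · exact hstep c (Or.inl hc)
    · rw [Finset.mem_coe, Finset.mem_union] at hc
      rcases hc with hc | hc
      · rw [Finset.mem_sdiff] at hc
        have h1 := reach_closed (p := p) (B := bad p (box N N) k) hc.1
        have h2 : lo p c ∈ S ∧ hi p c ∈ S := by
          by_contra hcon
          refine hc.2 (Finset.mem_filter.2 ⟨hω hc.1, ?_⟩)
          simp only [← hS] at h1 ⊢
          tauto
        refine propext ⟨fun h => absurd h2.1 (hnot _ h), fun h => absurd h2.2 (hnot _ h)⟩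
      · exact hstep c (Or.inr hc)

lemma dom_unexplored {p : ℤ} {N k : ℕ} {ω : Finset V} {s : Setoid V} (hω : ω ⊆ box N N)
    (hs : Adm p (box N N) s) :
    Dom p (s ⊔ conn p ↑(ω \ unexplored p (box N N) k ω))
      (lump (Finset.Icc (-(k:ℤ)) k ×ˢ {0}) (corner p N) (conn p (Hc \ ↑(box N N))))
      (unexplored p (box N N) k ω) := by
  set F := Hc \ (box N N : Set V) with hF
  set S := reach p (bad p (box N N) k) ω with hS
  set L := lump (Finset.Icc (-(k:ℤ)) k ×ˢ {0}) (corner p N) (conn p F) with hL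
  intro a ha e he h
  set R := L ⊔ conn p ↑a with hR
  let f : V → Quotient R := fun v => if v ∈ S then Quotient.mk R (corner p N) else Quotient.mk R v
  have hfS : ∀ v, v ∈ S → f v = Quotient.mk R (corner p N) := fun v hv => if_pos hv
  have hfN : ∀ v, v ∉ S → f v = Quotient.mk R v := fun v hv => if_neg hv
  have hb : ∀ v, (v ∈ verts p (box N N) ∧ ∃ c ∉ box N N, lo p c = v ∨ hi p c = v) →
      f v = Quotient.mk R (corner p N) := by
    rintro v ⟨hv, c, hc, hcv⟩
    by_cases hvS : v ∈ S
    · exact hfS v hvS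
    rw [hfN v hvS]
    obtain ⟨h1, h2, h3⟩ := outside_vertex hv hc hcv
    refine Quotient.sound ?_
    have hle : L ≤ R := le_sup_left
    refine hle ?_
    rcases h3 with h3 | h3
    · have h4 : ¬ (k:ℤ) < |v.1| := fun h4 =>
        hvS ⟨v, ⟨hv, h3, h4⟩, conn_refl p _ v⟩
      refine Or.inr ⟨⟨v, Finset.mem_insert_of_mem ?_, conn_refl p _ v⟩,
        corner p N, Finset.mem_insert_self _ _, conn_refl p _ _⟩
      rw [not_lt, abs_le] at h4
      rw [Finset.mem_product, Finset.mem_Icc, Finset.mem_singleton]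
      exact ⟨h4, h3⟩
    · exact Or.inl (conn_corner h1 h2 h3)
  have hle : (s ⊔ conn p ↑(ω \ unexplored p (box N N) k ω)) ⊔ conn p ↑a ≤ Setoid.ker f := by
    refine sup_le (sup_le ?_ ?_) ?_
    · intro v w hvw
      rcases hs v w hvw with rfl | ⟨hv, hw⟩
      · rfl
      · exact (hb v hv).trans (hb w hw).symm
    · intro v w hvw
      refine conn_inv f (fun c hc => ?_) hvw
      rw [Finset.mem_coe, Finset.mem_sdiff] at hc
      have h1 := reach_closed (p := p) (B := bad p (box N N) k) hc.1
      have h2 : lo p c ∈ S ∧ hi p c ∈ S := by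
        by_contra hcon
        refine hc.2 (Finset.mem_filter.2 ⟨hω hc.1, ?_⟩)
        simp only [← hS] at h1 ⊢
        tauto
      rw [hfS _ h2.1, hfS _ h2.2]
    · intro v w hvw
      refine conn_inv f (fun c hc => ?_) hvw
      have h1 := (Finset.mem_filter.1 (ha hc)).2
      rw [hfN _ h1.1, hfN _ h1.2]
      have hle : conn p ↑a ≤ R := le_sup_right
      exact Quotient.sound (hle (conn_step hc))
  have h1 : f (lo p e) = f (hi p e) := hle h
  have h2 := (Finset.mem_filter.1 he).2
  rw [hfN _ h2.1, hfN _ h2.2] at h1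
  exact Quotient.exact h1

lemma Pr_avoid_le (hq : 1 ≤ q) {p : ℤ} {N : ℕ} (k : ℕ) (u : V) {s : Setoid V}
    (hs : Adm p (box N N) s) :
    Pr q p s (box N N) (fun ω => u ∉ reach p (bad p (box N N) k) ω ∧ esc p (box N N) u ω) ≤
      q ^ (2 * k + 1) * Wp q p (box N N) (esc p (box N N) u) := by
  have hq0 : (0:ℝ) ≤ q := by linarith
  have hsub : ∀ ω, unexplored p (box N N) k ω ⊆ box N N := fun ω => Finset.filter_subset _ _
  have hW : 0 ≤ q ^ (2 * k + 1) * Wp q p (box N N) (esc p (box N N) u) :=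
    mul_nonneg (by positivity) (Wp_nonneg hq _ _ _)
  refine (Pr_explore_le hq (G := fun ω => u ∉ reach p (bad p (box N N) k) ω)
    (A := esc p (box N N) u) (D' := unexplored p (box N N) k)
    (ε := q ^ (2 * k + 1) * Wp q p (box N N) (esc p (box N N) u))
    (fun ω _ _ => hsub ω) (fun ω hω hG η hη => ?_) (fun ω hω hG => ?_)).trans
      (mul_le_of_le_one_right hW (Pr_le_one hq _))
  · have h1 : reach p (bad p (box N N) k) (ω \ unexplored p (box N N) k ω ∪ η) =
        reach p (bad p (box N N) k) ω := by
      refine reach_inv (fun c hc hcω => ?_) (fun c hc hlo => ?_)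
      · rw [Finset.mem_union, Finset.mem_sdiff] at hc
        rcases hc with hc | hc
        · exact absurd hc.1 hcω
        · exact (Finset.mem_filter.1 (hη hc)).2
      · refine Finset.mem_union_left _ (Finset.mem_sdiff.2 ⟨hc, fun h => ?_⟩)
        exact (Finset.mem_filter.1 h).2.1 hlo
    refine ⟨?_, by rwa [h1]⟩
    exact Finset.filter_congr fun c _ => by rw [h1]
  · have hinc : Incr (unexplored p (box N N) k ω) (esc p (box N N) u) :=
      fun a b hab hb => esc_incr p _ u a b hab (hb.trans (hsub ω))
    calc _ ≤ Pr q p (s ⊔ conn p ↑(ω \ unexplored p (box N N) k ω)) (unexplored p (box N N) k ω)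
            (esc p (box N N) u) := Pr_mono hq fun η hη h => esc_unexplored hω hG hη h
      _ ≤ _ := Pr_le_of_dom hq (dom_unexplored hω hs) hinc
      _ ≤ _ := Pr_lump_le hq _ _ _ _ _ _
      _ ≤ q ^ (2 * k + 1) * Wp q p (box N N) (esc p (box N N) u) := by
        have hcard : (Finset.Icc (-(k:ℤ)) k ×ˢ ({0} : Finset ℤ)).card = 2 * k + 1 := by
          rw [Finset.card_product, Int.card_Icc, Finset.card_singleton]; omega
        rw [hcard]
        exact mul_le_mul_of_nonneg_left (Pr_subdomain_le hq (hsub ω) (esc_incr p _ u))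
          (by positivity)

/-- Uniformly in the boundary conditions, it is unlikely in a large box to escape without
touching the boundary line far from the origin. -/
lemma exists_avoid_le (hq : 1 ≤ q) (p : ℤ) (k : ℕ) (u : V) {ε : ℝ} (hε : 0 < ε) :
    ∃ N : ℕ, ∀ s : Setoid V, Adm p (box N N) s →
      Pr q p s (box N N) (fun ω => u ∉ reach p (bad p (box N N) k) ω ∧
        esc p (box N N) u ω) ≤ ε := by
  have hq0 : (0:ℝ) < q := by linarith
  obtain ⟨D, hD, h⟩ := exists_esc_le hq p u (ε := ε / q ^ (2 * k + 1)) (by positivity)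
  obtain ⟨N, hN⟩ : ∃ N : ℕ, D ⊆ box N N := by
    refine ⟨D.sup (fun c => c.1.natAbs + c.2.natAbs + 1), fun c hc => ?_⟩
    have := Finset.le_sup (f := fun c : V => c.1.natAbs + c.2.natAbs + 1) hc
    have h0 : 0 ≤ c.2 := hD hc
    rw [mem_box]
    omega
  refine ⟨N, fun s hs => (Pr_avoid_le hq k u hs).trans ?_⟩
  have := h (box N N) (box_Hc N N) hN
  rwa [le_div_iff₀' (by positivity)] at this

end AvoidBound

section Measurability

lemma measurableSet_reflTransGen {Ω : Type*} [MeasurableSpace Ω] {r : Ω → V → V → Prop}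
    (hr : ∀ a b, MeasurableSet {ω | r ω a b}) (u v : V) :
    MeasurableSet {ω | Relation.ReflTransGen (r ω) u v} := by
  let P : ℕ → V → Set Ω := fun n => Nat.rec (fun v => {_ω | v = u})
    (fun _ Q b => ⋃ a : V, Q a ∩ {ω | r ω a b}) n
  have hP : ∀ n b, MeasurableSet (P n b) := by
    intro n
    induction n with
    | zero => exact fun b => MeasurableSet.const _
    | succ n ih => exact fun b => MeasurableSet.iUnion fun a => (ih a).inter (hr a b)
  have key : {ω | Relation.ReflTransGen (r ω) u v} = ⋃ n, P n v := by
    ext ω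
    rw [Set.mem_iUnion]
    constructor
    · intro h
      induction (h : Relation.ReflTransGen (r ω) u v) with
      | refl => exact ⟨0, rfl⟩
      | tail _ hbc ih =>
        obtain ⟨n, hn⟩ := ih
        exact ⟨n + 1, Set.mem_iUnion.2 ⟨_, hn, hbc⟩⟩
    · rintro ⟨n, hn⟩
      change Relation.ReflTransGen (r ω) u v
      induction n generalizing v with
      | zero => rw [show v = u from hn]
      | succ n ih =>
        obtain ⟨a, ha, hav⟩ := Set.mem_iUnion.1 hn
        exact (ih a ha).tail hav
  rw [key]
  exact MeasurableSet.iUnion fun n => hP n v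

lemma measurableSet_infinite {Ω : Type*} [MeasurableSpace Ω] {s : Ω → Set V}
    (hs : ∀ v, MeasurableSet {ω | v ∈ s ω}) : MeasurableSet {ω | (s ω).Infinite} := by
  have : {ω | (s ω).Infinite} = ⋂ F : Finset V, ⋃ v : V, {_ω : Ω | v ∉ F} ∩ {ω | v ∈ s ω} := by
    ext ω
    simp only [Set.mem_iInter, Set.mem_iUnion]
    constructor
    · intro h F
      obtain ⟨v, hv, hvF⟩ := Set.Infinite.exists_notMem_finset h F
      exact ⟨v, hvF, hv⟩
    · intro h hfin
      obtain ⟨v, hv, hvs⟩ := h hfin.toFinset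
      exact hv (hfin.mem_toFinset.2 hvs)
  rw [this]
  exact MeasurableSet.iInter fun F => MeasurableSet.iUnion fun v =>
    (MeasurableSet.const _).inter (hs v)

variable {Adj : V → V → Prop}

instance : Countable (Edge Adj) := by
  have : Countable (Sym2 V) := inferInstanceAs (Countable (Quot _))
  infer_instance

lemma measurableSet_connectedIn (S : Set (Edge Adj)) (u v : V) :
    MeasurableSet {ω | ConnectedIn Adj ω S u v} := by
  refine measurableSet_reflTransGen (fun a b => ?_) u v
  have : {ω : Config Adj | ∃ e : Edge Adj, e ∈ S ∧ ω e = true ∧ Inc Adj a e ∧ Inc Adj b e} =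
      ⋃ e : Edge Adj, {_ω | e ∈ S} ∩ ({ω | ω e = true} ∩ {_ω | Inc Adj a e ∧ Inc Adj b e}) := by
    ext ω; simp only [Set.mem_iUnion]; rfl
  rw [this]
  refine MeasurableSet.iUnion fun e => (MeasurableSet.const _).inter (MeasurableSet.inter ?_
    (MeasurableSet.const _))
  exact (measurable_pi_apply (X := fun _ : Edge Adj => Bool) e) (measurableSet_singleton true)

lemma measurableSet_infCluster (S : Set (Edge Adj)) (u : V) :
    MeasurableSet {ω | InfCluster Adj ω S u} :=
  measurableSet_infinite fun v => measurableSet_connectedIn S u v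

lemma finite_bdry (maxDeg : ℕ) (D : Finset (Edge Adj)) : (bdry Adj maxDeg D).Finite := by
  have h : (⋃ e ∈ D, {v : V | Inc Adj v e}).Finite := by
    refine Set.Finite.biUnion D.finite_toSet fun e _ => ?_
    obtain ⟨⟨x, y⟩, h⟩ := e
    refine (Set.toFinite {x, y}).subset fun v hv => ?_
    exact Sym2.mem_iff.1 hv
  refine h.subset fun v hv => ?_
  obtain ⟨e, he, hve⟩ := hv.1
  exact Set.mem_biUnion he hve

lemma measurableSet_inducedBC (maxDeg : ℕ) (D : Finset (Edge Adj))
    (ξ : Setoid (bdry Adj maxDeg D)) :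
    MeasurableSet {ω | inducedBC Adj maxDeg D ω = ξ} := by
  have := (finite_bdry maxDeg D).to_subtype
  let g : Config Adj → (bdry Adj maxDeg D × bdry Adj maxDeg D → Prop) := fun ω x =>
    ConnectedIn Adj ω {e | e ∉ D} x.1.1 x.2.1 ∨
      (InfCluster Adj ω {e | e ∉ D} x.1.1 ∧ InfCluster Adj ω {e | e ∉ D} x.2.1)
  have hg : Measurable g := by
    refine measurable_pi_lambda _ fun x => ?_
    refine measurable_to_prop ?_
    have : (fun ω => g ω x) ⁻¹' {True} = {ω | ConnectedIn Adj ω {e | e ∉ D} x.1.1 x.2.1} ∪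
        ({ω | InfCluster Adj ω {e | e ∉ D} x.1.1} ∩ {ω | InfCluster Adj ω {e | e ∉ D} x.2.1}) := by
      ext ω
      simp only [Set.mem_preimage, Set.mem_singleton_iff, eq_iff_iff, iff_true]
      rfl
    rw [this]
    exact (measurableSet_connectedIn _ _ _).union
      ((measurableSet_infCluster _ _).inter (measurableSet_infCluster _ _))
  have : {ω | inducedBC Adj maxDeg D ω = ξ} =
      g ⁻¹' {r | Relation.EqvGen.setoid (fun u v => r (u, v)) = ξ} := rfl
  rw [this]
  exact hg (Set.toFinite _).measurableSet

lemma measurable_restrictD (D : Finset (Edge Adj)) : Measurable (restrictD Adj D) :=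
  measurable_pi_lambda _ fun e => measurable_pi_apply e.1

/-- To bound the probability of a local event under a Gibbs measure, it suffices to bound it
under every finite-volume measure with an induced boundary condition. -/
lemma IsGibbs.le_of_forall {maxDeg : ℕ} {p q : ℝ} {φ : Measure (Config Adj)}
    (hφ : IsGibbs Adj maxDeg p q φ) (D : Finset (Edge Adj)) (B : Set ({e // e ∈ D} → Bool))
    {ε : ℝ≥0∞}
    (h : ∀ τ : Config Adj, fkFin Adj p q maxDeg D (inducedBC Adj maxDeg D τ) B ≤ ε) :
    φ (restrictD Adj D ⁻¹' B) ≤ ε := by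
  have := hφ.1
  have := (finite_bdry maxDeg D).to_subtype
  have hfin : Finite (Setoid (bdry Adj maxDeg D)) :=
    Finite.of_injective (fun s : Setoid (bdry Adj maxDeg D) => s.r) fun s t hst =>
      Setoid.ext fun a b => by rw [show s.r = t.r from hst]
  let C : Setoid (bdry Adj maxDeg D) → Set (Config Adj) :=
    fun ξ => {ω | inducedBC Adj maxDeg D ω = ξ}
  have hC : ∀ ξ, MeasurableSet (C ξ) := measurableSet_inducedBC maxDeg D
  have hdisj : Pairwise (Function.onFun Disjoint C) := by
    intro ξ ξ' hne
    rw [Function.onFun, Set.disjoint_left]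
    exact fun ω h1 h2 => hne (h1.symm.trans h2)
  have hB : MeasurableSet (restrictD Adj D ⁻¹' B) :=
    measurable_restrictD D (Set.toFinite B).measurableSet
  have hbd : ∀ ξ, φ (C ξ ∩ restrictD Adj D ⁻¹' B) ≤ ε * φ (C ξ) := by
    intro ξ
    by_cases h0 : φ (C ξ) = 0
    · exact (measure_mono_null Set.inter_subset_left h0).le.trans bot_le
    obtain ⟨τ, hτ⟩ : (C ξ).Nonempty := by
      rw [Set.nonempty_iff_ne_empty]
      intro h1; rw [h1] at h0; exact h0 measure_empty
    have h2 := hφ.2 D ξ Set.univ MeasurableSet.univ (fun _ _ _ => Iff.rfl)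
      (by rwa [Set.inter_univ])
    rw [Set.inter_univ] at h2
    have h3 := h τ
    rw [show inducedBC Adj maxDeg D τ = ξ from hτ, ← h2,
      Measure.map_apply (measurable_restrictD D) (Set.toFinite B).measurableSet,
      cond_apply (hC ξ)] at h3
    have h4 : φ (C ξ) ≠ ∞ := measure_ne_top _ _
    calc _ = (φ (C ξ))⁻¹ * φ (C ξ ∩ restrictD Adj D ⁻¹' B) * φ (C ξ) := by
          rw [mul_comm, ← mul_assoc, ENNReal.mul_inv_cancel h0 h4, one_mul]
      _ ≤ _ := by gcongr
  have hcov : restrictD Adj D ⁻¹' B = ⋃ ξ, (C ξ ∩ restrictD Adj D ⁻¹' B) := by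
    ext ω
    simp only [Set.mem_iUnion]
    exact ⟨fun h => ⟨_, rfl, h⟩, fun ⟨_, _, h⟩ => h⟩
  calc φ (restrictD Adj D ⁻¹' B) ≤ ∑' ξ, φ (C ξ ∩ restrictD Adj D ⁻¹' B) := by
        conv_lhs => rw [hcov]
        exact measure_iUnion_le _
    _ ≤ ∑' ξ, ε * φ (C ξ) := ENNReal.tsum_le_tsum hbd
    _ = ε * φ (⋃ ξ, C ξ) := by rw [ENNReal.tsum_mul_left, measure_iUnion hdisj hC]
    _ ≤ ε * 1 := by gcongr; exact prob_le_one
    _ = ε := mul_one ε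

end Measurability

section HalfPlaneCoordinates

/-- Two points which are diagonal neighbours in the square grid. -/
def Diag (u v : V) : Prop := (u.1 - v.1) ^ 2 = 1 ∧ (u.2 - v.2) ^ 2 = 1

/-- Lattice coordinates in which the half-plane `hpRegion a t` is the upper half-plane. -/
structure HPCoord (a : V) (t : ℤ) where
  T : V ≃ V
  even_iff : ∀ u, Even ((T u).1 + (T u).2) ↔ Even (u.1 + u.2)
  diag_iff : ∀ u v, Diag (T u) (T v) ↔ Diag u v
  cross : ∀ u v, crossSym (T u) (T v) = Sym2.map T (crossSym u v)
  region : ∀ u, T u ∈ hpRegion a t ↔ 0 ≤ u.2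
  line : ∀ u, T u ∈ hpLine a t ↔ u.2 = 0

lemma sq_sub_add (x y t : ℤ) : (x + t - (y + t)) ^ 2 = (x - y) ^ 2 := by ring

lemma sq_neg_sub (x y t : ℤ) : (-x - t - (-y - t)) ^ 2 = (x - y) ^ 2 := by ring

lemma exists_hpCoord (a : V) (ha : a = (0, 1) ∨ a = (0, -1) ∨ a = (1, 0) ∨ a = (-1, 0)) (t : ℤ) :
    Nonempty (HPCoord a t) := by
  rcases ha with rfl | rfl | rfl | rfl
  · refine ⟨⟨⟨fun u => (u.1 + t, u.2 + t), fun u => (u.1 - t, u.2 - t), fun u => by simp,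
      fun u => by simp⟩, fun u => ?_, fun u v => ?_, fun u v => rfl, fun u => ?_, fun u => ?_⟩⟩
    · simp only [Equiv.coe_fn_mk, Int.even_iff]; omega
    · simp only [Equiv.coe_fn_mk, Diag, sq_sub_add]
    · simp only [Equiv.coe_fn_mk, hpRegion, Set.mem_ofPred_eq]; omega
    · simp only [Equiv.coe_fn_mk, hpLine, Set.mem_ofPred_eq]; omega
  · refine ⟨⟨⟨fun u => (u.1 + t, -u.2 - t), fun u => (u.1 - t, -u.2 - t), fun u => by simp,
      fun u => by simp⟩, fun u => ?_, fun u v => ?_, fun u v => rfl, fun u => ?_, fun u => ?_⟩⟩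
    · simp only [Equiv.coe_fn_mk, Int.even_iff]; omega
    · simp only [Equiv.coe_fn_mk, Diag, sq_sub_add, sq_neg_sub]
    · simp only [Equiv.coe_fn_mk, hpRegion, Set.mem_ofPred_eq]; omega
    · simp only [Equiv.coe_fn_mk, hpLine, Set.mem_ofPred_eq]; omega
  · refine ⟨⟨⟨fun u => (u.2 + t, u.1 + t), fun u => (u.2 - t, u.1 - t), fun u => by simp,
      fun u => by simp⟩, fun u => ?_, fun u v => ?_, fun u v => Sym2.eq_swap, fun u => ?_,
      fun u => ?_⟩⟩
    · simp only [Equiv.coe_fn_mk, Int.even_iff]; omega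
    · simp only [Equiv.coe_fn_mk, Diag, sq_sub_add]; exact and_comm
    · simp only [Equiv.coe_fn_mk, hpRegion, Set.mem_ofPred_eq]; omega
    · simp only [Equiv.coe_fn_mk, hpLine, Set.mem_ofPred_eq]; omega
  · refine ⟨⟨⟨fun u => (-u.2 - t, u.1 + t), fun u => (u.2 - t, -u.1 - t), fun u => by simp,
      fun u => by simp⟩, fun u => ?_, fun u v => ?_, fun u v => Sym2.eq_swap, fun u => ?_,
      fun u => ?_⟩⟩
    · simp only [Equiv.coe_fn_mk, Int.even_iff]; omega
    · simp only [Equiv.coe_fn_mk, Diag, sq_sub_add, sq_neg_sub]; exact and_comm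
    · simp only [Equiv.coe_fn_mk, hpRegion, Set.mem_ofPred_eq]; omega
    · simp only [Equiv.coe_fn_mk, hpLine, Set.mem_ofPred_eq]; omega

lemma diag_lo_hi (p : ℤ) (c : V) : Diag (lo p c) (hi p c) := by
  unfold Diag lo hi
  split_ifs <;> simp

lemma sq_eq_one_cases {x y : ℤ} (h : (x - y) ^ 2 = 1) : x = y + 1 ∨ y = x + 1 := by
  have h2 : (x - y - 1) * (x - y + 1) = 0 := by linear_combination h
  rcases mul_eq_zero.1 h2 with h | h <;> omega

lemma exists_cell {p : ℤ} {u v : V} (h : Diag u v) (hu : (u.1 + u.2 + p) % 2 = 0) :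
    ∃ c, (u = lo p c ∧ v = hi p c) ∨ (u = hi p c ∧ v = lo p c) := by
  obtain ⟨x, y⟩ := u
  obtain ⟨x', y'⟩ := v
  obtain ⟨h1, h2⟩ := h
  simp only at hu h1 h2
  refine ⟨(min x x', min y y'), ?_⟩
  unfold lo hi
  rcases sq_eq_one_cases h1 with rfl | rfl <;> rcases sq_eq_one_cases h2 with rfl | rfl <;>
    split_ifs <;> simp <;> simp_all <;> omega

end HalfPlaneCoordinates

section EdgeCells

variable {a : V} {t : ℤ} (S : HPCoord a t)

lemma HPCoord.adjL_iff {u v : V} :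
    AdjL (S.T u) (S.T v) ↔ (u.1 + u.2) % 2 = 0 ∧ (v.1 + v.2) % 2 = 0 ∧ Diag u v := by
  unfold AdjL
  rw [S.even_iff, S.even_iff, Int.even_iff, Int.even_iff]
  have := S.diag_iff u v
  unfold Diag at this ⊢
  rw [this]

/-- The edge of the square lattice crossing the cell `c`, in half-plane coordinates. -/
def HPCoord.edge (c : V) : Edge AdjL :=
  ⟨s(S.T (lo 0 c), S.T (hi 0 c)), _, _, S.adjL_iff.2
    ⟨by simpa using lo_parity 0 c, by simpa using hi_parity 0 c, diag_lo_hi 0 c⟩, rfl⟩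

lemma HPCoord.edge_surjective : Function.Surjective S.edge := by
  rintro ⟨_, u, v, h, rfl⟩
  obtain ⟨u, rfl⟩ := S.T.surjective u
  obtain ⟨v, rfl⟩ := S.T.surjective v
  obtain ⟨h1, h2, h3⟩ := S.adjL_iff.1 h
  obtain ⟨c, ⟨rfl, rfl⟩ | ⟨rfl, rfl⟩⟩ := exists_cell (p := 0) h3 (by simpa using h1)
  · exact ⟨c, rfl⟩
  · exact ⟨c, Subtype.ext Sym2.eq_swap⟩

lemma lo_hi_injective {p : ℤ} {c d : V} (h : lo p c = lo p d) (h' : hi p c = hi p d) : c = d := by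
  obtain ⟨x, y⟩ := c
  obtain ⟨x', y'⟩ := d
  unfold lo at h
  unfold hi at h'
  have h1 := congrArg Prod.fst h
  have h2 := congrArg Prod.snd h
  have h3 := congrArg Prod.fst h'
  split_ifs at h1 h2 h3 <;> simp only at h1 h2 h3 <;> ext <;> simp only <;> omega

lemma HPCoord.edge_injective : Function.Injective S.edge := by
  intro c d h
  have h1 := congrArg Subtype.val h
  simp only [HPCoord.edge, Sym2.eq_iff, S.T.injective.eq_iff] at h1
  rcases h1 with ⟨h1, h2⟩ | ⟨h1, h2⟩
  · exact lo_hi_injective h1 h2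
  · have h3 := congrArg Prod.snd h1
    have h4 := congrArg Prod.snd h2
    rw [lo_snd, hi_snd] at h3
    rw [lo_snd, hi_snd] at h4
    omega

lemma HPCoord.inc_edge {v c : V} : Inc AdjL (S.T v) (S.edge c) ↔ lo 0 c = v ∨ hi 0 c = v := by
  unfold Inc HPCoord.edge
  rw [Sym2.mem_iff, S.T.injective.eq_iff, S.T.injective.eq_iff, eq_comm, @eq_comm _ v]

lemma HPCoord.edge_mem_hpE {c : V} : S.edge c ∈ hpE a t ↔ c ∈ Hc := by
  unfold hpE edgesInRegion HPCoord.edge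
  simp only [Set.mem_ofPred_eq, Sym2.mem_iff, forall_eq_or_imp, forall_eq, S.region, lo_snd, hi_snd]
  exact ⟨fun h => h.1, fun h => ⟨h, by have : 0 ≤ c.2 := h; omega⟩⟩

lemma HPCoord.cross_edge (c : V) :
    crossSym (S.T (lo 1 c)) (S.T (hi 1 c)) = (S.edge c : Sym2 V) := by
  rw [S.cross]
  have : crossSym (lo 1 c) (hi 1 c) = s(lo 0 c, hi 0 c) := by
    unfold crossSym lo hi
    by_cases h : (c.1 + c.2 + 0) % 2 = 0
    · have h1 : (c.1 + c.2 + 1) % 2 ≠ 0 := by omega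
      simp only [h, h1, if_true, if_false]
      exact Sym2.eq_swap
    · have h1 : (c.1 + c.2 + 1) % 2 = 0 := by omega
      simp only [h, h1, if_true, if_false]
      exact Sym2.eq_swap
  rw [this]; rfl

lemma crossSym_swap (u v : V) : crossSym u v = crossSym v u := Sym2.eq_swap

/-- The cells crossed by the open edges (`b = true`), or by the dual-open edges (`b = false`),
of `E`. -/
def HPCoord.cells (b : Bool) (ω : Config AdjL) (E : Set (Edge AdjL)) : Set V :=
  {c | S.edge c ∈ E ∧ ω (S.edge c) = b}

lemma HPCoord.connectedIn_iff (ω : Config AdjL) (E : Set (Edge AdjL)) (u v : V) :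
    ConnectedIn AdjL ω E (S.T u) (S.T v) ↔ conn 0 (S.cells true ω E) u v := by
  constructor
  · intro h
    suffices H : ∀ x y, ConnectedIn AdjL ω E x y →
        conn 0 (S.cells true ω E) (S.T.symm x) (S.T.symm y) by simpa using H _ _ h
    intro x y h
    induction (h : Relation.ReflTransGen _ x y) with
    | refl => exact conn_refl _ _ _
    | @tail b d _ hbd ih =>
      refine conn_trans ih ?_
      obtain ⟨e, he, hω, hb, hd⟩ := hbd
      obtain ⟨c, rfl⟩ := S.edge_surjective e
      have hc : c ∈ S.cells true ω E := ⟨he, hω⟩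
      rw [← S.T.apply_symm_apply b, S.inc_edge] at hb
      rw [← S.T.apply_symm_apply d, S.inc_edge] at hd
      have hstep := conn_step (p := 0) hc
      rcases hb with hb | hb <;> rcases hd with hd | hd
      · rw [← hb, ← hd]
      · rwa [hb, hd] at hstep
      · rw [hb, hd] at hstep; exact conn_symm hstep
      · rw [← hb, ← hd]
  · intro h
    have := conn_inv (fun v => ConnectedIn AdjL ω E (S.T u) (S.T v)) (fun c hc => ?_) h
    · exact this.mp Relation.ReflTransGen.refl
    · exact propext ⟨fun h => h.tail ⟨_, hc.1, hc.2, S.inc_edge.2 (Or.inl rfl),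
        S.inc_edge.2 (Or.inr rfl)⟩, fun h => h.tail ⟨_, hc.1, hc.2, S.inc_edge.2 (Or.inr rfl),
        S.inc_edge.2 (Or.inl rfl)⟩⟩

lemma HPCoord.isDualV_iff (u : V) : IsDualV (S.T u) ↔ (u.1 + u.2 + 1) % 2 = 0 := by
  unfold IsDualV
  rw [← Int.not_even_iff_odd, S.even_iff, Int.even_iff]; omega

lemma HPCoord.dualStep_of_mem {ω : Config AdjL} {E : Set (Edge AdjL)} {c : V}
    (hc : c ∈ S.cells false ω E) : DualStep ω E (S.T (lo 1 c)) (S.T (hi 1 c)) ∧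
      DualStep ω E (S.T (hi 1 c)) (S.T (lo 1 c)) := by
  have h1 := S.cross_edge c
  have h2 : crossSym (S.T (hi 1 c)) (S.T (lo 1 c)) = (S.edge c : Sym2 V) := by
    rw [crossSym_swap, h1]
  have hd := (S.diag_iff _ _).2 (diag_lo_hi 1 c)
  have hd' : Diag (S.T (hi 1 c)) (S.T (lo 1 c)) :=
    ⟨by linear_combination hd.1, by linear_combination hd.2⟩
  have hl := (S.isDualV_iff _).2 (lo_parity 1 c)
  have hh := (S.isDualV_iff _).2 (hi_parity 1 c)
  refine ⟨⟨hl, hh, hd.1, hd.2, h1 ▸ (S.edge c).2, ?_⟩,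
    ⟨hh, hl, hd'.1, hd'.2, h2 ▸ (S.edge c).2, ?_⟩⟩
  · simp only [h1]; exact hc
  · simp only [h2]; exact hc

lemma HPCoord.dualConnectedIn_iff (ω : Config AdjL) (E : Set (Edge AdjL)) (u v : V) :
    DualConnectedIn ω E (S.T u) (S.T v) ↔ conn 1 (S.cells false ω E) u v := by
  constructor
  · intro h
    suffices H : ∀ x y, DualConnectedIn ω E x y →
        conn 1 (S.cells false ω E) (S.T.symm x) (S.T.symm y) by simpa using H _ _ h
    intro x y h
    induction (h : Relation.ReflTransGen _ x y) with
    | refl => exact conn_refl _ _ _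
    | @tail b d _ hbd ih =>
      refine conn_trans ih ?_
      obtain ⟨hb, hd, h1, h2, h3, h4⟩ := hbd
      obtain ⟨b, rfl⟩ := S.T.surjective b
      obtain ⟨d, rfl⟩ := S.T.surjective d
      rw [S.T.symm_apply_apply, S.T.symm_apply_apply]
      obtain ⟨c, hc⟩ := exists_cell ((S.diag_iff b d).1 ⟨h1, h2⟩) ((S.isDualV_iff b).1 hb)
      have h5 : crossSym (S.T b) (S.T d) = (S.edge c : Sym2 V) := by
        rcases hc with ⟨rfl, rfl⟩ | ⟨rfl, rfl⟩
        · exact S.cross_edge c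
        · rw [crossSym_swap]; exact S.cross_edge c
      simp only [h5] at h4
      exact conn_cell (c := c) h4 hc
  · intro h
    have := conn_inv (fun v => DualConnectedIn ω E (S.T u) (S.T v)) (fun c hc => ?_) h
    · exact this.mp Relation.ReflTransGen.refl
    · exact propext ⟨fun h => h.tail (S.dualStep_of_mem hc).1,
        fun h => h.tail (S.dualStep_of_mem hc).2⟩

lemma HPCoord.infCluster_iff (ω : Config AdjL) (E : Set (Edge AdjL)) (u : V) :
    InfCluster AdjL ω E (S.T u) ↔ (cl 0 (S.cells true ω E) u).Infinite := by
  have : {v | ConnectedIn AdjL ω E (S.T u) v} = S.T '' cl 0 (S.cells true ω E) u := by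
    ext v
    obtain ⟨v, rfl⟩ := S.T.surjective v
    rw [S.T.injective.mem_set_image]
    exact S.connectedIn_iff ω E u v
  unfold InfCluster
  rw [this, Set.infinite_image_iff S.T.injective.injOn]

lemma HPCoord.dualInfCluster_iff (ω : Config AdjL) (E : Set (Edge AdjL)) (u : V) :
    DualInfCluster ω E (S.T u) ↔ (cl 1 (S.cells false ω E) u).Infinite := by
  have : {v | DualConnectedIn ω E (S.T u) v} = S.T '' cl 1 (S.cells false ω E) u := by
    ext v
    obtain ⟨v, rfl⟩ := S.T.surjective v
    rw [S.T.injective.mem_set_image]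
    exact S.dualConnectedIn_iff ω E u v
  unfold DualInfCluster
  rw [this, Set.infinite_image_iff S.T.injective.injOn]

lemma HPCoord.cells_hpE (b : Bool) (ω : Config AdjL) :
    S.cells b ω (hpE a t) = {c | c ∈ Hc ∧ ω (S.edge c) = b} := by
  unfold HPCoord.cells
  simp only [S.edge_mem_hpE]

/-- If all infinite clusters of the half-plane touch its boundary line infinitely often, then
the desired conclusions hold. -/
lemma HPCoord.conclusion {ω : Config AdjL} (h0 : TouchesLine 0 (S.cells true ω (hpE a t)))
    (h1 : TouchesLine 1 (S.cells false ω (hpE a t))) :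
    (∀ u v : V, InfCluster AdjL ω (hpE a t) u → InfCluster AdjL ω (hpE a t) v →
          ConnectedIn AdjL ω (hpE a t) u v) ∧
        (∀ u : V, InfCluster AdjL ω (hpE a t) u →
          {v : V | v ∈ hpLine a t ∧ ConnectedIn AdjL ω (hpE a t) u v}.Infinite) ∧
        (∀ w w' : V, DualInfCluster ω (hpE a t) w → DualInfCluster ω (hpE a t) w' →
          DualConnectedIn ω (hpE a t) w w') ∧
        (∀ w : V, DualInfCluster ω (hpE a t) w →
          {w' : V | w' ∈ hpLine a t ∧ DualConnectedIn ω (hpE a t) w w'}.Infinite) := by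
  have hH0 : S.cells true ω (hpE a t) ⊆ Hc := by rw [S.cells_hpE]; exact fun c hc => hc.1
  have hH1 : S.cells false ω (hpE a t) ⊆ Hc := by rw [S.cells_hpE]; exact fun c hc => hc.1
  have hc0 : Hc \ S.cells true ω (hpE a t) = S.cells false ω (hpE a t) := by
    ext c
    simp only [S.cells_hpE, Set.mem_sdiff, Set.mem_ofPred_eq]
    cases ω (S.edge c) <;> simp
  have hc1 : Hc \ S.cells false ω (hpE a t) = S.cells true ω (hpE a t) := by
    ext c
    simp only [S.cells_hpE, Set.mem_sdiff, Set.mem_ofPred_eq]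
    cases ω (S.edge c) <;> simp
  have h0' : TouchesLine (1 + 1) (S.cells true ω (hpE a t)) := by
    have := h0
    unfold TouchesLine at this ⊢
    intro u hu
    have e1 : conn ((0:ℤ) + 1 + 1) (S.cells true ω (hpE a t)) =
        conn 0 (S.cells true ω (hpE a t)) := by rw [conn_period]
    have e2 : cl ((0:ℤ) + 1 + 1) (S.cells true ω (hpE a t)) u =
        cl 0 (S.cells true ω (hpE a t)) u := by rw [cl_period]
    rw [zero_add] at e1 e2
    rw [e2] at hu
    rw [e1]
    exact this u hu
  have hinj : Function.Injective fun x : ℤ => S.T (x, 0) := fun x y h =>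
    congrArg Prod.fst (S.T.injective h)
  refine ⟨fun u v hu hv => ?_, fun u hu => ?_, fun u v hu hv => ?_, fun u hu => ?_⟩
  · obtain ⟨u, rfl⟩ := S.T.surjective u
    obtain ⟨v, rfl⟩ := S.T.surjective v
    rw [S.infCluster_iff] at hu hv
    rw [S.connectedIn_iff]
    exact unique_of_touches hH0 h0 (by rw [hc0]; exact h1) hu hv
  · obtain ⟨u, rfl⟩ := S.T.surjective u
    rw [S.infCluster_iff] at hu
    refine ((h0 u hu).image (f := fun x : ℤ => S.T (x, 0)) hinj.injOn).mono ?_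
    rintro _ ⟨x, hx, rfl⟩
    exact ⟨(S.line _).2 rfl, (S.connectedIn_iff _ _ _ _).2 hx⟩
  · obtain ⟨u, rfl⟩ := S.T.surjective u
    obtain ⟨v, rfl⟩ := S.T.surjective v
    rw [S.dualInfCluster_iff] at hu hv
    rw [S.dualConnectedIn_iff]
    exact unique_of_touches hH1 h1 (by rw [hc1]; exact h0') hu hv
  · obtain ⟨u, rfl⟩ := S.T.surjective u
    rw [S.dualInfCluster_iff] at hu
    refine ((h1 u hu).image (f := fun x : ℤ => S.T (x, 0)) hinj.injOn).mono ?_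
    rintro _ ⟨x, hx, rfl⟩
    exact ⟨(S.line _).2 rfl, (S.dualConnectedIn_iff _ _ _ _).2 hx⟩

end EdgeCells

section OutsideBC
open scoped Classical
variable {q : ℝ}

/-- The restriction of an equivalence relation to `W`. -/
def restr (W : Finset V) (s : Setoid V) : Setoid V where
  r u v := u = v ∨ (u ∈ W ∧ v ∈ W) ∧ s u v
  iseqv := by
    refine ⟨fun u => Or.inl rfl, ?_, ?_⟩
    · rintro u v (h | ⟨⟨h, h'⟩, k⟩)
      · exact Or.inl h.symm
      · exact Or.inr ⟨⟨h', h⟩, s.symm k⟩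
    · rintro u v w (rfl | ⟨⟨h, h'⟩, k⟩) (rfl | ⟨⟨l, l'⟩, m⟩)
      · exact Or.inl rfl
      · exact Or.inr ⟨⟨l, l'⟩, m⟩
      · exact Or.inr ⟨⟨h, h'⟩, k⟩
      · exact Or.inr ⟨⟨h, l'⟩, s.trans k m⟩

lemma restr_le (W : Finset V) (s : Setoid V) : restr W s ≤ s := by
  rintro u v (rfl | h)
  · exact s.refl u
  · exact h.2

lemma restr_sup_conn {p : ℤ} {D a : Finset V} {s : Setoid V} (ha : a ⊆ D) {u v : V}
    (hu : u ∈ verts p D) (hv : v ∈ verts p D) :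
    (restr (verts p D) s ⊔ conn p ↑a) u v ↔ (s ⊔ conn p ↑a) u v := by
  have hle := sup_le_sup_right (restr_le (verts p D) s) (conn p ↑a)
  refine ⟨fun h => hle h, fun h => ?_⟩
  set R := restr (verts p D) s ⊔ conn p ↑a with hR
  have h0 : restr (verts p D) s ≤ R := le_sup_left
  have h1 : ∀ x y, x ∈ verts p D → y ∈ verts p D → s x y → R x y :=
    fun x y hx hy hxy => h0 (Or.inr ⟨⟨hx, hy⟩, hxy⟩)
  let R' : Setoid V :=
    { r := fun x y => s x y ∨ ∃ x' y', x' ∈ verts p D ∧ y' ∈ verts p D ∧ s x x' ∧ R x' y' ∧ s y' y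
      iseqv := by
        refine ⟨fun x => Or.inl (s.refl x), ?_, ?_⟩
        · rintro x y (h | ⟨x', y', hx', hy', h2, h3, h4⟩)
          · exact Or.inl (s.symm h)
          · exact Or.inr ⟨y', x', hy', hx', s.symm h4, R.symm h3, s.symm h2⟩
        · rintro x y z (h | ⟨x', y', hx', hy', h2, h3, h4⟩) (k | ⟨y'', z', hy'', hz', k2, k3, k4⟩)
          · exact Or.inl (s.trans h k)
          · exact Or.inr ⟨y'', z', hy'', hz', s.trans h k2, k3, k4⟩
          · exact Or.inr ⟨x', y', hx', hy', h2, h3, s.trans h4 k⟩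
          · exact Or.inr ⟨x', z', hx', hz', h2,
              R.trans h3 (R.trans (h1 _ _ hy' hy'' (s.trans h4 k2)) k3), k4⟩ }
  have h2 : s ⊔ conn p ↑a ≤ R' := by
    refine sup_le (fun x y h => Or.inl h) ((conn_le_iff).2 fun c hc => Or.inr ⟨_, _,
      lo_mem_verts (ha hc), hi_mem_verts (ha hc), s.refl _, ?_, s.refl _⟩)
    have h3 : conn p ↑a ≤ R := le_sup_right
    exact h3 (conn_step hc)
  rcases h2 h with h | ⟨x', y', hx', hy', h2, h3, h4⟩
  · exact h1 u v hu hv h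
  · exact R.trans (h1 _ _ hu hx' h2) (R.trans h3 (h1 _ _ hy' hv h4))

lemma exists_infinite_of_union {p : ℤ} {O : Set V} {ω : Finset V} {u : V}
    (h : (cl p (O ∪ ↑ω) u).Infinite) : ∃ w, conn p (O ∪ ↑ω) u w ∧ (cl p O w).Infinite := by
  by_contra! hcon
  refine h ?_
  have hfin : (⋃ w ∈ {w | w ∈ insert u (verts p ω) ∧ conn p (O ∪ ↑ω) u w}, cl p O w).Finite := by
    refine Set.Finite.biUnion ((insert u (verts p ω)).finite_toSet.subset fun w hw => hw.1)
      fun w hw => hcon w hw.2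
  refine hfin.subset fun v hv => ?_
  have h1 := conn_inv (fun v => ∃ w, (w ∈ insert u (verts p ω) ∧ conn p (O ∪ ↑ω) u w) ∧
    conn p O w v ∨ ¬ conn p (O ∪ ↑ω) u v) (fun c hc => ?_) (show conn p (O ∪ ↑ω) u v from hv)
  · obtain ⟨w, h | h⟩ := h1.mp ⟨u, Or.inl ⟨⟨Finset.mem_insert_self _ _, conn_refl p _ _⟩,
      conn_refl p _ _⟩⟩
    · exact Set.mem_biUnion (show w ∈ {w | _} from h.1) h.2
    · exact absurd hv h
  · have hs := conn_step (p := p) hc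
    by_cases hlo : conn p (O ∪ ↑ω) u (lo p c)
    · have hhi := conn_trans hlo hs
      simp only [hlo, hhi, not_true, or_false]
      rcases hc with hc | hc
      · have hs := conn_step (p := p) hc
        exact propext ⟨fun ⟨w, hw, h⟩ => ⟨w, hw, conn_trans h hs⟩,
          fun ⟨w, hw, h⟩ => ⟨w, hw, conn_trans h (conn_symm hs)⟩⟩
      · exact propext ⟨fun _ => ⟨_, ⟨Finset.mem_insert_of_mem (hi_mem_verts hc), hhi⟩,
          conn_refl p _ _⟩, fun _ => ⟨_, ⟨Finset.mem_insert_of_mem (lo_mem_verts hc), hlo⟩,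
          conn_refl p _ _⟩⟩
    · have hhi : ¬ conn p (O ∪ ↑ω) u (hi p c) := fun h => hlo (conn_trans h (conn_symm hs))
      simp only [hlo, hhi, not_false_eq_true, or_true]

lemma connI_sup_conn (p : ℤ) (O : Set V) (ω : Finset V) :
    connI p O ⊔ conn p ↑ω = connI p (O ∪ ↑ω) := by
  refine le_antisymm (sup_le ?_ ?_) ?_
  · intro u v h
    rcases connI_def.1 h with h | ⟨h, h'⟩
    · exact connI_def.2 (Or.inl (conn_mono Set.subset_union_left h))
    · exact connI_def.2 (Or.inr ⟨h.mono (cl_mono Set.subset_union_left _),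
        h'.mono (cl_mono Set.subset_union_left _)⟩)
  · exact fun u v h => connI_def.2 (Or.inl (conn_mono Set.subset_union_right h))
  · have hle : conn p (O ∪ ↑ω) ≤ connI p O ⊔ conn p ↑ω := by
      rw [conn_union]
      exact sup_le_sup_right (fun u v h => connI_def.2 (Or.inl h)) _
    have hle' : connI p O ≤ connI p O ⊔ conn p ↑ω := le_sup_left
    intro u v h
    rcases connI_def.1 h with h | ⟨h, h'⟩
    · exact hle h
    · obtain ⟨w, hw, hw'⟩ := exists_infinite_of_union h
      obtain ⟨x, hx, hx'⟩ := exists_infinite_of_union h'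
      exact Setoid.trans' _ (hle hw) (Setoid.trans' _ (hle' (connI_def.2 (Or.inr ⟨hw', hx'⟩)))
        (hle (conn_symm hx)))

lemma exists_cell_of_conn {p : ℤ} {O : Set V} {u v : V} (h : conn p O u v) (hne : u ≠ v) :
    ∃ c ∈ O, lo p c = u ∨ hi p c = u :=
  (verts_of_conn (conn_symm h)).resolve_left hne

lemma exists_cell_of_infinite {p : ℤ} {O : Set V} {u : V} (h : (cl p O u).Infinite) :
    ∃ c ∈ O, lo p c = u ∨ hi p c = u := by
  obtain ⟨v, hv, hne⟩ := h.exists_notMem_finset {u}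
  exact exists_cell_of_conn hv fun h => hne (by simp [h])

lemma adm_restr_connI {p : ℤ} {D : Finset V} {O : Set V} (hO : ∀ c ∈ O, c ∉ D) :
    Adm p D (restr (verts p D) (connI p O)) := by
  rintro v w (h | ⟨⟨hv, hw⟩, h⟩)
  · exact Or.inl h
  by_cases hne : v = w
  · exact Or.inl hne
  have key : ∀ x y, x ≠ y → connI p O x y → ∃ c ∉ D, lo p c = x ∨ hi p c = x := by
    intro x y hxy h
    obtain ⟨c, hc, h⟩ := (connI_def.1 h).elim (fun h => exists_cell_of_conn h hxy)
      fun h => exists_cell_of_infinite h.1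
    exact ⟨c, hO c hc, h⟩
  exact Or.inr ⟨⟨hv, key v w hne h⟩, hw, key w v (Ne.symm hne) (Setoid.symm' _ h)⟩

lemma adm_restr_conn {p : ℤ} {D : Finset V} {O : Set V} (hO : ∀ c ∈ O, c ∉ D) :
    Adm p D (restr (verts p D) (conn p O)) := by
  rintro v w (h | ⟨hvw, h⟩)
  · exact Or.inl h
  · exact adm_restr_connI hO v w (Or.inr ⟨hvw, connI_def.2 (Or.inl h)⟩)

/-- The finite-volume measure with the boundary condition induced by the cells `O` outside of
`D` is the dual of the one induced by the complementary cells. -/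
lemma Pr_restr_dual (hq : 1 ≤ q) {p : ℤ} {D : Finset V} {O : Set V} (hO : ∀ c ∈ O, c ∉ D)
    (A : Finset V → Prop) :
    Pr q p (restr (verts p D) (connI p O)) D (fun ω => A (D \ ω)) =
      Pr q (p + 1) (restr (verts (p + 1) D) (conn (p + 1) ((↑D ∪ O)ᶜ))) D A := by
  rw [Pr_dual hq (s' := restr (verts (p + 1) D) (conn (p + 1) ((↑D ∪ O)ᶜ)))
    (fun ω hω e he heω => ?_)]
  · exact Pr_congr fun ω hω => by rw [Finset.sdiff_sdiff_eq_self hω]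
  · rw [restr_sup_conn hω (lo_mem_verts he) (hi_mem_verts he),
      restr_sup_conn Finset.sdiff_subset (lo_mem_verts he) (hi_mem_verts he), connI_sup_conn,
      ← conn_union]
    have h1 : (O ∪ ↑ω) \ {e} = O ∪ ↑ω := by
      rw [sdiff_eq_left, Set.disjoint_singleton_right]
      rintro (h | h)
      · exact hO e h he
      · exact heω h
    have h2 : (O ∪ ↑ω)ᶜ \ {e} = (↑D ∪ O)ᶜ ∪ ↑(D \ insert e ω) := by
      ext c
      simp only [Set.mem_sdiff, Set.mem_compl_iff, Set.mem_union, Finset.mem_coe,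
        Set.mem_singleton_iff, Finset.mem_sdiff, Finset.mem_insert]
      have h3 := hO c
      have h4 := @hω c
      by_cases h5 : c ∈ O <;> by_cases h6 : c ∈ D <;> by_cases h7 : c ∈ ω <;>
        by_cases h8 : c = e <;> simp_all
    have := connI_iff_not_dual p (O ∪ ↑ω) e
    rwa [h1, h2] at this

end OutsideBC

section FiniteVolume
open scoped Classical
variable {q : ℝ}

lemma card_quot_eq_kk {X : Type*} {r : X → X → Prop} {W : Finset V} {R : Setoid V} {f : X → V}
    (hf : ∀ x, f x ∈ W) (hf' : ∀ w ∈ W, ∃ x, f x = w) (h1 : ∀ x y, r x y → R (f x) (f y))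
    (h2 : ∀ x y, R (f x) (f y) → Quot.mk r x = Quot.mk r y) : Nat.card (Quot r) = kk W R := by
  let F : Quot r → {c // c ∈ W.image (Quotient.mk R)} :=
    Quot.lift (fun x => ⟨Quotient.mk R (f x), Finset.mem_image_of_mem _ (hf x)⟩)
      fun x y h => Subtype.ext (Quotient.sound (h1 x y h))
  have hF : Function.Bijective F := by
    constructor
    · rintro ⟨x⟩ ⟨y⟩ h
      exact h2 x y (Quotient.exact (congrArg Subtype.val h))
    · rintro ⟨c, hc⟩
      obtain ⟨w, hw, rfl⟩ := Finset.mem_image.1 hc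
      obtain ⟨x, rfl⟩ := hf' w hw
      exact ⟨Quot.mk r x, rfl⟩
  rw [Nat.card_eq_of_bijective F hF, Nat.card_eq_fintype_card, Fintype.card_coe, kk]

variable {a : V} {t : ℤ} (S : HPCoord a t)

/-- The edges crossing the cells of `D`. -/
def HPCoord.edges (D : Finset V) : Finset (Edge AdjL) := D.image S.edge

lemma HPCoord.edge_mem_edges {D : Finset V} {c : V} : S.edge c ∈ S.edges D ↔ c ∈ D := by
  unfold HPCoord.edges
  rw [Finset.mem_image]
  exact ⟨fun ⟨d, hd, h⟩ => S.edge_injective h ▸ hd, fun h => ⟨c, h, rfl⟩⟩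

lemma HPCoord.mem_vertexSet {D : Finset V} {v : V} :
    S.T v ∈ vertexSet AdjL (S.edges D) ↔ v ∈ verts 0 D := by
  rw [mem_verts]
  constructor
  · rintro ⟨e, he, h⟩
    obtain ⟨c, rfl⟩ := S.edge_surjective e
    exact ⟨c, S.edge_mem_edges.1 he, S.inc_edge.1 h⟩
  · rintro ⟨c, hc, h⟩
    exact ⟨S.edge c, S.edge_mem_edges.2 hc, S.inc_edge.2 h⟩

lemma HPCoord.mem_bdry {D : Finset V} {v c : V} (hv : v ∈ verts 0 D) (hc : c ∉ D)
    (h : lo 0 c = v ∨ hi 0 c = v) : S.T v ∈ bdry AdjL 4 (S.edges D) := by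
  refine ⟨S.mem_vertexSet.2 hv, ?_⟩
  have hsub : ((S.edges D).filter fun e => Inc AdjL (S.T v) e) ⊆
      ((star v).erase c).image S.edge := by
    intro e he
    obtain ⟨he, h'⟩ := Finset.mem_filter.1 he
    obtain ⟨d, rfl⟩ := S.edge_surjective e
    rw [S.edge_mem_edges] at he
    exact Finset.mem_image_of_mem _ (Finset.mem_erase.2
      ⟨fun h => hc (h ▸ he), (S.inc_edge.1 h').elim lo_mem_star hi_mem_star⟩)
  have h4 : (star v).card ≤ 4 := Finset.card_le_four
  have := Finset.card_erase_lt_of_mem (h.elim lo_mem_star hi_mem_star)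
  have := (Finset.card_le_card hsub).trans Finset.card_image_le
  have hlt : ((S.edges D).filter fun e => Inc AdjL (S.T v) e).card < 4 := by omega
  unfold degree
  convert hlt

/-- The cells of `D` crossed by the open edges of a local configuration. -/
def HPCoord.openIn (D : Finset V) (η : {e // e ∈ S.edges D} → Bool) : Finset V :=
  D.filter fun c => extendBy AdjL (S.edges D) η (S.edge c) = true

/-- The cells outside of `D` crossed by open edges. -/
def HPCoord.outer (D : Finset V) (τ : Config AdjL) : Set V := S.cells true τ {e | e ∉ S.edges D}

lemma HPCoord.outer_notMem {D : Finset V} {τ : Config AdjL} :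
    ∀ c ∈ S.outer D τ, c ∉ D := fun _ hc h => hc.1 (S.edge_mem_edges.2 h)

lemma HPCoord.clusterCount_eq (D : Finset V) (τ : Config AdjL)
    (η : {e // e ∈ S.edges D} → Bool) :
    clusterCount AdjL 4 (S.edges D) (inducedBC AdjL 4 (S.edges D) τ)
        (extendBy AdjL (S.edges D) η) =
      kk (verts 0 D) (restr (verts 0 D) (connI 0 (S.outer D τ)) ⊔ conn 0 ↑(S.openIn D η)) := by
  set s := restr (verts 0 D) (connI 0 (S.outer D τ)) with hs
  set R := s ⊔ conn 0 ↑(S.openIn D η) with hR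
  have hs0 : s ≤ R := le_sup_left
  have hc0 : conn 0 ↑(S.openIn D η) ≤ R := le_sup_right
  have hmem : ∀ x : vertexSet AdjL (S.edges D), S.T.symm x.1 ∈ verts 0 D := fun x => by
    rw [← S.mem_vertexSet, S.T.apply_symm_apply]; exact x.2
  have hbase : ∀ u v : V, (ConnectedIn AdjL τ {e | e ∉ S.edges D} (S.T u) (S.T v) ∨
      (InfCluster AdjL τ {e | e ∉ S.edges D} (S.T u) ∧
        InfCluster AdjL τ {e | e ∉ S.edges D} (S.T v))) ↔ connI 0 (S.outer D τ) u v := by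
    intro u v
    rw [S.connectedIn_iff, S.infCluster_iff, S.infCluster_iff, connI_def]
    rfl
  unfold clusterCount
  refine card_quot_eq_kk (f := fun x => S.T.symm x.1) hmem
    (fun w hw => ⟨⟨S.T w, S.mem_vertexSet.2 hw⟩, by simp⟩) ?_ ?_
  · rintro x y (⟨e, he, hη, hx, hy⟩ | ⟨hx, hy, h⟩)
    · obtain ⟨c, rfl⟩ := S.edge_surjective e
      have hc : c ∈ S.openIn D η := Finset.mem_filter.2 ⟨S.edge_mem_edges.1 he, hη⟩
      have hstep := hc0 (conn_step (p := 0) (Finset.mem_coe.2 hc))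
      rw [← S.T.apply_symm_apply x.1, S.inc_edge] at hx
      rw [← S.T.apply_symm_apply y.1, S.inc_edge] at hy
      rcases hx with hx | hx <;> rcases hy with hy | hy
      · rw [← hx, ← hy]
      · rwa [hx, hy] at hstep
      · rw [hx, hy] at hstep; exact R.symm hstep
      · rw [← hx, ← hy]
    · refine hs0 (Or.inr ⟨⟨hmem x, hmem y⟩, ?_⟩)
      have key : ∀ b b' : bdry AdjL 4 (S.edges D), (inducedBC AdjL 4 (S.edges D) τ).r b b' →
          connI 0 (S.outer D τ) (S.T.symm b.1) (S.T.symm b'.1) := by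
        intro b b' hb
        induction (hb : Relation.EqvGen _ b b') with
        | rel b b' h =>
          rw [← hbase, S.T.apply_symm_apply, S.T.apply_symm_apply]; exact h
        | refl b => exact Setoid.refl' _ _
        | symm b b' h ih => exact Setoid.symm' _ ih
        | trans b b' b'' h h' ih ih' => exact Setoid.trans' _ ih ih'
      exact key _ _ h
  · intro x y hxy
    set r := fun u v : vertexSet AdjL (S.edges D) =>
      (∃ e ∈ S.edges D, extendBy AdjL (S.edges D) η e = true ∧ Inc AdjL u.1 e ∧
        Inc AdjL v.1 e) ∨
      ∃ hu : u.1 ∈ bdry AdjL 4 (S.edges D), ∃ hv : v.1 ∈ bdry AdjL 4 (S.edges D),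
        (inducedBC AdjL 4 (S.edges D) τ).r ⟨u.1, hu⟩ ⟨v.1, hv⟩ with hr
    let g : V → Option (Quot r) := fun v =>
      if h : v ∈ verts 0 D then some (Quot.mk r ⟨S.T v, S.mem_vertexSet.2 h⟩) else none
    have hg : ∀ v (h : v ∈ verts 0 D), g v = some (Quot.mk r ⟨S.T v, S.mem_vertexSet.2 h⟩) :=
      fun v h => dif_pos h
    have hle : R ≤ Setoid.ker g := by
      refine sup_le ?_ (conn_le_iff.2 fun c hc => ?_)
      · intro u v huv
        obtain h | ⟨⟨hu', hv'⟩, h⟩ := id huv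
        · rw [h]
        have hadm := adm_restr_connI S.outer_notMem u v huv
        obtain h' | ⟨⟨hu, c, hc, hcu⟩, hv, d, hd, hdv⟩ := hadm
        · rw [h']
        rw [Setoid.ker_def, hg u hu, hg v hv]
        exact congrArg some (Quot.sound (Or.inr ⟨S.mem_bdry hu hc hcu, S.mem_bdry hv hd hdv,
          Relation.EqvGen.rel _ _ ((hbase u v).2 h)⟩))
      · obtain ⟨hc, hη⟩ := Finset.mem_filter.1 (Finset.mem_coe.1 hc)
        rw [Setoid.ker_def, hg _ (lo_mem_verts hc), hg _ (hi_mem_verts hc)]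
        exact congrArg some (Quot.sound (Or.inl ⟨S.edge c, S.edge_mem_edges.2 hc, hη,
          S.inc_edge.2 (Or.inl rfl), S.inc_edge.2 (Or.inr rfl)⟩))
    have := hle hxy
    rw [Setoid.ker_def, hg _ (hmem x), hg _ (hmem y)] at this
    simpa using this

lemma HPCoord.openCount_eq (D : Finset V) (η : {e // e ∈ S.edges D} → Bool) :
    openCount AdjL (S.edges D) η = (S.openIn D η).card := by
  unfold openCount
  symm
  refine Finset.card_bij (fun c hc => ⟨S.edge c, S.edge_mem_edges.2 (Finset.mem_filter.1 hc).1⟩)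
    (fun c hc => ?_) (fun c hc d hd h => S.edge_injective (congrArg Subtype.val h)) ?_
  · obtain ⟨hc, h⟩ := Finset.mem_filter.1 hc
    unfold extendBy at h
    rw [dif_pos (S.edge_mem_edges.2 hc)] at h
    exact Finset.mem_filter.2 ⟨Finset.mem_univ _, h⟩
  · rintro ⟨e, he⟩ h
    obtain ⟨c, rfl⟩ := S.edge_surjective e
    refine ⟨c, Finset.mem_filter.2 ⟨S.edge_mem_edges.1 he, ?_⟩, rfl⟩
    unfold extendBy
    rw [dif_pos he]
    exact (Finset.mem_filter.1 h).2

lemma HPCoord.sum_openIn (D : Finset V) (F : Finset V → ℝ) :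
    ∑ η : {e // e ∈ S.edges D} → Bool, F (S.openIn D η) = ∑ ω ∈ D.powerset, F ω := by
  refine Finset.sum_bij (fun η _ => S.openIn D η)
    (fun η _ => Finset.mem_powerset.2 (Finset.filter_subset _ _)) ?_ ?_ fun _ _ => rfl
  · intro η _ η' _ h
    funext ⟨e, he⟩
    obtain ⟨c, rfl⟩ := S.edge_surjective e
    have h1 := Finset.ext_iff.1 h c
    unfold HPCoord.openIn extendBy at h1
    simp only [Finset.mem_filter, S.edge_mem_edges.1 he, dif_pos he, true_and] at h1
    exact Bool.eq_iff_iff.2 h1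
  · intro ω hω
    rw [Finset.mem_powerset] at hω
    refine ⟨fun e => decide (∃ c ∈ ω, S.edge c = e.1), Finset.mem_univ _, ?_⟩
    ext c
    unfold HPCoord.openIn extendBy
    rw [Finset.mem_filter]
    constructor
    · rintro ⟨hc, h⟩
      rw [dif_pos (S.edge_mem_edges.2 hc), decide_eq_true_eq] at h
      obtain ⟨d, hd, h⟩ := h
      exact S.edge_injective h ▸ hd
    · intro hc
      refine ⟨hω hc, ?_⟩
      rw [dif_pos (S.edge_mem_edges.2 (hω hc)), decide_eq_true_eq]
      exact ⟨c, hc, rfl⟩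

lemma pc_div_one_sub (q : ℝ) : pc q / (1 - pc q) = Real.sqrt q := by
  have : 0 < 1 + Real.sqrt q := by positivity
  have h : 1 - pc q = 1 / (1 + Real.sqrt q) := by unfold pc; field_simp; ring
  rw [h]; unfold pc; field_simp

lemma HPCoord.fkWeight_eq (D : Finset V) (τ : Config AdjL) (η : {e // e ∈ S.edges D} → Bool) :
    fkWeight AdjL (pc q) q 4 (S.edges D) (inducedBC AdjL 4 (S.edges D) τ) η =
      wt q 0 (restr (verts 0 D) (connI 0 (S.outer D τ))) D (S.openIn D η) := by
  unfold fkWeight wt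
  rw [pc_div_one_sub, S.openCount_eq, S.clusterCount_eq]

lemma HPCoord.fkFin_eq (hq : 1 ≤ q) (D : Finset V) (τ : Config AdjL) (A : Finset V → Prop) :
    fkFin AdjL (pc q) q 4 (S.edges D) (inducedBC AdjL 4 (S.edges D) τ)
        {η | A (S.openIn D η)} =
      ENNReal.ofReal (Pr q 0 (restr (verts 0 D) (connI 0 (S.outer D τ))) D A) := by
  set s := restr (verts 0 D) (connI 0 (S.outer D τ)) with hs
  have hpos := mass_true_pos hq 0 s D
  unfold fkFin
  simp only [S.fkWeight_eq, Measure.smul_apply, Measure.finsetSum_apply, smul_eq_mul]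
  rw [← hs]
  have h1 : ∑ η : {e // e ∈ S.edges D} → Bool, ENNReal.ofReal (wt q 0 s D (S.openIn D η)) =
      ENNReal.ofReal (mass q 0 s D fun _ => True) := by
    rw [mass_eq_sum, ← S.sum_openIn,
      ENNReal.ofReal_sum_of_nonneg fun η _ => by simp [(wt_pos hq 0 s D _).le]]
    simp
  have h2 : ∑ η : {e // e ∈ S.edges D} → Bool, ENNReal.ofReal (wt q 0 s D (S.openIn D η)) *
      Measure.dirac η {η | A (S.openIn D η)} = ENNReal.ofReal (mass q 0 s D A) := by
    rw [mass_eq_sum, ← S.sum_openIn, ENNReal.ofReal_sum_of_nonneg fun η _ => by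
      split_ifs
      · exact (wt_pos hq 0 s D _).le
      · exact le_rfl]
    refine Finset.sum_congr rfl fun η _ => ?_
    rw [Measure.dirac_apply]
    by_cases h : A (S.openIn D η) <;> simp [h]
  rw [h1, h2, Pr, ENNReal.ofReal_div_of_pos hpos, ENNReal.div_eq_inv_mul]

/-- The cells of `D` crossed by open edges (`b = true`), or by dual-open edges (`b = false`). -/
def HPCoord.inner (b : Bool) (D : Finset V) (ω : Config AdjL) : Finset V :=
  D.filter fun c => ω (S.edge c) = b

lemma HPCoord.inner_true (D : Finset V) (ω : Config AdjL) :
    S.inner true D ω = S.openIn D (restrictD AdjL (S.edges D) ω) := by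
  refine Finset.filter_congr fun c hc => ?_
  unfold extendBy restrictD
  rw [dif_pos (S.edge_mem_edges.2 hc)]

lemma HPCoord.inner_false (D : Finset V) (ω : Config AdjL) :
    S.inner false D ω = D \ S.openIn D (restrictD AdjL (S.edges D) ω) := by
  rw [← S.inner_true]
  ext c
  simp only [HPCoord.inner, Finset.mem_filter, Finset.mem_sdiff]
  cases ω (S.edge c) <;> simp

variable {φ : Measure (Config AdjL)}

/-- A bound on the probability of a primal event under all admissible boundary conditions. -/
lemma HPCoord.measure_inner_true_le (hq : 1 ≤ q) (hφ : IsGibbs AdjL 4 (pc q) q φ) {D : Finset V}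
    {A : Finset V → Prop} {ε : ℝ} (h : ∀ s, Adm 0 D s → Pr q 0 s D A ≤ ε) :
    φ {ω | A (S.inner true D ω)} ≤ ENNReal.ofReal ε := by
  simp only [S.inner_true]
  refine hφ.le_of_forall (S.edges D) {η | A (S.openIn D η)} fun τ => ?_
  rw [S.fkFin_eq hq]
  exact ENNReal.ofReal_le_ofReal (h _ (adm_restr_connI S.outer_notMem))

/-- A bound on the probability of a dual event under all admissible boundary conditions. -/
lemma HPCoord.measure_inner_false_le (hq : 1 ≤ q) (hφ : IsGibbs AdjL 4 (pc q) q φ) {D : Finset V}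
    {A : Finset V → Prop} {ε : ℝ} (h : ∀ s, Adm 1 D s → Pr q 1 s D A ≤ ε) :
    φ {ω | A (S.inner false D ω)} ≤ ENNReal.ofReal ε := by
  simp only [S.inner_false]
  refine hφ.le_of_forall (S.edges D) {η | A (D \ S.openIn D η)} fun τ => ?_
  rw [S.fkFin_eq hq D τ fun ω => A (D \ ω), Pr_restr_dual hq S.outer_notMem]
  refine ENNReal.ofReal_le_ofReal (h _ (adm_restr_conn fun c hc => ?_))
  simp only [Set.mem_compl_iff, Set.mem_union, Finset.mem_coe, not_or] at hc
  exact hc.1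

end FiniteVolume

section AlmostSure
open scoped Classical
variable {q : ℝ} {a : V} {t : ℤ} (S : HPCoord a t) {φ : Measure (Config AdjL)}

lemma HPCoord.cells_subset_esc (b : Bool) (D : Finset V) (ω : Config AdjL) :
    S.cells b ω (hpE a t) ⊆ Hc \ ↑D ∪ ↑(S.inner b D ω) := by
  rw [S.cells_hpE]
  rintro c ⟨hc, h⟩
  by_cases hD : c ∈ D
  · exact Or.inr (Finset.mem_coe.2 (Finset.mem_filter.2 ⟨hD, h⟩))
  · exact Or.inl ⟨hc, hD⟩

lemma HPCoord.inner_subset_cells (b : Bool) {D : Finset V} (hD : (D : Set V) ⊆ Hc)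
    (ω : Config AdjL) : ↑(S.inner b D ω) ⊆ S.cells b ω (hpE a t) := by
  rw [S.cells_hpE]
  intro c hc
  obtain ⟨hc, h⟩ := Finset.mem_filter.1 (Finset.mem_coe.1 hc)
  exact ⟨hD hc, h⟩

lemma HPCoord.ae_touchesLine (hq : 1 ≤ q) {p : ℤ} {b : Bool}
    (hφ : ∀ (D : Finset V) (A : Finset V → Prop) (ε : ℝ),
      (∀ s, Adm p D s → Pr q p s D A ≤ ε) → φ {ω | A (S.inner b D ω)} ≤ ENNReal.ofReal ε) :
    ∀ᵐ ω ∂φ, TouchesLine p (S.cells b ω (hpE a t)) := by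
  have key : ∀ (u : V) (k : ℕ), ∀ᵐ ω ∂φ, ¬ ((cl p (S.cells b ω (hpE a t)) u).Infinite ∧
      ∀ x : ℤ, conn p (S.cells b ω (hpE a t)) u (x, 0) → |x| ≤ k) := by
    intro u k
    rw [ae_iff]
    refine le_antisymm (ENNReal.le_of_forall_pos_le_add fun ε hε _ => ?_) (zero_le)
    rw [zero_add]
    obtain ⟨N, hN⟩ := exists_avoid_le hq p k u (ε := (ε : ℝ)) (by exact_mod_cast hε)
    refine (measure_mono ?_).trans ((hφ (box N N) _ ε hN).trans
      (ENNReal.ofReal_coe_nnreal).le)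
    intro ω hω
    rw [Set.mem_ofPred_eq, not_not] at hω
    refine ⟨?_, hω.1.mono (cl_mono (S.cells_subset_esc b _ ω) u)⟩
    rintro ⟨⟨x, y⟩, ⟨-, rfl, hx⟩, h⟩
    have := hω.2 x (conn_symm (conn_mono (S.inner_subset_cells b (box_Hc N N) ω) h))
    simp only at hx
    omega
  filter_upwards [ae_all_iff.2 fun u => ae_all_iff.2 (key u)] with ω hω u hu
  by_contra hfin
  rw [Set.not_infinite] at hfin
  obtain ⟨k, hk⟩ := (hfin.image Int.natAbs).bddAbove
  refine hω u k ⟨hu, fun x hx => ?_⟩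
  rw [Int.abs_eq_natAbs]
  exact_mod_cast hk (Set.mem_image_of_mem Int.natAbs hx)

end AlmostSure

end FK

open FK in
/-- **Theorem.** Let `φ` be a tail-trivial Gibbs measure for FK-percolation at the
self-dual point.  Almost surely, every half-plane contains at most one infinite primal
cluster and at most one infinite dual cluster of the restriction of the configuration to
the half-plane, and any such infinite cluster contains infinitely many points of the
boundary line of the half-plane. -/
theorem halfplane_unique_infinite_cluster (q : ℝ) (hq : 1 ≤ q)
    (φ : Measure (Config AdjL)) (hφ : IsGibbs AdjL 4 (pc q) q φ)
    (htail : TailTrivial AdjL φ)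
    (a : V) (ha : a = (0, 1) ∨ a = (0, -1) ∨ a = (1, 0) ∨ a = (-1, 0)) (t : ℤ) :
    φ {ω |
        (∀ u v : V, InfCluster AdjL ω (hpE a t) u → InfCluster AdjL ω (hpE a t) v →
          ConnectedIn AdjL ω (hpE a t) u v) ∧
        (∀ u : V, InfCluster AdjL ω (hpE a t) u →
          {v : V | v ∈ hpLine a t ∧ ConnectedIn AdjL ω (hpE a t) u v}.Infinite) ∧
        (∀ w w' : V, DualInfCluster ω (hpE a t) w → DualInfCluster ω (hpE a t) w' →
          DualConnectedIn ω (hpE a t) w w') ∧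
        (∀ w : V, DualInfCluster ω (hpE a t) w →
          {w' : V | w' ∈ hpLine a t ∧ DualConnectedIn ω (hpE a t) w w'}.Infinite)} = 1 := by
  have := hφ.1
  obtain ⟨S⟩ := exists_hpCoord a ha t
  refine (measure_congr (eventuallyEq_univ.2 ?_)).trans measure_univ
  filter_upwards [S.ae_touchesLine hq (p := 0) (b := true)
      fun _ _ _ h => S.measure_inner_true_le hq hφ h,
    S.ae_touchesLine hq (p := 1) (b := false)
      fun _ _ _ h => S.measure_inner_false_le hq hφ h] with ω h0 h1
  exact S.conclusion h0 h1
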